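/- arXiv:2605.01824 — 4 statements merged into one kernel-verified Lean document; each statement's English description precedes it below -/
import Mathlib

section
/- Let K ⊂ ℝ be the attractor of a homogeneous IFS ℱ = {f_i(x) = λx + a_i}_{i=1}^ℓ satisfying the strong separation condition, where 0 < λ < 1. Let 0 = t_0 < t_1 < ⋯ < t_m. If ⋃_{j=0}^m (K + t_j) is a self-similar set, then for every k ∈ ℕ the union ⋃_{j=0}^m (K + λ^{−k} t_j) is also a self-similar set. -/
/-- A set `S ⊆ ℝ` is self-similar if it is the attractor (unique nonempty compact
invariant set) of a finite IFS of contractive similitudes on `ℝ`. -/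
def IsSelfSimilar (S : Set ℝ) : Prop :=
  S.Nonempty ∧ IsCompact S ∧
    ∃ (n : ℕ) (r a : Fin n → ℝ), 0 < n ∧ (∀ i, r i ≠ 0 ∧ |r i| < 1) ∧
      S = ⋃ i, (fun x => r i * x + a i) '' S

/-- `S` is a finite union of images of `T` under similitudes of ratio at most `ε`. -/
def IsTiledBy (ε : ℝ) (S T : Set ℝ) : Prop :=
  ∃ P : Set (ℝ × ℝ), P.Finite ∧ (∀ p ∈ P, p.1 ≠ 0 ∧ |p.1| ≤ ε) ∧
    S = ⋃ p ∈ P, (fun x => p.1 * x + p.2) '' T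

namespace IsTiledBy

theorem trans {ε δ : ℝ} {S T U : Set ℝ} (hST : IsTiledBy ε S T) (hTU : IsTiledBy δ T U) :
    IsTiledBy (ε * δ) S U := by
  obtain ⟨P, hP, hPr, hS⟩ := hST
  obtain ⟨Q, hQ, hQr, hT⟩ := hTU
  refine ⟨Set.image2 (fun p q : ℝ × ℝ => (p.1 * q.1, p.1 * q.2 + p.2)) P Q,
    hP.image2 _ hQ, ?_, ?_⟩
  · rintro _ ⟨p, hp, q, hq, rfl⟩
    refine ⟨mul_ne_zero (hPr p hp).1 (hQr q hq).1, ?_⟩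
    rw [abs_mul]
    exact mul_le_mul (hPr p hp).2 (hQr q hq).2 (abs_nonneg _)
      ((abs_nonneg _).trans (hPr p hp).2)
  · ext x
    rw [hS, hT]
    simp only [Set.mem_iUnion, Set.mem_image, exists_prop]
    constructor
    · rintro ⟨p, hp, _, ⟨q, hq, z, hz, rfl⟩, rfl⟩
      exact ⟨_, ⟨p, hp, q, hq, rfl⟩, z, hz, by ring⟩
    · rintro ⟨_, ⟨p, hp, q, hq, rfl⟩, z, hz, rfl⟩
      exact ⟨p, hp, _, ⟨q, hq, z, hz, rfl⟩, by ring⟩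

theorem mono {ε δ : ℝ} {S T : Set ℝ} (h : IsTiledBy ε S T) (hεδ : ε ≤ δ) :
    IsTiledBy δ S T := by
  obtain ⟨P, hP, hPr, hS⟩ := h
  exact ⟨P, hP, fun p hp => ⟨(hPr p hp).1, (hPr p hp).2.trans hεδ⟩, hS⟩

theorem iUnion {ι : Type*} [Finite ι] {ε : ℝ} {S : ι → Set ℝ} {T : Set ℝ}
    (h : ∀ i, IsTiledBy ε (S i) T) : IsTiledBy ε (⋃ i, S i) T := by
  choose P hP hPr hS using h
  refine ⟨⋃ i, P i, Set.finite_iUnion hP, ?_, ?_⟩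
  · intro p hp
    obtain ⟨i, hi⟩ := Set.mem_iUnion.1 hp
    exact hPr i p hi
  · rw [Set.biUnion_iUnion]
    exact Set.iUnion_congr hS

theorem image_affine {c : ℝ} (hc : c ≠ 0) (d : ℝ) (S : Set ℝ) :
    IsTiledBy |c| ((fun x => c * x + d) '' S) S :=
  ⟨{(c, d)}, Set.finite_singleton _, by simpa using hc, by simp⟩

theorem of_image_affine {c : ℝ} (hc : c ≠ 0) (d : ℝ) (S : Set ℝ) :
    IsTiledBy |c⁻¹| S ((fun x => c * x + d) '' S) := by
  refine ⟨{(c⁻¹, -c⁻¹ * d)}, Set.finite_singleton _, by simpa using hc, ?_⟩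
  simp only [Set.mem_singleton_iff, Set.iUnion_iUnion_eq_left, Set.image_image]
  have : (fun x => c⁻¹ * (c * x + d) + -c⁻¹ * d) = id := by
    funext x
    field_simp
    simp
  rw [this, Set.image_id]

/-- A clopen piece of a set finely tiled by `T` is itself finely tiled by `T`. -/
theorem of_union {U R T : Set ℝ} (hU : IsCompact U) (hR : IsClosed R) (hUR : Disjoint U R)
    (hT : Bornology.IsBounded T) (h : ∀ ε > 0, IsTiledBy ε (U ∪ R) T) :
    ∀ ε > 0, IsTiledBy ε U T := by
  intro ε hε
  obtain ⟨r, hr, hdist⟩ := Metric.exists_pos_forall_lt_edist hU hR hUR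
  obtain ⟨M, hM⟩ := Metric.isBounded_iff.1 hT
  have hN : 0 < max M 1 := lt_max_of_lt_right one_pos
  have hr' : (0 : ℝ) < r := hr
  obtain ⟨P, hP, hPr, hS⟩ := h (min ε (r / max M 1)) (lt_min hε (div_pos hr' hN))
  refine ⟨{p ∈ P | (fun x => p.1 * x + p.2) '' T ⊆ U}, hP.subset (Set.sep_subset _ _),
    fun p hp => ⟨(hPr p hp.1).1, (hPr p hp.1).2.trans (min_le_left _ _)⟩, ?_⟩
  refine Set.Subset.antisymm ?_ (Set.iUnion₂_subset fun p hp => hp.2)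
  intro x hx
  have hx' := hS.subset (Or.inl hx)
  simp only [Set.mem_iUnion] at hx'
  obtain ⟨p, hp, z, hz, rfl⟩ := hx'
  refine Set.mem_biUnion (x := p) ⟨hp, ?_⟩ ⟨z, hz, rfl⟩
  rintro _ ⟨y, hy, rfl⟩
  have hy' : p.1 * y + p.2 ∈ U ∪ R :=
    hS.symm.subset (Set.mem_biUnion (x := p) hp ⟨y, hy, rfl⟩)
  refine hy'.resolve_right fun hyR => ?_
  have hlt := hdist _ hx _ hyR
  rw [edist_nndist, ENNReal.coe_lt_coe, ← NNReal.coe_lt_coe, coe_nndist, Real.dist_eq] at hlt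
  have hle : |p.1 * z + p.2 - (p.1 * y + p.2)| ≤ r := by
    calc |p.1 * z + p.2 - (p.1 * y + p.2)| = |p.1| * |z - y| := by
          rw [← abs_mul]; congr 1; ring
      _ ≤ r / max M 1 * max M 1 := by
          refine mul_le_mul ((hPr p hp).2.trans (min_le_right _ _)) ?_ (abs_nonneg _)
            (div_pos hr' hN).le
          exact (hM hz hy).trans (le_max_left _ _)
      _ = r := div_mul_cancel₀ _ hN.ne'
  exact absurd hlt hle.not_gt

theorem isSelfSimilar {ε : ℝ} {S : Set ℝ} (hε : ε < 1) (hne : S.Nonempty) (hS : IsCompact S)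
    (h : IsTiledBy ε S S) : IsSelfSimilar S := by
  obtain ⟨P, hP, hPr, hSP⟩ := h
  obtain ⟨x, hx⟩ := hne
  have hx' := hSP.subset hx
  simp only [Set.mem_iUnion] at hx'
  obtain ⟨p, hp, -⟩ := hx'
  have : Finite P := hP
  have : Nonempty P := ⟨⟨p, hp⟩⟩
  let e := Finite.equivFin P
  refine ⟨⟨x, hx⟩, hS, Nat.card P, fun i => (e.symm i).1.1, fun i => (e.symm i).1.2,
    Nat.card_pos, fun i => ?_, ?_⟩
  · have := hPr _ (e.symm i).2
    exact ⟨this.1, this.2.trans_lt hε⟩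
  · rw [e.symm.surjective.iUnion_comp (fun q : P => (fun x => q.1.1 * x + q.1.2) '' S),
      ← Set.biUnion_eq_iUnion P (fun q _ => (fun x => q.1 * x + q.2) '' S)]
    exact hSP

end IsTiledBy

theorem IsSelfSimilar.isTiledBy {S : Set ℝ} (h : IsSelfSimilar S) :
    ∀ ε > 0, IsTiledBy ε S S := by
  obtain ⟨-, -, n, r, a, hn, hr, hS⟩ := h
  have : Nonempty (Fin n) := ⟨⟨0, hn⟩⟩
  obtain ⟨i₀, hi₀⟩ := Finite.exists_max fun i => |r i|
  have hone : IsTiledBy |r i₀| S S := by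
    have := IsTiledBy.iUnion fun i =>
      (IsTiledBy.image_affine (hr i).1 (a i) S).mono (hi₀ i)
    rwa [← hS] at this
  have hpow : ∀ k : ℕ, IsTiledBy (|r i₀| ^ (k + 1)) S S := by
    intro k
    induction k with
    | zero => simpa using hone
    | succ k ih => rw [pow_succ]; exact ih.trans hone
  intro ε hε
  obtain ⟨k, hk⟩ := exists_pow_lt_of_lt_one hε (hr i₀).2
  refine (hpow k).mono (le_trans ?_ hk.le)
  exact pow_le_pow_of_le_one (abs_nonneg _) (hr i₀).2.le k.le_succ

section Homogeneous

variable {ι : Type*} [Finite ι] {lam : ℝ} {a : ι → ℝ} {K : Set ℝ}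

/-- The `k`-th iterate of a homogeneous iterated function system. -/
theorem exists_finite_translates_pow (hK : K = ⋃ i, (fun x => lam * x + a i) '' K) (k : ℕ) :
    ∃ C : Set ℝ, C.Finite ∧ K = ⋃ c ∈ C, (fun x => lam ^ k * x + c) '' K := by
  induction k with
  | zero => exact ⟨{0}, Set.finite_singleton _, by simp⟩
  | succ k ih =>
    obtain ⟨C, hC, hKC⟩ := ih
    refine ⟨Set.image2 (fun c i => lam ^ k * a i + c) C Set.univ,
      hC.image2 _ Set.finite_univ, ?_⟩
    ext x
    constructor
    · intro hx
      rw [hKC] at hx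
      simp only [Set.mem_iUnion] at hx
      obtain ⟨c, hc, y, hy, rfl⟩ := hx
      rw [hK] at hy
      obtain ⟨i, z, hz, rfl⟩ := Set.mem_iUnion.1 hy
      exact Set.mem_biUnion ⟨c, hc, i, trivial, rfl⟩ ⟨z, hz, by ring⟩
    · intro hx
      simp only [Set.mem_iUnion] at hx
      obtain ⟨_, ⟨c, hc, i, -, rfl⟩, z, hz, rfl⟩ := hx
      rw [hKC]
      refine Set.mem_biUnion hc ⟨lam * z + a i, ?_, by ring⟩
      rw [hK]
      exact Set.mem_iUnion.2 ⟨i, z, hz, rfl⟩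

/-- Under strong separation, the cylinders containing a given point are clopen. -/
theorem exists_clopen_cylinder (hlam : lam ≠ 0) (hcpt : IsCompact K)
    (hK : K = ⋃ i, (fun x => lam * x + a i) '' K)
    (hSSC : ∀ i j, i ≠ j →
      Disjoint ((fun x => lam * x + a i) '' K) ((fun x => lam * x + a j) '' K))
    {p : ℝ} (hp : p ∈ K) (n : ℕ) :
    ∃ (b : ℝ) (R : Set ℝ), p ∈ (fun x => lam ^ n * x + b) '' K ∧ IsCompact R ∧
      Disjoint ((fun x => lam ^ n * x + b) '' K) R ∧
      K = (fun x => lam ^ n * x + b) '' K ∪ R := by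
  induction n with
  | zero => exact ⟨0, ∅, by simpa using hp, isCompact_empty, by simp, by simp⟩
  | succ n ih =>
    obtain ⟨b, R, ⟨q, hq, rfl⟩, hR, hdisj, hKR⟩ := ih
    rw [hK] at hq
    obtain ⟨i, z, hz, rfl⟩ := Set.mem_iUnion.1 hq
    let g : ℝ → ℝ := fun x => lam ^ n * x + b
    have hg : Function.Injective g := fun x y hxy => by
      have : lam ^ n * x + b = lam ^ n * y + b := hxy
      exact mul_left_cancel₀ (pow_ne_zero n hlam) (add_right_cancel this)
    have hgi : (fun x => lam ^ (n + 1) * x + (lam ^ n * a i + b)) '' K =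
        g '' ((fun x => lam * x + a i) '' K) := by
      rw [Set.image_image]
      exact Set.image_congr fun x _ => by simp only [g]; ring
    have hsub : ∀ j, (fun x => lam * x + a j) '' K ⊆ K := fun j =>
      (Set.subset_iUnion (fun j => (fun x => lam * x + a j) '' K) j).trans hK.symm.subset
    have hsplit : K = (fun x => lam * x + a i) '' K ∪
        ⋃ j : {j // j ≠ i}, (fun x => lam * x + a j) '' K := by
      refine Set.Subset.antisymm ?_
        (Set.union_subset (hsub i) (Set.iUnion_subset fun j => hsub j))
      intro x hx
      rw [hK] at hx
      obtain ⟨j, hj⟩ := Set.mem_iUnion.1 hx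
      by_cases hji : j = i
      · exact Or.inl (hji ▸ hj)
      · exact Or.inr (Set.mem_iUnion.2 ⟨⟨j, hji⟩, hj⟩)
    refine ⟨lam ^ n * a i + b,
      g '' (⋃ j : {j // j ≠ i}, (fun x => lam * x + a j) '' K) ∪ R, ?_, ?_, ?_, ?_⟩
    · exact ⟨z, hz, by ring⟩
    · refine IsCompact.union (IsCompact.image (isCompact_iUnion fun j => ?_) ?_) hR
      · exact hcpt.image (by fun_prop)
      · simp only [g]; fun_prop
    · rw [hgi, Set.disjoint_union_right]
      refine ⟨(Set.disjoint_image_iff hg).2 ?_, hdisj.mono_left (Set.image_mono (hsub i))⟩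
      exact Set.disjoint_iUnion_right.2 fun j => hSSC i j j.2.symm
    · rw [hgi, ← Set.union_assoc, ← Set.image_union, ← hsplit]
      exact hKR

end Homogeneous

theorem stmt_5 (ℓ : ℕ) (hℓ : 0 < ℓ) (lam : ℝ) (hlam : 0 < lam ∧ lam < 1) (a : Fin ℓ → ℝ)
    (K : Set ℝ) (hne : K.Nonempty) (hcpt : IsCompact K)
    (hK : K = ⋃ i, (fun x => lam * x + a i) '' K)
    (hSSC : ∀ i j : Fin ℓ, i ≠ j →
      Disjoint ((fun x => lam * x + a i) '' K) ((fun x => lam * x + a j) '' K))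
    (m : ℕ) (t : Fin (m + 1) → ℝ) (ht0 : t 0 = 0) (ht : StrictMono t)
    (hself : IsSelfSimilar (⋃ j, (· + t j) '' K)) :
    ∀ k : ℕ, 1 ≤ k → IsSelfSimilar (⋃ j, (· + t j / lam ^ k) '' K) := by
  obtain ⟨hl0, hl1⟩ := hlam
  have hpow (n : ℕ) : lam ^ n ≠ 0 := ne_of_gt (pow_pos hl0 n)
  -- A small cylinder at the minimum of `K` is clopen in the whole union.
  have hKtiled : ∀ ε > 0, IsTiledBy ε K (⋃ j, (· + t j) '' K) := by
    obtain ⟨p, hp, hpmin⟩ := hcpt.exists_isLeast hne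
    obtain ⟨M, hM⟩ := Metric.isBounded_iff.1 hcpt.isBounded
    obtain ⟨n, hn⟩ : ∃ n : ℕ, ∀ j, j ≠ 0 → lam ^ n * M < t j := by
      have : ∀ᶠ n : ℕ in Filter.atTop, ∀ j, j ≠ 0 → lam ^ n * M < t j := by
        refine Filter.eventually_all.2 fun j => ?_
        by_cases hj : j = 0
        · simp [hj]
        · have htj : 0 < t j := ht0 ▸ ht (Fin.pos_of_ne_zero hj)
          have hlim := (tendsto_pow_atTop_nhds_zero_of_lt_one hl0.le hl1).mul_const M
          rw [zero_mul] at hlim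
          exact (hlim.eventually_lt_const htj).mono fun _ h _ => h
      exact this.exists
    obtain ⟨b, R, ⟨q, hq, hqp⟩, hR, hdisj, hKR⟩ :=
      exists_clopen_cylinder hl0.ne' hcpt hK hSSC hp n
    set U := (fun x => lam ^ n * x + b) '' K
    have hUF : (⋃ j, (· + t j) '' K) =
        U ∪ (R ∪ ⋃ j : {j // j ≠ 0}, (· + t j.1) '' K) := by
      rw [← Set.union_assoc, ← hKR]
      ext x
      simp only [Set.mem_iUnion, Set.mem_union]
      constructor
      · rintro ⟨j, hj⟩
        by_cases hj0 : j = 0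
        · subst hj0
          left
          simpa [ht0] using hj
        · exact Or.inr ⟨⟨j, hj0⟩, hj⟩
      · rintro (hx | ⟨j, hj⟩)
        · exact ⟨0, by simpa [ht0] using hx⟩
        · exact ⟨j, hj⟩
    have hfine : ∀ ε > 0, IsTiledBy ε U (⋃ j, (· + t j) '' K) := by
      refine IsTiledBy.of_union (R := R ∪ ⋃ j : {j // j ≠ 0}, (· + t j.1) '' K)
        (hcpt.image (by fun_prop)) ?_ ?_ hself.2.1.isBounded ?_
      · exact (hR.union (isCompact_iUnion fun j => hcpt.image (by fun_prop))).isClosed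
      · refine Set.disjoint_union_right.2 ⟨hdisj, Set.disjoint_iUnion_right.2 fun j => ?_⟩
        rw [Set.disjoint_left]
        rintro _ ⟨x, hx, rfl⟩ ⟨y, hy, hxy⟩
        have h1 : x - q ≤ M := (le_abs_self _).trans (hM hx hq)
        have h2 := mul_le_mul_of_nonneg_left h1 (pow_pos hl0 n).le
        have h3 := hn j j.2
        have h4 := hpmin hy
        simp only at hqp hxy
        linarith
      · rw [← hUF]
        exact hself.isTiledBy
    intro ε hε
    have hc : 0 < |(lam ^ n)⁻¹| := abs_pos.2 (inv_ne_zero (hpow n))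
    refine ((IsTiledBy.of_image_affine (hpow n) b K).trans
      (hfine (ε / |(lam ^ n)⁻¹|) (div_pos hε hc))).mono ?_
    rw [mul_div_cancel₀ _ hc.ne']
  intro k _
  set G := ⋃ j, (· + t j / lam ^ k) '' K with hG
  have hFG : IsTiledBy 1 (⋃ j, (· + t j) '' K) G := by
    obtain ⟨C, hC, hKC⟩ := exists_finite_translates_pow hK k
    refine ⟨(fun c => (lam ^ k, c)) '' C, hC.image _, ?_, ?_⟩
    · rintro _ ⟨c, -, rfl⟩
      exact ⟨hpow k, by rw [abs_of_pos (pow_pos hl0 k)]; exact pow_le_one₀ hl0.le hl1.le⟩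
    · rw [Set.biUnion_image]
      ext x
      simp only [hG, Set.mem_iUnion, Set.mem_image]
      constructor
      · rintro ⟨j, y, hy, rfl⟩
        rw [hKC] at hy
        simp only [Set.mem_iUnion] at hy
        obtain ⟨c, hc, z, hz, rfl⟩ := hy
        refine ⟨c, hc, _, ⟨j, z, hz, rfl⟩, ?_⟩
        have := hpow k
        field_simp
        ring
      · rintro ⟨c, hc, _, ⟨j, z, hz, rfl⟩, rfl⟩
        refine ⟨j, lam ^ k * z + c, ?_, ?_⟩
        · rw [hKC]
          exact Set.mem_biUnion hc ⟨z, hz, rfl⟩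
        · have := hpow k
          field_simp
          ring
  have hGG : IsTiledBy (1 / 2) G G := by
    refine IsTiledBy.iUnion fun j => ?_
    have hshift := IsTiledBy.image_affine one_ne_zero (t j / lam ^ k) K
    simp only [one_mul, abs_one] at hshift
    exact ((hshift.trans (hKtiled (1 / 2) (by norm_num))).trans hFG).mono (by norm_num)
  refine hGG.isSelfSimilar (by norm_num) ?_ ?_
  · obtain ⟨x, hx⟩ := hne
    exact ⟨_, Set.mem_iUnion.2 ⟨0, x, hx, rfl⟩⟩
  · exact isCompact_iUnion fun j => hcpt.image (by fun_prop)
end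

section
/- Let K ⊂ ℝ be a self-similar set satisfying the strong separation condition, and let m ≥ 1. Then the set {(t_1,…,t_m) ∈ ℝ^m : 0 = t_0 < t_1 < ⋯ < t_m and ⋃_{j=0}^m (K + t_j) is a self-similar set} is at most countable. -/
/-- The composition of the maps `x ↦ r i * x + a i` along a word. -/
def wordMap {ℓ : ℕ} (r a : Fin ℓ → ℝ) : List (Fin ℓ) → ℝ → ℝ
  | [], x => x
  | i :: w, x => r i * wordMap r a w x + a i

/-- The product of the entries of `r` along a word. -/
def wordRatio {ℓ : ℕ} (r : Fin ℓ → ℝ) : List (Fin ℓ) → ℝ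
  | [] => 1
  | i :: w => r i * wordRatio r w

/-- `K` is the attractor of the maps `x ↦ r i * x + a i`, whose images of `K` are `δ`-separated;
the contraction ratios lie in `[ρ, σ] ⊆ (0, 1)`, the diameter of `K` is at most `D`, and `K`
has a gap. -/
structure IsSeparatedAttractor {ℓ : ℕ} (r a : Fin ℓ → ℝ) (K : Set ℝ) (δ ρ σ D : ℝ) :
    Prop where
  compact : IsCompact K
  nonempty : K.Nonempty
  maps : ∀ i, ∀ x ∈ K, r i * x + a i ∈ K
  cover : ∀ x ∈ K, ∃ i, ∃ y ∈ K, r i * y + a i = x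
  sep : ∀ i j, i ≠ j → ∀ x ∈ K, ∀ y ∈ K, δ ≤ |(r i * x + a i) - (r j * y + a j)|
  sep_pos : 0 < δ
  lower_pos : 0 < ρ
  lower_le : ∀ i, ρ ≤ |r i|
  le_upper : ∀ i, |r i| ≤ σ
  upper_lt : σ < 1
  diam_pos : 0 < D
  diam_le : ∀ x ∈ K, ∀ y ∈ K, |x - y| ≤ D
  gap : ∃ g ∈ K, ∃ h ∈ K, g < h ∧ ∀ x ∈ K, x ≤ g ∨ h ≤ x

section Words

variable {ℓ : ℕ} (r a : Fin ℓ → ℝ)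

theorem wordMap_sub (w : List (Fin ℓ)) (x y : ℝ) :
    wordMap r a w x - wordMap r a w y = wordRatio r w * (x - y) := by
  induction w with
  | nil => simp [wordMap, wordRatio]
  | cons i w ih => simp only [wordMap, wordRatio]; linear_combination r i * ih

theorem wordMap_eq (w : List (Fin ℓ)) (x : ℝ) :
    wordMap r a w x = wordRatio r w * x + wordMap r a w 0 := by
  linear_combination wordMap_sub r a w x 0

theorem wordMap_append (v w : List (Fin ℓ)) (x : ℝ) :
    wordMap r a (v ++ w) x = wordMap r a v (wordMap r a w x) := by
  induction v with
  | nil => rfl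
  | cons i v ih => simp [wordMap, ih]

theorem wordRatio_append (v w : List (Fin ℓ)) :
    wordRatio r (v ++ w) = wordRatio r v * wordRatio r w := by
  induction v with
  | nil => simp [wordRatio]
  | cons i v ih => simp [wordRatio, ih, mul_assoc]

end Words

namespace IsSeparatedAttractor

variable {ℓ : ℕ} {r a : Fin ℓ → ℝ} {K : Set ℝ} {δ ρ σ D : ℝ}

theorem abs_pos (h : IsSeparatedAttractor r a K δ ρ σ D) (i : Fin ℓ) : 0 < |r i| :=
  h.lower_pos.trans_le (h.lower_le i)

theorem upper_pos (h : IsSeparatedAttractor r a K δ ρ σ D) : 0 < σ := by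
  obtain ⟨x, hx⟩ := h.nonempty
  obtain ⟨i, -⟩ := h.cover x hx
  exact (h.abs_pos i).trans_le (h.le_upper i)

theorem wordRatio_pos (h : IsSeparatedAttractor r a K δ ρ σ D) (w : List (Fin ℓ)) :
    0 < |wordRatio r w| := by
  induction w with
  | nil => simp [wordRatio]
  | cons i w ih => rw [wordRatio, abs_mul]; exact mul_pos (h.abs_pos i) ih

theorem wordRatio_ne_zero (h : IsSeparatedAttractor r a K δ ρ σ D) (w : List (Fin ℓ)) :
    wordRatio r w ≠ 0 :=
  _root_.abs_pos.1 (h.wordRatio_pos w)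

theorem wordRatio_le_pow (h : IsSeparatedAttractor r a K δ ρ σ D) (w : List (Fin ℓ)) :
    |wordRatio r w| ≤ σ ^ w.length := by
  induction w with
  | nil => simp [wordRatio]
  | cons i w ih =>
    rw [wordRatio, abs_mul, List.length_cons, pow_succ']
    exact mul_le_mul (h.le_upper i) ih (abs_nonneg _) h.upper_pos.le

theorem wordRatio_le_one (h : IsSeparatedAttractor r a K δ ρ σ D) (w : List (Fin ℓ)) :
    |wordRatio r w| ≤ 1 :=
  (h.wordRatio_le_pow w).trans (pow_le_one₀ h.upper_pos.le h.upper_lt.le)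

theorem wordMap_injective (h : IsSeparatedAttractor r a K δ ρ σ D) (w : List (Fin ℓ)) :
    Function.Injective (wordMap r a w) := by
  intro x y hxy
  have := wordMap_sub r a w x y
  rw [hxy, sub_self, eq_comm, mul_eq_zero, or_iff_right (h.wordRatio_ne_zero w)] at this
  linarith

theorem wordMap_mem (h : IsSeparatedAttractor r a K δ ρ σ D) (w : List (Fin ℓ)) {x : ℝ}
    (hx : x ∈ K) : wordMap r a w x ∈ K := by
  induction w with
  | nil => exact hx
  | cons i w ih => exact h.maps i _ ih

theorem exists_word_ofFn (h : IsSeparatedAttractor r a K δ ρ σ D) (n : ℕ) {x : ℝ}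
    (hx : x ∈ K) : ∃ e : Fin n → Fin ℓ, ∃ y ∈ K, wordMap r a (List.ofFn e) y = x := by
  induction n generalizing x with
  | zero => exact ⟨Fin.elim0, x, hx, by simp [wordMap]⟩
  | succ n ih =>
    obtain ⟨i, y, hy, rfl⟩ := h.cover x hx
    obtain ⟨e, z, hz, rfl⟩ := ih hy
    exact ⟨Fin.cons i e, z, hz, by simp [wordMap, List.ofFn_succ]⟩

theorem sep_wordMap (h : IsSeparatedAttractor r a K δ ρ σ D) (v : List (Fin ℓ)) {x y : ℝ}
    (hx : x ∈ K) (hy : y ∈ K) (hyv : y ∉ wordMap r a v '' K) :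
    δ * |wordRatio r v| ≤ |y - wordMap r a v x| := by
  induction v generalizing y with
  | nil => exact absurd ⟨y, hy, rfl⟩ hyv
  | cons i v ih =>
    obtain ⟨j, z, hz, rfl⟩ := h.cover y hy
    by_cases hij : j = i
    · subst hij
      have hzv : z ∉ wordMap r a v '' K := fun ⟨k, hk, hkz⟩ => hyv ⟨k, hk, by simp [wordMap, hkz]⟩
      have := mul_le_mul_of_nonneg_left (ih hz hzv) (abs_nonneg (r j))
      rw [← abs_mul] at this
      simp only [wordMap, wordRatio, abs_mul]
      calc δ * (|r j| * |wordRatio r v|) = |r j| * (δ * |wordRatio r v|) := by ring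
        _ ≤ |r j * (z - wordMap r a v x)| := this
        _ = _ := by rw [mul_sub, add_sub_add_right_eq_sub]
    · calc δ * |wordRatio r (i :: v)| ≤ δ * 1 :=
            mul_le_mul_of_nonneg_left (h.wordRatio_le_one _) h.sep_pos.le
        _ = δ := mul_one δ
        _ ≤ _ := h.sep j i hij z hz _ (h.wordMap_mem v hx)

/-- Every point of `K` lies in a cylinder of any prescribed size, up to the factor `ρ`. -/
theorem exists_word_of_size (h : IsSeparatedAttractor r a K δ ρ σ D) {x : ℝ} (hx : x ∈ K)
    {d : ℝ} (hd : 0 < d) (hd1 : d < 1) :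
    ∃ u, x ∈ wordMap r a u '' K ∧ d < |wordRatio r u| ∧ ρ * |wordRatio r u| ≤ d := by
  obtain ⟨n, hn⟩ := exists_pow_lt_of_lt_one hd h.upper_lt
  induction n generalizing x d with
  | zero => simp at hn; linarith
  | succ n ih =>
    obtain ⟨i, y, hy, rfl⟩ := h.cover x hx
    have hi := h.abs_pos i
    rcases le_or_gt |r i| d with hid | hid
    · refine ⟨[], ⟨_, hx, rfl⟩, ?_, ?_⟩
      · simpa [wordRatio] using hd1
      · simpa [wordRatio] using (h.lower_le i).trans hid
    · obtain ⟨u, ⟨z, hz, rfl⟩, h1, h2⟩ := ih hy (div_pos hd hi) ((div_lt_one hi).2 hid) (by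
        rw [lt_div_iff₀ hi]
        refine lt_of_le_of_lt ?_ hn
        rw [pow_succ]
        exact mul_le_mul_of_nonneg_left (h.le_upper i) (pow_nonneg h.upper_pos.le n))
      refine ⟨i :: u, ⟨z, hz, rfl⟩, ?_, ?_⟩
      · rw [wordRatio, abs_mul]; rwa [div_lt_iff₀' hi] at h1
      · rw [wordRatio, abs_mul]; rw [le_div_iff₀' hi] at h2; linarith

/-- In weights `p` summing to one, any cover of `K` by cylinders has total weight at least one. -/
theorem one_le_sum_of_cover (h : IsSeparatedAttractor r a K δ ρ σ D) {p : Fin ℓ → ℝ}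
    (hp : ∀ i, 0 ≤ p i) (hp1 : ∑ i, p i = 1) {ι : Type} (s : Finset ι) (u : ι → List (Fin ℓ))
    (hcov : ∀ x ∈ K, ∃ i ∈ s, x ∈ wordMap r a (u i) '' K) :
    1 ≤ ∑ i ∈ s, wordRatio p (u i) := by
  classical
  have hnn : ∀ w, 0 ≤ wordRatio p w := by
    intro w
    induction w with
    | nil => simp [wordRatio]
    | cons i w ih => exact mul_nonneg (hp i) ih
  obtain ⟨n, hn⟩ : ∃ n, ∀ i ∈ s, (u i).length ≤ n := ⟨s.sup fun i => (u i).length,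
    fun i hi => Finset.le_sup (f := fun i => (u i).length) hi⟩
  by_cases hnil : ∃ i ∈ s, u i = []
  · obtain ⟨i, hi, hui⟩ := hnil
    calc (1 : ℝ) = wordRatio p (u i) := by rw [hui, wordRatio]
      _ ≤ _ := Finset.single_le_sum (f := fun i => wordRatio p (u i)) (fun j _ => hnn _) hi
  push Not at hnil
  induction n generalizing s u with
  | zero =>
    obtain ⟨x, hx⟩ := h.nonempty
    obtain ⟨i, hi, -⟩ := hcov x hx
    exact absurd (List.length_eq_zero_iff.1 (Nat.le_zero.1 (hn i hi))) (hnil i hi)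
  | succ n ih =>
    have key : ∀ j, 1 ≤ ∑ i ∈ s with (u i).head? = some j, wordRatio p (u i).tail := by
      intro j
      have hcov' : ∀ x ∈ K, ∃ i ∈ s.filter (fun i => (u i).head? = some j),
          x ∈ wordMap r a (u i).tail '' K := by
        intro x hx
        obtain ⟨i, hi, z, hz, hzx⟩ := hcov _ (h.maps j x hx)
        obtain ⟨b, w, hbw⟩ := List.exists_cons_of_ne_nil (hnil i hi)
        rw [hbw, wordMap] at hzx
        have hbj : b = j := by
          by_contra hne
          have := h.sep b j hne _ (h.wordMap_mem w hz) x hx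
          rw [hzx, sub_self, abs_zero] at this
          exact absurd h.sep_pos this.not_gt
        subst hbj
        refine ⟨i, by simp [hi, hbw], z, hz, ?_⟩
        rw [hbw, List.tail_cons]
        have hb : r b ≠ 0 := _root_.abs_pos.1 (h.abs_pos b)
        exact mul_left_cancel₀ hb (by linarith)
      by_cases hnil' : ∃ i ∈ s.filter (fun i => (u i).head? = some j), (u i).tail = []
      · obtain ⟨i, hi, hui⟩ := hnil'
        calc (1 : ℝ) = wordRatio p (u i).tail := by rw [hui, wordRatio]
          _ ≤ _ := Finset.single_le_sum (f := fun i => wordRatio p (u i).tail)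
            (fun j _ => hnn _) hi
      · push Not at hnil'
        refine ih _ (fun i => (u i).tail) hcov' ?_ hnil'
        intro i hi
        have := hn i (Finset.mem_filter.1 hi).1
        simp; omega
    calc (1 : ℝ) = ∑ j, p j * 1 := by simp [hp1]
      _ ≤ ∑ j, p j * ∑ i ∈ s with (u i).head? = some j, wordRatio p (u i).tail :=
        Finset.sum_le_sum fun j _ => mul_le_mul_of_nonneg_left (key j) (hp j)
      _ = ∑ j, ∑ i ∈ s with (u i).head? = some j, wordRatio p (u i) := by
        refine Finset.sum_congr rfl fun j _ => ?_
        rw [Finset.mul_sum]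
        refine Finset.sum_congr rfl fun i hi => ?_
        obtain ⟨w, hw⟩ := List.head?_eq_some_iff.1 (Finset.mem_filter.1 hi).2
        rw [hw, List.tail_cons, wordRatio]
      _ = ∑ j, ∑ i ∈ s, if (u i).head? = some j then wordRatio p (u i) else 0 := by
        simp only [Finset.sum_filter]
      _ = ∑ i ∈ s, ∑ j, if (u i).head? = some j then wordRatio p (u i) else 0 :=
        Finset.sum_comm
      _ = ∑ i ∈ s, wordRatio p (u i) := by
        refine Finset.sum_congr rfl fun i hi => ?_
        obtain ⟨b, w, hbw⟩ := List.exists_cons_of_ne_nil (hnil i hi)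
        simp [hbw]

end IsSeparatedAttractor

/-- The points that lie in `K` or at distance at least `δ` from `K`. -/
def farOrMem (K : Set ℝ) (δ : ℝ) : Set ℝ := K ∪ {y | ∀ x ∈ K, δ ≤ |y - x|}

/-- The pairs `q` for which `x ↦ q.1 * x + q.2` is a similitude from `K` to `farOrMem K δ`. -/
def nearMaps (K : Set ℝ) (δ : ℝ) : Set (ℝ × ℝ) :=
  {q | q.1 ≠ 0 ∧ ∀ x ∈ K, q.1 * x + q.2 ∈ farOrMem K δ}

/-- The isolated points of `nearMaps K δ`. -/
def isolatedMaps (K : Set ℝ) (δ : ℝ) : Set (ℝ × ℝ) :=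
  {q | q ∈ nearMaps K δ ∧ ∃ η > 0, ∀ q' ∈ nearMaps K δ, dist q' q < η → q' = q}

theorem isClosed_farOrMem {K : Set ℝ} (hK : IsClosed K) (δ : ℝ) : IsClosed (farOrMem K δ) := by
  refine hK.union ?_
  simp only [Set.ofPred_forall]
  exact isClosed_biInter fun x _ => isClosed_le (by fun_prop) (by fun_prop)

theorem mem_of_mem_farOrMem {K : Set ℝ} {δ x y : ℝ} (hy : y ∈ farOrMem K δ) (hx : x ∈ K)
    (hxy : |y - x| < δ) : y ∈ K :=
  hy.resolve_right fun h => (h x hx).not_gt hxy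

theorem countable_isolatedMaps (K : Set ℝ) (δ : ℝ) : (isolatedMaps K δ).Countable := by
  have : DiscreteTopology (isolatedMaps K δ) := by
    refine discreteTopology_iff_isOpen_singleton.2 fun q => Metric.isOpen_singleton_iff.2 ?_
    obtain ⟨-, η, hη, hq⟩ := q.2
    exact ⟨η, hη, fun q' hq' => Subtype.ext (hq q'.1 q'.2.1 hq')⟩
  exact Set.countable_coe_iff.1 (TopologicalSpace.separableSpace_iff_countable.1 inferInstance)

theorem abs_affine_sub_lt {B x η : ℝ} {q q' : ℝ × ℝ} (hx : |x| ≤ B)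
    (hq : dist q' q < η / (B + 1)) : |(q'.1 * x + q'.2) - (q.1 * x + q.2)| < η := by
  have hB : 0 < B + 1 := by linarith [abs_nonneg x]
  have h1 : |q'.1 - q.1| ≤ dist q' q := by
    rw [← Real.dist_eq, Prod.dist_eq]; exact le_max_left _ _
  have h2 : |q'.2 - q.2| ≤ dist q' q := by
    rw [← Real.dist_eq, Prod.dist_eq]; exact le_max_right _ _
  rw [lt_div_iff₀ hB] at hq
  calc |(q'.1 * x + q'.2) - (q.1 * x + q.2)| = |(q'.1 - q.1) * x + (q'.2 - q.2)| := by
        congr 1; ring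
    _ ≤ |q'.1 - q.1| * |x| + |q'.2 - q.2| := by rw [← abs_mul]; exact abs_add_le _ _
    _ ≤ dist q' q * B + dist q' q := by gcongr
    _ < η := by linarith

namespace IsSeparatedAttractor

variable {ℓ : ℕ} {r a : Fin ℓ → ℝ} {K : Set ℝ} {δ ρ σ D : ℝ}

theorem exists_abs_le (h : IsSeparatedAttractor r a K δ ρ σ D) :
    ∃ B, 0 ≤ B ∧ ∀ x ∈ K, |x| ≤ B := by
  obtain ⟨B, hB⟩ := h.compact.isBounded.exists_norm_le
  obtain ⟨x, hx⟩ := h.nonempty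
  exact ⟨B, (norm_nonneg x).trans (hB x hx), hB⟩

/-- A similitude in `nearMaps K δ` whose image covers `K` is isolated: nearby maps can neither
shrink a gap of `K` nor enlarge its convex hull. -/
theorem mem_isolatedMaps (h : IsSeparatedAttractor r a K δ ρ σ D) {q : ℝ × ℝ}
    (hq : q ∈ nearMaps K δ) (hcov : ∀ z ∈ K, ∃ x ∈ K, q.1 * x + q.2 = z) :
    q ∈ isolatedMaps K δ := by
  obtain ⟨B, hB0, hB⟩ := h.exists_abs_le
  obtain ⟨g, hg, g', hg', hgg', hgap⟩ := h.gap
  obtain ⟨m, hm, hmin⟩ := h.compact.exists_isLeast h.nonempty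
  obtain ⟨M, hM, hmax⟩ := h.compact.exists_isGreatest h.nonempty
  obtain ⟨x₁, hx₁, e₁⟩ := hcov g hg
  obtain ⟨x₂, hx₂, e₂⟩ := hcov g' hg'
  obtain ⟨y₁, hy₁, f₁⟩ := hcov m hm
  obtain ⟨y₂, hy₂, f₂⟩ := hcov M hM
  have hη : 0 < min δ (g' - g) := lt_min h.sep_pos (sub_pos.2 hgg')
  refine ⟨hq, min δ (g' - g) / (B + 1), by positivity, fun q' hq' hd => ?_⟩
  have near : ∀ x ∈ K, ∀ z ∈ K, q.1 * x + q.2 = z →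
      q'.1 * x + q'.2 ∈ K ∧ |q'.1 * x + q'.2 - z| < g' - g := by
    intro x hx z hz hxz
    have := abs_affine_sub_lt (hB x hx) hd
    rw [hxz] at this
    exact ⟨mem_of_mem_farOrMem (hq'.2 x hx) hz (this.trans_le (min_le_left _ _)),
      this.trans_le (min_le_right _ _)⟩
  obtain ⟨a₁, b₁⟩ := near x₁ hx₁ g hg e₁
  obtain ⟨a₂, b₂⟩ := near x₂ hx₂ g' hg' e₂
  obtain ⟨a₃, -⟩ := near y₁ hy₁ m hm f₁
  obtain ⟨a₄, -⟩ := near y₂ hy₂ M hM f₂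
  have c₁ : q'.1 * x₁ + q'.2 ≤ g := (hgap _ a₁).resolve_right fun hh => by
    linarith [(abs_lt.1 b₁).2]
  have c₂ : g' ≤ q'.1 * x₂ + q'.2 := (hgap _ a₂).resolve_left fun hh => by
    linarith [(abs_lt.1 b₂).1]
  have c₃ := hmin a₃
  have c₄ := hmax a₄
  have hmM : m < M := (hmin hg).trans_lt (hgg'.trans_le (hmax hg'))
  have hα : q'.1 - q.1 = 0 := by
    have i₁ : 0 ≤ (q'.1 - q.1) * (x₂ - x₁) := by linarith
    have i₂ : (q'.1 - q.1) * (y₂ - y₁) ≤ 0 := by linarith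
    have j₁ : 0 < q.1 * (x₂ - x₁) := by linarith
    have j₂ : 0 < q.1 * (y₂ - y₁) := by linarith
    rcases lt_or_gt_of_ne hq.1 with hneg | hpos
    · have k₁ : x₂ - x₁ < 0 := by nlinarith
      have k₂ : y₂ - y₁ < 0 := by nlinarith
      apply le_antisymm <;> nlinarith
    · have k₁ : 0 < x₂ - x₁ := by nlinarith
      have k₂ : 0 < y₂ - y₁ := by nlinarith
      apply le_antisymm <;> nlinarith
  have hα' : q'.1 = q.1 := by linarith
  rw [hα'] at c₁ c₂
  exact Prod.ext hα' (by linarith)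

/-- In a bounded family, the non-isolated elements of `nearMaps K δ` miss a point of `K` by a
uniform amount. -/
theorem exists_uniform_miss (h : IsSeparatedAttractor r a K δ ρ σ D) {c : ℝ} (hc : 0 < c)
    (C B : ℝ) : ∃ ε > 0, ∀ q ∈ nearMaps K δ, q ∉ isolatedMaps K δ → c ≤ |q.1| → |q.1| ≤ C →
      |q.2| ≤ B → ∃ z ∈ K, ∀ y ∈ K, ε ≤ |q.1 * y + q.2 - z| := by
  let Z : Set (ℝ × ℝ) :=
    {q | c ≤ |q.1| ∧ |q.1| ≤ C ∧ |q.2| ≤ B ∧ ∀ x ∈ K, q.1 * x + q.2 ∈ farOrMem K δ}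
  have hZ : IsCompact Z := by
    refine (isCompact_Icc (a := ((-C, -B) : ℝ × ℝ)) (b := (C, B))).of_isClosed_subset ?_ ?_
    · refine (isClosed_le continuous_const continuous_fst.abs).inter
        ((isClosed_le continuous_fst.abs continuous_const).inter
        ((isClosed_le continuous_snd.abs continuous_const).inter ?_))
      change IsClosed {q : ℝ × ℝ | ∀ x ∈ K, q.1 * x + q.2 ∈ farOrMem K δ}
      simp only [Set.ofPred_forall]
      exact isClosed_biInter fun x _ =>
        (isClosed_farOrMem h.compact.isClosed δ).preimage (by fun_prop)
    · rintro q ⟨-, h1, h2, -⟩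
      rw [abs_le] at h1 h2
      exact ⟨⟨h1.1, h2.1⟩, ⟨h1.2, h2.2⟩⟩
  have key : ∃ ε > 0, ∀ q ∈ Z, q ∈ nearMaps K δ → q ∉ isolatedMaps K δ →
      ∃ z ∈ K, ∀ y ∈ K, ε ≤ |q.1 * y + q.2 - z| := by
    refine hZ.induction_on
      (p := fun S => ∃ ε > 0, ∀ q ∈ S, q ∈ nearMaps K δ → q ∉ isolatedMaps K δ →
        ∃ z ∈ K, ∀ y ∈ K, ε ≤ |q.1 * y + q.2 - z|) ?_ ?_ ?_ ?_
    · exact ⟨1, one_pos, fun q hq => hq.elim⟩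
    · rintro s t hst ⟨ε, hε, H⟩
      exact ⟨ε, hε, fun q hq => H q (hst hq)⟩
    · rintro s t ⟨ε, hε, H⟩ ⟨ε', hε', H'⟩
      refine ⟨min ε ε', lt_min hε hε', fun q hq hq1 hq2 => ?_⟩
      rcases hq with hq | hq
      · obtain ⟨z, hz, Hz⟩ := H q hq hq1 hq2
        exact ⟨z, hz, fun y hy => (min_le_left _ _).trans (Hz y hy)⟩
      · obtain ⟨z, hz, Hz⟩ := H' q hq hq1 hq2
        exact ⟨z, hz, fun y hy => (min_le_right _ _).trans (Hz y hy)⟩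
    · rintro q ⟨hq1, -, -, hq4⟩
      have hq : q ∈ nearMaps K δ := ⟨_root_.abs_pos.1 (hc.trans_le hq1), hq4⟩
      by_cases hiso : q ∈ isolatedMaps K δ
      · obtain ⟨-, η, hη, H⟩ := hiso
        refine ⟨Metric.ball q η, mem_nhdsWithin_of_mem_nhds (Metric.ball_mem_nhds q hη), 1,
          one_pos, fun q' hq' hn hni => ?_⟩
        rw [H q' hn hq'] at hni
        exact absurd ⟨hq, η, hη, H⟩ hni
      · obtain ⟨z, hz, hzq⟩ : ∃ z ∈ K, ∀ x ∈ K, q.1 * x + q.2 ≠ z := by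
          by_contra! hcon
          exact hiso (h.mem_isolatedMaps hq hcon)
        obtain ⟨x, hx, hmin⟩ := h.compact.exists_isMinOn h.nonempty
          (f := fun y => |q.1 * y + q.2 - z|) (by fun_prop)
        have hpos : 0 < |q.1 * x + q.2 - z| := _root_.abs_pos.2 (sub_ne_zero.2 (hzq x hx))
        obtain ⟨b, hb0, hb⟩ := h.exists_abs_le
        refine ⟨Metric.ball q (|q.1 * x + q.2 - z| / 2 / (b + 1)),
          mem_nhdsWithin_of_mem_nhds (Metric.ball_mem_nhds q (by positivity)),
          |q.1 * x + q.2 - z| / 2, by positivity, fun q' hq' _ _ => ⟨z, hz, fun y hy => ?_⟩⟩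
        have h1 := abs_affine_sub_lt (hb y hy) hq'
        have h2 : |q.1 * x + q.2 - z| ≤ |q.1 * y + q.2 - z| := hmin hy
        have h3 := abs_sub_abs_le_abs_sub (q.1 * y + q.2 - z) (q'.1 * y + q'.2 - z)
        rw [abs_sub_comm] at h1
        rw [sub_sub_sub_cancel_right] at h3
        linarith
  obtain ⟨ε, hε, H⟩ := key
  exact ⟨ε, hε, fun q hq hqi h1 h2 h3 => H q ⟨h1, h2, h3, hq.2⟩ hq hqi⟩

/-- Renormalisation of a similitude mapping `K` into itself at a cylinder met by its image. -/
theorem exists_zoom (h : IsSeparatedAttractor r a K δ ρ σ D) {q : ℝ × ℝ} (hq : q.1 ≠ 0)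
    (hqK : ∀ x ∈ K, q.1 * x + q.2 ∈ K) (v : List (Fin ℓ)) {x₀ : ℝ} (hx₀ : x₀ ∈ K)
    (hv : q.1 * x₀ + q.2 ∈ wordMap r a v '' K) :
    ∃ u, ∃ ψ ∈ nearMaps K δ,
      (∀ x, wordMap r a v (ψ.1 * x + ψ.2) = q.1 * wordMap r a u x + q.2) ∧
      (∀ y ∈ K, q.1 * y + q.2 ∈ wordMap r a v '' K → y ∈ wordMap r a u '' K) ∧
      min |q.1| (D / δ) ≤ |ψ.1| ∧ |ψ.1| ≤ D / (δ * ρ) ∧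
      |q.1| * |wordRatio r u| = |ψ.1| * |wordRatio r v| ∧
      ∃ x ∈ K, ψ.1 * x + ψ.2 ∈ K := by
  have hv0 := h.wordRatio_ne_zero v
  have hvp := h.wordRatio_pos v
  have hqp : 0 < |q.1| := _root_.abs_pos.2 hq
  have hδ := h.sep_pos
  have hρ := h.lower_pos
  have hD := h.diam_pos
  obtain ⟨u, hu1, hu2, hu3⟩ : ∃ u,
      (∀ y ∈ K, q.1 * y + q.2 ∈ wordMap r a v '' K → y ∈ wordMap r a u '' K) ∧
      min |q.1| (D / δ) ≤ |q.1| * |wordRatio r u| / |wordRatio r v| ∧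
      |q.1| * |wordRatio r u| / |wordRatio r v| ≤ D / (δ * ρ) := by
    have hρ1 : ρ ≤ 1 := by
      obtain ⟨i, -⟩ := h.cover x₀ hx₀
      exact (h.lower_le i).trans ((h.le_upper i).trans h.upper_lt.le)
    set d := |wordRatio r v| * D / (|q.1| * δ) with hd
    have hdpos : 0 < d := by positivity
    have hdeq : |q.1| * δ * d = |wordRatio r v| * D := by rw [hd]; field_simp
    rcases lt_or_ge d 1 with hd1 | hd1
    · obtain ⟨u, hxu, hdu, hud⟩ := h.exists_word_of_size hx₀ hdpos hd1
      refine ⟨u, fun y hy hyv => ?_, (min_le_right _ _).trans ?_, ?_⟩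
      · by_contra hyu
        obtain ⟨k, hk, hkx⟩ := hxu
        have h1 := h.sep_wordMap u hk hy hyu
        obtain ⟨z, hz, hzy⟩ := hyv
        obtain ⟨z₀, hz₀, hzx⟩ := hv
        have h2 : |q.1| * |y - x₀| ≤ |wordRatio r v| * D := by
          calc |q.1| * |y - x₀| = |q.1 * (y - x₀)| := (abs_mul _ _).symm
            _ = |wordMap r a v z - wordMap r a v z₀| := by rw [hzy, hzx]; congr 1; ring
            _ = |wordRatio r v| * |z - z₀| := by rw [wordMap_sub, abs_mul]
            _ ≤ _ := mul_le_mul_of_nonneg_left (h.diam_le z hz z₀ hz₀) hvp.le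
        rw [hkx] at h1
        have h3 : |q.1| * δ * d < |q.1| * δ * |wordRatio r u| :=
          mul_lt_mul_of_pos_left hdu (by positivity)
        nlinarith [mul_le_mul_of_nonneg_left h1 hqp.le]
      · rw [div_le_div_iff₀ hδ hvp]
        nlinarith [mul_lt_mul_of_pos_left hdu (show 0 < |q.1| * δ by positivity)]
      · rw [div_le_div_iff₀ hvp (by positivity)]
        nlinarith [mul_le_mul_of_nonneg_left hud (show 0 ≤ |q.1| * δ by positivity)]
    · have hle : |q.1| * δ ≤ |wordRatio r v| * D := by
        rw [← hdeq]; exact le_mul_of_one_le_right (by positivity) hd1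
      refine ⟨[], fun y hy _ => ⟨y, hy, rfl⟩, (min_le_left _ _).trans ?_, ?_⟩
      · rw [wordRatio, abs_one, mul_one, le_div_iff₀ hvp]
        exact mul_le_of_le_one_right hqp.le (h.wordRatio_le_one v)
      · rw [wordRatio, abs_one, mul_one, div_le_div_iff₀ hvp (by positivity)]
        nlinarith [mul_le_mul_of_nonneg_left hρ1 (show 0 ≤ |q.1| * δ by positivity)]
  let ψ : ℝ × ℝ := (q.1 * wordRatio r u / wordRatio r v,
    (q.1 * wordMap r a u 0 + q.2 - wordMap r a v 0) / wordRatio r v)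
  have hψ : ∀ x, wordMap r a v (ψ.1 * x + ψ.2) = q.1 * wordMap r a u x + q.2 := by
    intro x
    rw [wordMap_eq r a v, wordMap_eq r a u x]
    simp only [ψ]
    field_simp
    ring
  have habs : |ψ.1| = |q.1| * |wordRatio r u| / |wordRatio r v| := by
    simp only [ψ, abs_div, abs_mul]
  refine ⟨u, ψ, ⟨?_, fun x hx => ?_⟩, hψ, hu1, habs ▸ hu2, habs ▸ hu3, ?_, ?_⟩
  · exact div_ne_zero (mul_ne_zero hq (h.wordRatio_ne_zero u)) hv0
  · by_cases hmem : q.1 * wordMap r a u x + q.2 ∈ wordMap r a v '' K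
    · obtain ⟨z, hz, hzx⟩ := hmem
      rw [← hψ] at hzx
      exact Or.inl (h.wordMap_injective v hzx ▸ hz)
    · refine Or.inr fun z hz => ?_
      have h1 := h.sep_wordMap v hz (hqK _ (h.wordMap_mem u hx)) hmem
      rw [← hψ, wordMap_sub, abs_mul, mul_comm] at h1
      exact le_of_mul_le_mul_left h1 hvp
  · rw [habs]; field_simp
  · obtain ⟨x, hx, hxx⟩ := hu1 x₀ hx₀ hv
    obtain ⟨z, hz, hzx⟩ := hv
    rw [← hxx, ← hψ] at hzx
    exact ⟨x, hx, h.wordMap_injective v hzx ▸ hz⟩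

end IsSeparatedAttractor

namespace IsSeparatedAttractor

variable {ℓ : ℕ} {r a : Fin ℓ → ℝ} {K : Set ℝ} {δ ρ σ D : ℝ}

/-- If a map `f` on `K` misses a subcylinder, `L` levels down, of every cylinder, then `f '' K` is
covered by finitely many cylinders of arbitrarily small total weight. -/
theorem exists_cover_of_miss (h : IsSeparatedAttractor r a K δ ρ σ D) {p : Fin ℓ → ℝ}
    (hp : ∀ i, 0 < p i) (hp1 : ∑ i, p i = 1) {f : ℝ → ℝ} (hf : ∀ x ∈ K, f x ∈ K) {L : ℕ}
    (hL : ∀ v, ∃ e : Fin L → Fin ℓ, ∀ y ∈ K, f y ∉ wordMap r a (v ++ List.ofFn e) '' K)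
    {ε : ℝ} (hε : 0 < ε) :
    ∃ (ι : Type) (_ : Fintype ι) (v : ι → List (Fin ℓ)),
      (∀ x ∈ K, ∃ i, f x ∈ wordMap r a (v i) '' K) ∧ ∑ i, wordRatio p (v i) < ε := by
  classical
  have hpos : ∀ w, 0 < wordRatio p w := by
    intro w
    induction w with
    | nil => simp [wordRatio]
    | cons i w ih => exact mul_pos (hp i) ih
  have hofFn : ∀ (n : ℕ) (e : Fin n → Fin ℓ), wordRatio p (List.ofFn e) = ∏ i, p (e i) := by
    intro n
    induction n with
    | zero => intro e; simp [wordRatio]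
    | succ n ih => intro e; rw [List.ofFn_succ, wordRatio, ih, Fin.prod_univ_succ]
  have hsum : ∑ e : Fin L → Fin ℓ, wordRatio p (List.ofFn e) = 1 := by
    simp only [hofFn]
    rw [← Fintype.sum_pow, hp1, one_pow]
  choose e he using hL
  have : Nonempty (Fin L → Fin ℓ) := ⟨e []⟩
  obtain ⟨e₀, he₀⟩ := Finite.exists_min fun e : Fin L → Fin ℓ => wordRatio p (List.ofFn e)
  set θ := 1 - wordRatio p (List.ofFn e₀) with hθ
  have hθ0 : 0 ≤ θ := by
    rw [hθ, ← hsum, sub_nonneg]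
    exact Finset.single_le_sum (f := fun e : Fin L → Fin ℓ => wordRatio p (List.ofFn e))
      (fun e _ => (hpos _).le) (Finset.mem_univ e₀)
  have hθ1 : θ < 1 := by linarith [hpos (List.ofFn e₀)]
  obtain ⟨n, hn⟩ := exists_pow_lt_of_lt_one hε hθ1
  suffices H : ∃ (ι : Type) (_ : Fintype ι) (v : ι → List (Fin ℓ)),
      (∀ x ∈ K, ∃ i, f x ∈ wordMap r a (v i) '' K) ∧ ∑ i, wordRatio p (v i) ≤ θ ^ n by
    obtain ⟨ι, hι, v, h1, h2⟩ := H
    exact ⟨ι, hι, v, h1, h2.trans_lt hn⟩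
  clear hn
  induction n with
  | zero => exact ⟨Unit, inferInstance, fun _ => [], fun x hx => ⟨(), f x, hf x hx, rfl⟩,
      by simp [wordRatio]⟩
  | succ n ih =>
    obtain ⟨ι, hι, v, h1, h2⟩ := ih
    refine ⟨Σ i : ι, {b : Fin L → Fin ℓ // b ≠ e (v i)}, inferInstance,
      fun j => v j.1 ++ List.ofFn j.2.1, fun x hx => ?_, ?_⟩
    · obtain ⟨i, z, hz, hzx⟩ := h1 x hx
      obtain ⟨b, y, hy, rfl⟩ := h.exists_word_ofFn L hz
      have hmem : f x ∈ wordMap r a (v i ++ List.ofFn b) '' K :=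
        ⟨y, hy, by rw [wordMap_append, hzx]⟩
      exact ⟨⟨i, b, fun hb => he (v i) x hx (hb ▸ hmem)⟩, hmem⟩
    · have hsub : ∀ i, ∑ b : {b : Fin L → Fin ℓ // b ≠ e (v i)}, wordRatio p (List.ofFn b.1)
          ≤ θ := by
        intro i
        have := Fintype.sum_subtype_add_sum_subtype (fun b => b ≠ e (v i))
          (fun b : Fin L → Fin ℓ => wordRatio p (List.ofFn b))
        rw [hsum] at this
        have h3 : wordRatio p (List.ofFn (e (v i))) ≤
            ∑ b : {b : Fin L → Fin ℓ // ¬ b ≠ e (v i)}, wordRatio p (List.ofFn b.1) :=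
          Finset.single_le_sum
            (f := fun b : {b : Fin L → Fin ℓ // ¬ b ≠ e (v i)} => wordRatio p (List.ofFn b.1))
            (fun b _ => (hpos _).le) (Finset.mem_univ ⟨e (v i), by simp⟩)
        linarith [he₀ (e (v i))]
      rw [Fintype.sum_sigma]
      simp only [wordRatio_append, ← Finset.mul_sum]
      calc ∑ i, wordRatio p (v i) *
            ∑ b : {b : Fin L → Fin ℓ // b ≠ e (v i)}, wordRatio p (List.ofFn b.1)
          ≤ ∑ i, wordRatio p (v i) * θ :=
            Finset.sum_le_sum fun i _ => mul_le_mul_of_nonneg_left (hsub i) (hpos _).le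
        _ = (∑ i, wordRatio p (v i)) * θ := (Finset.sum_mul _ _ _).symm
        _ ≤ θ ^ n * θ := mul_le_mul_of_nonneg_right h2 hθ0
        _ = θ ^ (n + 1) := (pow_succ _ _).symm

/-- The similarity dimension. -/
theorem exists_rpow_sum_eq_one (h : IsSeparatedAttractor r a K δ ρ σ D) :
    ∃ s : ℝ, 0 ≤ s ∧ ∑ i, |r i| ^ s = 1 := by
  have hcont : Continuous fun s : ℝ => ∑ i, |r i| ^ s :=
    continuous_finsetSum _ fun i _ => Real.continuous_const_rpow (h.abs_pos i).ne'
  have hlim : Filter.Tendsto (fun s : ℝ => ∑ i, |r i| ^ s) Filter.atTop (nhds 0) := by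
    have : Filter.Tendsto (fun s : ℝ => ∑ i, |r i| ^ s) Filter.atTop
        (nhds (∑ _i : Fin ℓ, (0 : ℝ))) :=
      tendsto_finsetSum _ fun i _ => tendsto_rpow_atTop_of_base_lt_one _
        (by linarith [h.abs_pos i]) ((h.le_upper i).trans_lt h.upper_lt)
    simpa using this
  obtain ⟨t, ht1, ht0⟩ :=
    ((hlim.eventually (gt_mem_nhds one_pos)).and (Filter.eventually_ge_atTop 0)).exists
  have h0 : (1 : ℝ) ≤ ∑ i, |r i| ^ (0 : ℝ) := by
    obtain ⟨x, hx⟩ := h.nonempty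
    obtain ⟨i, -⟩ := h.cover x hx
    have : 1 ≤ ℓ := i.pos
    simpa using this
  obtain ⟨s, hs, hs1⟩ := intermediate_value_Icc' ht0 hcont.continuousOn ⟨ht1.le, h0⟩
  exact ⟨s, hs.1, hs1⟩

/-- Every similitude mapping `K` into itself renormalises to an isolated element of
`nearMaps K δ`. -/
theorem exists_isolated_zoom (h : IsSeparatedAttractor r a K δ ρ σ D) {q : ℝ × ℝ}
    (hq : q.1 ≠ 0) (hqK : ∀ x ∈ K, q.1 * x + q.2 ∈ K) :
    ∃ u v, ∃ ψ ∈ isolatedMaps K δ,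
      ∀ x, wordMap r a v (ψ.1 * x + ψ.2) = q.1 * wordMap r a u x + q.2 := by
  classical
  by_contra! hcon
  have hδ := h.sep_pos
  have hρ := h.lower_pos
  have hD := h.diam_pos
  have hqp : 0 < |q.1| := _root_.abs_pos.2 hq
  set c := min |q.1| (D / δ)
  have hc : 0 < c := lt_min hqp (div_pos hD hδ)
  set C := D / (δ * ρ)
  have hC : 0 < C := by positivity
  obtain ⟨B, hB0, hB⟩ := h.exists_abs_le
  obtain ⟨ε, hε, hmiss⟩ := h.exists_uniform_miss hc C (B + C * B)
  obtain ⟨L, hL⟩ := exists_pow_lt_of_lt_one (div_pos hε hD) h.upper_lt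
  rw [lt_div_iff₀ hD] at hL
  have hLmiss : ∀ v, ∃ e : Fin L → Fin ℓ, ∀ y ∈ K,
      q.1 * y + q.2 ∉ wordMap r a (v ++ List.ofFn e) '' K := by
    intro v
    by_cases hv : ∃ x₀ ∈ K, q.1 * x₀ + q.2 ∈ wordMap r a v '' K
    · obtain ⟨x₀, hx₀, hv⟩ := hv
      obtain ⟨u, ψ, hψ, hψu, hu, h1, h2, -, x, hx, hxK⟩ := h.exists_zoom hq hqK v hx₀ hv
      have h3 : |ψ.2| ≤ B + C * B := by
        calc |ψ.2| = |(ψ.1 * x + ψ.2) - ψ.1 * x| := by congr 1; ring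
          _ ≤ |ψ.1 * x + ψ.2| + |ψ.1 * x| := abs_sub _ _
          _ ≤ B + C * B := by
            rw [abs_mul]
            exact add_le_add (hB _ hxK) (mul_le_mul h2 (hB x hx) (abs_nonneg _) hC.le)
      have hni : ψ ∉ isolatedMaps K δ := fun hψi => by
        obtain ⟨y, hy⟩ := hcon u v ψ hψi
        exact hy (hψu y)
      obtain ⟨z, hz, hzε⟩ := hmiss ψ hψ hni h1 h2 h3
      obtain ⟨e, z', hz', rfl⟩ := h.exists_word_ofFn L hz
      refine ⟨e, fun y hy hmem => ?_⟩
      obtain ⟨k, hk, hky⟩ := hmem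
      rw [wordMap_append] at hky
      obtain ⟨y', hy', rfl⟩ := hu y hy ⟨_, h.wordMap_mem _ hk, hky⟩
      rw [← hψu] at hky
      have h4 := hzε y' hy'
      rw [← h.wordMap_injective v hky, wordMap_sub, abs_mul] at h4
      have h5 : |wordRatio r (List.ofFn e)| * |k - z'| ≤ σ ^ L * D := by
        have := h.wordRatio_le_pow (List.ofFn e)
        rw [List.length_ofFn] at this
        exact mul_le_mul this (h.diam_le k hk z' hz') (abs_nonneg _)
          (pow_nonneg h.upper_pos.le _)
      linarith
    · push Not at hv
      obtain ⟨x, hx⟩ := h.nonempty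
      obtain ⟨e, -⟩ := h.exists_word_ofFn L hx
      refine ⟨e, fun y hy hmem => hv y hy ?_⟩
      obtain ⟨k, hk, hky⟩ := hmem
      rw [wordMap_append] at hky
      exact ⟨_, h.wordMap_mem _ hk, hky⟩
  obtain ⟨s, hs0, hs1⟩ := h.exists_rpow_sum_eq_one
  have hw : ∀ w, wordRatio (fun i => |r i| ^ s) w = |wordRatio r w| ^ s := by
    intro w
    induction w with
    | nil => simp [wordRatio]
    | cons i w ih =>
      rw [wordRatio, wordRatio, ih, abs_mul, Real.mul_rpow (abs_nonneg _) (abs_nonneg _)]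
  have hp : ∀ i, 0 < |r i| ^ s := fun i => Real.rpow_pos_of_pos (h.abs_pos i) s
  have hE : 0 < (C / |q.1|) ^ s := Real.rpow_pos_of_pos (div_pos hC hqp) s
  obtain ⟨ι, hι, v, hcov, hsmall⟩ := h.exists_cover_of_miss hp hs1 hqK hLmiss (inv_pos.2 hE)
  have hu : ∀ i, ∃ u, (∃ x₀ ∈ K, q.1 * x₀ + q.2 ∈ wordMap r a (v i) '' K) →
      (∀ y ∈ K, q.1 * y + q.2 ∈ wordMap r a (v i) '' K → y ∈ wordMap r a u '' K) ∧
      |wordRatio r u| ≤ C / |q.1| * |wordRatio r (v i)| := by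
    intro i
    by_cases hv : ∃ x₀ ∈ K, q.1 * x₀ + q.2 ∈ wordMap r a (v i) '' K
    · obtain ⟨x₀, hx₀, hv⟩ := hv
      obtain ⟨u, ψ, -, -, hu, -, h2, h3, -⟩ := h.exists_zoom hq hqK (v i) hx₀ hv
      refine ⟨u, fun _ => ⟨hu, ?_⟩⟩
      rw [div_mul_eq_mul_div, le_div_iff₀ hqp, mul_comm, h3]
      exact mul_le_mul_of_nonneg_right h2 (abs_nonneg _)
    · exact ⟨[], fun hv' => absurd hv' hv⟩
  choose u hu using hu
  have hone := h.one_le_sum_of_cover (fun i => (hp i).le) hs1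
    (Finset.univ.filter fun i => ∃ x₀ ∈ K, q.1 * x₀ + q.2 ∈ wordMap r a (v i) '' K) u (by
      intro x hx
      obtain ⟨i, hi⟩ := hcov x hx
      exact ⟨i, by simpa using ⟨x, hx, hi⟩, (hu i ⟨x, hx, hi⟩).1 x hx hi⟩)
  have hle : ∑ i with ∃ x₀ ∈ K, q.1 * x₀ + q.2 ∈ wordMap r a (v i) '' K,
      wordRatio (fun i => |r i| ^ s) (u i) ≤
      ∑ i, (C / |q.1|) ^ s * wordRatio (fun i => |r i| ^ s) (v i) := by
    refine (Finset.sum_le_sum (g := fun i =>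
      (C / |q.1|) ^ s * wordRatio (fun i => |r i| ^ s) (v i)) fun i hi => ?_).trans
      (Finset.sum_le_sum_of_subset_of_nonneg (Finset.filter_subset _ _) fun i _ _ => ?_)
    · rw [hw, hw, ← Real.mul_rpow (div_pos hC hqp).le (abs_nonneg _)]
      exact Real.rpow_le_rpow (abs_nonneg _) (hu i (Finset.mem_filter.1 hi).2).2 hs0
    · rw [hw]
      exact mul_nonneg hE.le (Real.rpow_nonneg (abs_nonneg _) s)
  rw [← Finset.mul_sum] at hle
  have := mul_lt_mul_of_pos_left hsmall hE
  rw [mul_inv_cancel₀ hE.ne'] at this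
  linarith

/-- Only countably many similitudes map `K` into itself. -/
theorem countable_selfMaps (h : IsSeparatedAttractor r a K δ ρ σ D) :
    {q : ℝ × ℝ | q.1 ≠ 0 ∧ ∀ x ∈ K, q.1 * x + q.2 ∈ K}.Countable := by
  have hc : (⋃ (u : List (Fin ℓ)) (v : List (Fin ℓ)) (ψ ∈ isolatedMaps K δ), {q : ℝ × ℝ |
      ∀ x, wordMap r a v (ψ.1 * x + ψ.2) = q.1 * wordMap r a u x + q.2}).Countable := by
    refine Set.countable_iUnion fun u => Set.countable_iUnion fun v =>
      (countable_isolatedMaps K δ).biUnion fun ψ _ => Set.Subsingleton.countable ?_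
    intro q hq q' hq'
    have h0 := (hq 0).symm.trans (hq' 0)
    have h1 := (hq 1).symm.trans (hq' 1)
    rw [wordMap_eq r a u 1] at h1
    have h2 : (q.1 - q'.1) * wordRatio r u = 0 := by linear_combination h1 - h0
    rw [mul_eq_zero, or_iff_left (h.wordRatio_ne_zero u), sub_eq_zero] at h2
    rw [h2] at h0
    exact Prod.ext h2 (add_left_cancel h0)
  refine hc.mono fun q ⟨hq, hqK⟩ => ?_
  obtain ⟨u, v, ψ, hψ, H⟩ := h.exists_isolated_zoom hq hqK
  simp only [Set.mem_iUnion]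
  exact ⟨u, v, ψ, hψ, H⟩

end IsSeparatedAttractor

/-- The attractor of an IFS with the strong separation condition is a separated attractor. -/
theorem exists_isSeparatedAttractor {ℓ : ℕ} {r a : Fin ℓ → ℝ}
    (hr : ∀ i, r i ≠ 0 ∧ |r i| < 1) {K : Set ℝ} (hcpt : IsCompact K)
    (hK2 : ∃ x ∈ K, ∃ y ∈ K, x ≠ y) (hK : K = ⋃ i, (fun x => r i * x + a i) '' K)
    (hSSC : ∀ i j : Fin ℓ, i ≠ j →
      Disjoint ((fun x => r i * x + a i) '' K) ((fun x => r j * x + a j) '' K)) :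
    ∃ δ ρ σ D, IsSeparatedAttractor r a K δ ρ σ D := by
  have hne : K.Nonempty := let ⟨x, hx, _⟩ := hK2; ⟨x, hx⟩
  have maps : ∀ i, ∀ x ∈ K, r i * x + a i ∈ K := fun i x hx => by
    rw [hK]; exact Set.mem_iUnion.2 ⟨i, x, hx, rfl⟩
  have cover : ∀ x ∈ K, ∃ i, ∃ y ∈ K, r i * y + a i = x := fun x hx => by
    rw [hK] at hx; exact Set.mem_iUnion.1 hx
  have compact_image : ∀ i, IsCompact ((fun x => r i * x + a i) '' K) := fun i =>
    hcpt.image (by fun_prop)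
  have hι : Nonempty (Fin ℓ) := let ⟨x, hx⟩ := hne; let ⟨i, _⟩ := cover x hx; ⟨i⟩
  have exists_sep : ∀ A B : Set ℝ, IsCompact A → IsCompact B → A.Nonempty → B.Nonempty →
      Disjoint A B → ∃ x ∈ A, ∃ y ∈ B, 0 < |x - y| ∧ ∀ x' ∈ A, ∀ y' ∈ B,
        |x - y| ≤ |x' - y'| := by
    intro A B hA hB hA0 hB0 hAB
    obtain ⟨⟨x, y⟩, ⟨hx, hy⟩, hmin⟩ := (hA.prod hB).exists_isMinOn (hA0.prod hB0)
      (f := fun z => |z.1 - z.2|) (by fun_prop)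
    refine ⟨x, hx, y, hy, abs_pos.2 (sub_ne_zero.2 (hAB.ne_of_mem hx hy)), ?_⟩
    exact fun x' hx' y' hy' => hmin (a := (x', y')) ⟨hx', hy'⟩
  obtain ⟨δ, hδ, sep⟩ : ∃ δ > 0, ∀ i j, i ≠ j → ∀ x ∈ K, ∀ y ∈ K,
      δ ≤ |(r i * x + a i) - (r j * y + a j)| := by
    have hev : ∀ᶠ δ in nhdsWithin (0 : ℝ) (Set.Ioi 0), ∀ i j, i ≠ j → ∀ x ∈ K, ∀ y ∈ K,
        δ ≤ |(r i * x + a i) - (r j * y + a j)| := by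
      refine Filter.eventually_all.2 fun i => Filter.eventually_all.2 fun j => ?_
      by_cases hij : i = j
      · exact Filter.Eventually.of_forall fun _ h => absurd hij h
      obtain ⟨x, -, y, -, hpos, hmin⟩ := exists_sep _ _ (compact_image i) (compact_image j)
        (hne.image _) (hne.image _) (hSSC i j hij)
      filter_upwards [Ioc_mem_nhdsGT hpos] with δ hδ _ x' hx' y' hy'
      exact hδ.2.trans (hmin _ ⟨x', hx', rfl⟩ _ ⟨y', hy', rfl⟩)
    obtain ⟨δ, h1, h2⟩ := (hev.and self_mem_nhdsWithin).exists
    exact ⟨δ, h2, h1⟩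
  obtain ⟨imin, himin⟩ := Finite.exists_min fun i => |r i|
  obtain ⟨imax, himax⟩ := Finite.exists_max fun i => |r i|
  obtain ⟨⟨p, q⟩, ⟨hp, hq⟩, hmax⟩ := (hcpt.prod hcpt).exists_isMaxOn (hne.prod hne)
    (f := fun z : ℝ × ℝ => |z.1 - z.2|) (by fun_prop)
  have diam_le : ∀ x ∈ K, ∀ y ∈ K, |x - y| ≤ |p - q| := fun x hx y hy =>
    hmax (a := (x, y)) ⟨hx, hy⟩
  have diam_pos : 0 < |p - q| := by
    obtain ⟨x, hx, y, hy, hxy⟩ := hK2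
    exact (abs_pos.2 (sub_ne_zero.2 hxy)).trans_le (diam_le x hx y hy)
  obtain ⟨i, j, hij⟩ : ∃ i j : Fin ℓ, i ≠ j := by
    by_contra! hcon
    obtain ⟨i, x, hx, hxp⟩ := cover p hp
    obtain ⟨j, y, hy, hyq⟩ := cover q hq
    obtain rfl := hcon i j
    have h1 : |p - q| = |r i| * |x - y| := by
      rw [← hxp, ← hyq, ← abs_mul]; congr 1; ring
    have h2 := mul_le_mul_of_nonneg_left (diam_le x hx y hy) (abs_nonneg (r i))
    nlinarith [(hr i).2]
  have gap : ∃ g ∈ K, ∃ h ∈ K, g < h ∧ ∀ x ∈ K, x ≤ g ∨ h ≤ x := by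
    let A := (fun x => r i * x + a i) '' K
    let B := ⋃ k : {k // k ≠ i}, (fun x => r k * x + a k) '' K
    have hAK : A ⊆ K := by rintro _ ⟨x, hx, rfl⟩; exact maps i x hx
    have hBK : B ⊆ K := Set.iUnion_subset fun k => by rintro _ ⟨x, hx, rfl⟩; exact maps k x hx
    have hKAB : ∀ x ∈ K, x ∈ A ∨ x ∈ B := by
      intro x hx
      obtain ⟨k, y, hy, rfl⟩ := cover x hx
      by_cases hk : k = i
      · subst hk; exact Or.inl ⟨y, hy, rfl⟩
      · exact Or.inr (Set.mem_iUnion.2 ⟨⟨k, hk⟩, y, hy, rfl⟩)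
    obtain ⟨x, hx, y, hy, hpos, hmin⟩ := exists_sep A B (compact_image i)
      (isCompact_iUnion fun k => compact_image k) (hne.image _)
      (Set.nonempty_iUnion.2 ⟨⟨j, hij.symm⟩, hne.image _⟩)
      (Set.disjoint_iUnion_right.2 fun k => hSSC i k k.2.symm)
    have hxy : x ≠ y := sub_ne_zero.1 (abs_pos.1 hpos)
    rcases lt_or_gt_of_ne hxy with hlt | hlt
    · refine ⟨x, hAK hx, y, hBK hy, hlt, fun z hz => ?_⟩
      by_contra! hcon
      rcases hKAB z hz with hzA | hzB
      · have := hmin z hzA y hy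
        rw [abs_of_neg (by linarith), abs_of_neg (by linarith)] at this
        linarith
      · have := hmin x hx z hzB
        rw [abs_of_neg (by linarith), abs_of_neg (by linarith)] at this
        linarith
    · refine ⟨y, hBK hy, x, hAK hx, hlt, fun z hz => ?_⟩
      by_contra! hcon
      rcases hKAB z hz with hzA | hzB
      · have := hmin z hzA y hy
        rw [abs_of_pos (by linarith), abs_of_pos (by linarith)] at this
        linarith
      · have := hmin x hx z hzB
        rw [abs_of_pos (by linarith), abs_of_pos (by linarith)] at this
        linarith
  exact ⟨δ, |r imin|, |r imax|, |p - q|, hcpt, hne, maps, cover, sep, hδ,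
    abs_pos.2 (hr imin).1, himin, himax, (hr imax).2, diam_pos, diam_le, gap⟩

/-- If finitely many closed sets cover `K`, one of them contains a cylinder. -/
theorem IsSeparatedAttractor.exists_cylinder_subset {ℓ : ℕ} {r a : Fin ℓ → ℝ} {K : Set ℝ}
    {δ ρ σ D : ℝ} (h : IsSeparatedAttractor r a K δ ρ σ D) {ι : Type} [Finite ι]
    {S : ι → Set ℝ} (hS : ∀ i, IsClosed (S i)) (hcov : ∀ x ∈ K, ∃ i, x ∈ S i) :
    ∃ i u, ∀ x ∈ K, wordMap r a u x ∈ S i := by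
  have : Nonempty K := h.nonempty.to_subtype
  have : CompactSpace K := isCompact_iff_compactSpace.1 h.compact
  obtain ⟨i, x, hx⟩ := nonempty_interior_of_iUnion_of_closed
    (f := fun i => ((↑) : K → ℝ) ⁻¹' S i) (fun i => (hS i).preimage continuous_subtype_val)
    (Set.eq_univ_of_forall fun x => Set.mem_iUnion.2 (hcov x x.2))
  obtain ⟨ε, hε, hball⟩ := Metric.mem_nhds_iff.1 (mem_interior_iff_mem_nhds.1 hx)
  obtain ⟨n, hn⟩ := exists_pow_lt_of_lt_one (div_pos hε h.diam_pos) h.upper_lt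
  rw [lt_div_iff₀ h.diam_pos] at hn
  obtain ⟨e, z, hz, hzx⟩ := h.exists_word_ofFn n x.2
  refine ⟨i, List.ofFn e, fun y hy => ?_⟩
  refine hball (a := ⟨_, h.wordMap_mem _ hy⟩) ?_
  rw [Metric.mem_ball, Subtype.dist_eq, Real.dist_eq, ← hzx, wordMap_sub, abs_mul]
  have := h.wordRatio_le_pow (List.ofFn e)
  rw [List.length_ofFn] at this
  exact (mul_le_mul this (h.diam_le y hy z hz) (abs_nonneg _)
    (pow_nonneg h.upper_pos.le _)).trans_lt hn

/-- A contraction of a finite set of reals that extends to an affine map with ratio in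
`(-1, 1) \ {0}` forces all values to agree. -/
theorem eq_of_affine_recurrence {ι : Type} [Finite ι] {d : ι → ℝ} {k : ι → ι} {c b : ℝ}
    (hc0 : c ≠ 0) (hc1 : |c| < 1) (hd : ∀ j, d (k j) = c * d j + b) (i j : ι) :
    d i = d j := by
  by_contra hij
  have : Nonempty {p : ι × ι // d p.1 ≠ d p.2} := ⟨⟨(i, j), hij⟩⟩
  obtain ⟨⟨p, hp⟩, hmin⟩ := Finite.exists_min
    fun p : {p : ι × ι // d p.1 ≠ d p.2} => |d p.1.1 - d p.1.2|
  have heq : d (k p.1) - d (k p.2) = c * (d p.1 - d p.2) := by rw [hd, hd]; ring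
  have hsub := sub_ne_zero.2 hp
  have hne : d (k p.1) ≠ d (k p.2) := by
    rw [← sub_ne_zero, heq]; exact mul_ne_zero hc0 hsub
  have := hmin ⟨(k p.1, k p.2), hne⟩
  simp only [heq, abs_mul] at this
  nlinarith [abs_pos.2 hsub]

theorem stmt_7 (ℓ : ℕ) (hℓ : 0 < ℓ) (r a : Fin ℓ → ℝ)
    (hr : ∀ i, r i ≠ 0 ∧ |r i| < 1)
    (K : Set ℝ) (hne : K.Nonempty) (hcpt : IsCompact K)
    (hK2 : ∃ x ∈ K, ∃ y ∈ K, x ≠ y)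
    (hK : K = ⋃ i, (fun x => r i * x + a i) '' K)
    (hSSC : ∀ i j : Fin ℓ, i ≠ j →
      Disjoint ((fun x => r i * x + a i) '' K) ((fun x => r j * x + a j) '' K))
    (m : ℕ) (hm : 1 ≤ m) :
    Set.Countable {t : Fin m → ℝ | StrictMono t ∧ (∀ j, 0 < t j) ∧
      IsSelfSimilar (K ∪ ⋃ j, (· + t j) '' K)} := by
  obtain ⟨δ, ρ, σ, D, h⟩ := exists_isSeparatedAttractor hr hcpt hK2 hK hSSC
  let Φ := {q : ℝ × ℝ | q.1 ≠ 0 ∧ ∀ x ∈ K, q.1 * x + q.2 ∈ K}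
  have hΦ : Countable Φ := Set.countable_coe_iff.2 h.countable_selfMaps
  let T : (Fin m → ℝ) → Fin (m + 1) → ℝ := fun t => Fin.cons 0 t
  let R : (Fin (m + 1) → Fin (m + 1) × List (Fin ℓ) × Φ) → Set (Fin m → ℝ) := fun φ =>
    {t | ∃ c b : ℝ, c ≠ 0 ∧ |c| < 1 ∧ ∀ j x, c * (wordMap r a (φ j).2.1 x + T t j) + b =
      (φ j).2.2.1.1 * x + (φ j).2.2.1.2 + T t (φ j).1}
  refine (Set.countable_iUnion fun φ => (?_ : (R φ).Subsingleton).countable).mono ?_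
  · rintro t ⟨c, b, hc0, hc1, H⟩ t' ⟨c', b', -, -, H'⟩
    have hcc : c = c' := by
      have h0 := H 0 0
      have h1 := H 0 1
      have h0' := H' 0 0
      have h1' := H' 0 1
      rw [wordMap_eq] at h1 h1'
      exact mul_right_cancel₀ (h.wordRatio_ne_zero (φ 0).2.1)
        (by linear_combination h1 - h0 - h1' + h0')
    subst hcc
    have hd := eq_of_affine_recurrence (d := fun j => T t j - T t' j) (k := fun j => (φ j).1)
      hc0 hc1 (b := b - b') fun j => by linear_combination H' j 0 - H j 0
    funext j
    have := hd j.succ 0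
    simp only [T, Fin.cons_succ, Fin.cons_zero] at this
    linarith
  · rintro t ⟨-, -, -, -, n, c, b, hn, hcb, hE⟩
    have hmem : ∀ x, (x ∈ K ∪ ⋃ j, (· + t j) '' K) ↔ ∃ j, x - T t j ∈ K := by
      intro x
      rw [Fin.exists_fin_succ]
      simp [T, sub_eq_add_neg]
    have hmaps : ∀ j, ∀ x ∈ K, ∃ k, c ⟨0, hn⟩ * (x + T t j) + b ⟨0, hn⟩ - T t k ∈ K := by
      intro j x hx
      rw [← hmem, hE]
      refine Set.mem_iUnion.2 ⟨⟨0, hn⟩, x + T t j, ?_, rfl⟩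
      exact (hmem _).2 ⟨j, by simpa using hx⟩
    have key : ∀ j, ∃ k u, ∀ x ∈ K,
        c ⟨0, hn⟩ * (wordMap r a u x + T t j) + b ⟨0, hn⟩ - T t k ∈ K := fun j =>
      h.exists_cylinder_subset
        (S := fun k => (fun x => c ⟨0, hn⟩ * (x + T t j) + b ⟨0, hn⟩ - T t k) ⁻¹' K)
        (fun k => hcpt.isClosed.preimage (by fun_prop)) (hmaps j)
    choose k u hku using key
    have heq : ∀ j x, c ⟨0, hn⟩ * (wordMap r a (u j) x + T t j) + b ⟨0, hn⟩ =
        c ⟨0, hn⟩ * wordRatio r (u j) * x +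
          (c ⟨0, hn⟩ * (wordMap r a (u j) 0 + T t j) + b ⟨0, hn⟩ - T t (k j)) + T t (k j) := by
      intro j x
      rw [wordMap_eq r a (u j) x]
      ring
    refine Set.mem_iUnion.2 ⟨fun j => (k j, u j, ⟨(c ⟨0, hn⟩ * wordRatio r (u j),
      c ⟨0, hn⟩ * (wordMap r a (u j) 0 + T t j) + b ⟨0, hn⟩ - T t (k j)),
      mul_ne_zero (hcb _).1 (h.wordRatio_ne_zero _), fun x hx => ?_⟩), c ⟨0, hn⟩, b ⟨0, hn⟩,
      (hcb _).1, (hcb _).2, heq⟩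
    have := hku j x hx
    rw [heq, add_sub_cancel_right] at this
    exact this
end

section
/- Let 0 < λ < 1/3 and λ < ζ < 1 − 2λ with ζ ∉ ℚ(λ), and let K be the attractor of {φ_0(x) = λx, φ_1(x) = λx + ζ, φ_2(x) = λx + 1 − λ}. Then for every t > 0, the union K ∪ (K + t) is not a self-similar set. -/
/-- The translation parts of the three maps `x ↦ lam * x + offset lam ζ i`. -/
def offset (lam ζ : ℝ) : Fin 3 → ℝ := ![0, ζ, 1 - lam]

@[simp] lemma offset_zero (lam ζ : ℝ) : offset lam ζ 0 = 0 := rfl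
@[simp] lemma offset_one (lam ζ : ℝ) : offset lam ζ 1 = ζ := rfl
@[simp] lemma offset_two (lam ζ : ℝ) : offset lam ζ 2 = 1 - lam := rfl

/-- The elementary properties of the attractor of the three maps. -/
structure ThreePartCantor (lam ζ : ℝ) (K : Set ℝ) : Prop where
  lam_pos : 0 < lam
  lam_lt : lam < 1 / 3
  lt_zeta : lam < ζ
  zeta_lt : ζ < 1 - 2 * lam
  zero_mem : (0 : ℝ) ∈ K
  one_mem : (1 : ℝ) ∈ K
  nonneg : ∀ x ∈ K, 0 ≤ x
  le_one : ∀ x ∈ K, x ≤ 1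
  map_mem : ∀ i, ∀ x ∈ K, lam * x + offset lam ζ i ∈ K
  exists_preimage : ∀ x ∈ K, ∃ i, ∃ y ∈ K, x = lam * y + offset lam ζ i

/-- The affine map `x ↦ r * x + b` is injective and sends `K` into itself. -/
def EmbedsInto (K : Set ℝ) (r b : ℝ) : Prop := r ≠ 0 ∧ ∀ x ∈ K, r * x + b ∈ K

namespace ThreePartCantor

variable {lam ζ : ℝ} {K : Set ℝ}

lemma of_attractor (hlam : 0 < lam ∧ lam < 1 / 3) (hζ : lam < ζ ∧ ζ < 1 - 2 * lam)
    (hne : K.Nonempty) (hcpt : IsCompact K)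
    (hK : K = (fun x => lam * x) '' K ∪ (fun x => lam * x + ζ) '' K ∪
      (fun x => lam * x + (1 - lam)) '' K) : ThreePartCantor lam ζ K := by
  obtain ⟨h0, h3⟩ := hlam
  obtain ⟨hz1, hz2⟩ := hζ
  have hmap : ∀ i, ∀ x ∈ K, lam * x + offset lam ζ i ∈ K := by
    intro i x hx
    rw [hK]
    fin_cases i
    · exact Or.inl (Or.inl ⟨x, hx, by simp⟩)
    · exact Or.inl (Or.inr ⟨x, hx, by simp⟩)
    · exact Or.inr ⟨x, hx, by simp⟩
  have hpre : ∀ x ∈ K, ∃ i, ∃ y ∈ K, x = lam * y + offset lam ζ i := by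
    intro x hx
    rw [hK] at hx
    rcases hx with (⟨y, hy, rfl⟩ | ⟨y, hy, rfl⟩) | ⟨y, hy, rfl⟩
    · exact ⟨0, y, hy, by simp⟩
    · exact ⟨1, y, hy, by simp⟩
    · exact ⟨2, y, hy, by simp⟩
  obtain ⟨m, hm, hmin⟩ := hcpt.exists_isLeast hne
  obtain ⟨M, hM, hmax⟩ := hcpt.exists_isGreatest hne
  have hm0 : m = 0 := by
    have h1 := hmin (hmap 0 m hm)
    obtain ⟨i, y, hy, h2⟩ := hpre m hm
    have h4 := hmin hy
    have h5 : 0 ≤ offset lam ζ i := by fin_cases i <;> simp <;> linarith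
    simp only [offset_zero] at h1
    apply le_antisymm <;> nlinarith
  have hM1 : M = 1 := by
    have h1 := hmax (hmap 2 M hM)
    obtain ⟨i, y, hy, h2⟩ := hpre M hM
    have h4 := hmax hy
    have h5 : offset lam ζ i ≤ 1 - lam := by fin_cases i <;> simp <;> linarith
    simp only [offset_two] at h1
    apply le_antisymm <;> nlinarith
  subst hm0 hM1
  exact ⟨h0, h3, hz1, hz2, hm, hM, fun x hx => hmin hx, fun x hx => hmax hx, hmap, hpre⟩

variable (h : ThreePartCantor lam ζ K)
include h

lemma reflect : ThreePartCantor lam (1 - lam - ζ) {x | 1 - x ∈ K} where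
  lam_pos := h.lam_pos
  lam_lt := h.lam_lt
  lt_zeta := by linarith [h.zeta_lt]
  zeta_lt := by linarith [h.lt_zeta]
  zero_mem := by simpa using h.one_mem
  one_mem := by simpa using h.zero_mem
  nonneg x hx := by linarith [h.le_one _ hx]
  le_one x hx := by linarith [h.nonneg _ hx]
  map_mem i x hx := by
    have := h.map_mem i.rev _ hx
    fin_cases i <;> simp [Fin.rev] at this ⊢ <;> convert this using 1 <;> ring
  exists_preimage x hx := by
    obtain ⟨i, y, hy, hxy⟩ := h.exists_preimage _ hx
    refine ⟨i.rev, 1 - y, by simpa using hy, ?_⟩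
    fin_cases i <;> simp [Fin.rev] at hxy ⊢ <;> linarith

lemma location {x : ℝ} (hx : x ∈ K) :
    x ≤ lam ∨ (ζ ≤ x ∧ x ≤ ζ + lam) ∨ 1 - lam ≤ x := by
  obtain ⟨i, y, hy, rfl⟩ := h.exists_preimage x hx
  have h0 := mul_nonneg h.lam_pos.le (h.nonneg y hy)
  have h1 := mul_le_mul_of_nonneg_left (h.le_one y hy) h.lam_pos.le
  fin_cases i
  · left; simp; linarith
  · right; left; simp; constructor <;> linarith
  · right; right; simp; linarith

lemma preimage_mem {x : ℝ} (hx : x ∈ K) {k : Fin 3} (h1 : offset lam ζ k ≤ x)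
    (h2 : x ≤ offset lam ζ k + lam) : (x - offset lam ζ k) / lam ∈ K := by
  obtain ⟨i, y, hy, rfl⟩ := h.exists_preimage x hx
  have h0 := mul_nonneg h.lam_pos.le (h.nonneg y hy)
  have h3 := mul_le_mul_of_nonneg_left (h.le_one y hy) h.lam_pos.le
  have := h.lam_pos
  have := h.lam_lt
  have := h.lt_zeta
  have := h.zeta_lt
  have hik : i = k := by
    fin_cases i <;> fin_cases k <;> simp at h1 h2 ⊢ <;> linarith
  subst hik
  rwa [add_sub_cancel_right, mul_div_cancel_left₀ _ h.lam_pos.ne']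

lemma gap_le (hg : 1 - lam < 2 * ζ) {c d : ℝ} (hc : 0 ≤ c) (hd : d ≤ 1)
    (hcd : ∀ x ∈ K, x ≤ c ∨ d ≤ x) : d - c ≤ ζ - lam := by
  have hl := h.lam_pos
  have hl3 := h.lam_lt
  have hz := h.lt_zeta
  have hz2 := h.zeta_lt
  have key : ∀ n : ℕ, ∀ c d : ℝ, 0 ≤ c → d ≤ 1 → (∀ x ∈ K, x ≤ c ∨ d ≤ x) →
      d - c ≤ max (ζ - lam) (lam ^ n) := by
    intro n
    induction n with
    | zero =>
      intro c d hc hd _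
      exact le_max_of_le_right (by simp; linarith)
    | succ n ih =>
      intro c d hc hd hcd
      have sub : ∀ k, offset lam ζ k ≤ c → d ≤ offset lam ζ k + lam →
          d - c ≤ max (ζ - lam) (lam ^ (n + 1)) := by
        intro k h1 h2
        have := ih ((c - offset lam ζ k) / lam) ((d - offset lam ζ k) / lam)
          (div_nonneg (by linarith) hl.le) (by rw [div_le_one hl]; linarith) (by
            intro x hx
            rw [le_div_iff₀ hl, div_le_iff₀ hl]
            rcases hcd _ (h.map_mem k x hx) with h3 | h3
            · left; linarith
            · right; linarith)
        rw [← sub_div, sub_sub_sub_cancel_right, div_le_iff₀ hl] at this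
        refine this.trans ?_
        rw [max_mul_of_nonneg _ _ hl.le, pow_succ]
        exact max_le_max (by nlinarith) le_rfl
      have p1 := hcd _ (h.map_mem 0 1 h.one_mem)
      have p2 := hcd _ (h.map_mem 1 0 h.zero_mem)
      have p3 := hcd _ (h.map_mem 1 1 h.one_mem)
      have p4 := hcd _ (h.map_mem 2 0 h.zero_mem)
      simp at p1 p2 p3 p4
      rcases p1 with p1 | p1
      · rcases p2 with p2 | p2
        · rcases p3 with p3 | p3
          · rcases p4 with p4 | p4
            · exact sub 2 (by simpa using p4) (by simpa using hd)
            · exact le_max_of_le_left (by linarith)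
          · exact sub 1 (by simpa using p2) (by simp; linarith)
        · exact le_max_of_le_left (by linarith)
      · exact sub 0 (by simpa using hc) (by simpa using p1)
  obtain ⟨n, hn⟩ := exists_pow_lt_of_lt_one (sub_pos.2 hz) (by linarith : lam < 1)
  simpa [hn.le] using key n c d hc hd hcd

lemma straddle_le (hg : 1 - lam < 2 * ζ) {r b : ℝ} (hf : EmbedsInto K r b) {α β : ℝ}
    (hαβ : ∀ x ∈ K, x ≤ α ∨ β ≤ x) (hst : (b ≤ α ∧ β ≤ r + b) ∨ (r + b ≤ α ∧ β ≤ b)) :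
    β - α ≤ |r| * (ζ - lam) := by
  rcases le_or_gt β α with hba | hab
  · have := mul_nonneg (abs_nonneg r) (sub_nonneg.2 h.lt_zeta.le)
    linarith
  rcases hst with ⟨h1, h2⟩ | ⟨h1, h2⟩
  · have hr : 0 < r := by linarith
    have := h.gap_le hg (c := (α - b) / r) (d := (β - b) / r)
      (div_nonneg (by linarith) hr.le) (by rw [div_le_one hr]; linarith) (by
        intro x hx
        rw [le_div_iff₀ hr, div_le_iff₀ hr]
        rcases hαβ _ (hf.2 x hx) with h3 | h3
        · left; linarith
        · right; linarith)
    rw [← sub_div, sub_sub_sub_cancel_right, div_le_iff₀ hr] at this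
    rw [abs_of_pos hr]; linarith
  · have hr : 0 < -r := by linarith
    have := h.gap_le hg (c := (b - β) / -r) (d := (b - α) / -r)
      (div_nonneg (by linarith) hr.le) (by rw [div_le_one hr]; linarith) (by
        intro x hx
        rw [le_div_iff₀ hr, div_le_iff₀ hr]
        rcases hαβ _ (hf.2 x hx) with h3 | h3
        · right; linarith
        · left; linarith)
    rw [← sub_div, sub_sub_sub_cancel_left, div_le_iff₀ hr] at this
    rw [abs_of_neg (by linarith : r < 0)]; linarith

lemma endpoints {r b : ℝ} (hf : EmbedsInto K r b) : b ∈ K ∧ r + b ∈ K := by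
  have h0 := hf.2 0 h.zero_mem
  have h1 := hf.2 1 h.one_mem
  simp only [mul_zero, zero_add, mul_one] at h0 h1
  exact ⟨h0, h1⟩

lemma abs_le_one {r b : ℝ} (hf : EmbedsInto K r b) : |r| ≤ 1 := by
  obtain ⟨h0, h1⟩ := h.endpoints hf
  have := h.nonneg _ h0
  have := h.nonneg _ h1
  have := h.le_one _ h0
  have := h.le_one _ h1
  rw [abs_le]; constructor <;> linarith

lemma peel {r b : ℝ} (hf : EmbedsInto K r b) {k : Fin 3}
    (h0 : offset lam ζ k ≤ b ∧ b ≤ offset lam ζ k + lam)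
    (h1 : offset lam ζ k ≤ r + b ∧ r + b ≤ offset lam ζ k + lam) :
    EmbedsInto K (r / lam) ((b - offset lam ζ k) / lam) := by
  refine ⟨div_ne_zero hf.1 h.lam_pos.ne', fun x hx => ?_⟩
  have hx0 := h.nonneg x hx
  have hx1 := h.le_one x hx
  have := h.preimage_mem (hf.2 x hx) (k := k) (by nlinarith) (by nlinarith)
  convert this using 1
  ring

lemma eq_id_or_reflection {r b : ℝ} (hf : EmbedsInto K r b) (hr : |r| = 1) :
    (r = 1 ∧ b = 0) ∨ (r = -1 ∧ b = 1) := by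
  obtain ⟨h0, h1⟩ := h.endpoints hf
  have := h.nonneg _ h0
  have := h.nonneg _ h1
  have := h.le_one _ h0
  have := h.le_one _ h1
  rcases eq_or_eq_neg_of_abs_eq hr with rfl | rfl
  · left; constructor <;> linarith
  · right; constructor <;> linarith

lemma not_reflection (hg : 1 - lam < 2 * ζ) : ¬ EmbedsInto K (-1) 1 := by
  intro hf
  have h1 := hf.2 _ (h.map_mem 1 1 h.one_mem)
  simp only [offset_one] at h1
  have := h.lam_pos
  have := h.lt_zeta
  have := h.zeta_lt
  rcases h.location h1 with h2 | h2 | h2 <;> linarith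

/-- The image of `K` either lies in a single piece or crosses only the right-hand gap. -/
lemma location_of_lt_one (hg : 1 - lam < 2 * ζ) {r b : ℝ} (hf : EmbedsInto K r b) (hr : |r| < 1) :
    (∃ k, (offset lam ζ k ≤ b ∧ b ≤ offset lam ζ k + lam) ∧
      (offset lam ζ k ≤ r + b ∧ r + b ≤ offset lam ζ k + lam)) ∨
    (ζ ≤ b ∧ b ≤ ζ + lam ∧ 1 - lam ≤ r + b ∧ r + b ≤ 1) ∨
    (ζ ≤ r + b ∧ r + b ≤ ζ + lam ∧ 1 - lam ≤ b ∧ b ≤ 1) := by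
  obtain ⟨h0, h1⟩ := h.endpoints hf
  have a1 := h.nonneg _ h0
  have a2 := h.nonneg _ h1
  have a3 := h.le_one _ h0
  have a4 := h.le_one _ h1
  have hz := h.lt_zeta
  have hz2 := h.zeta_lt
  have hl := h.lam_pos
  have ns : ¬ ((b ≤ lam ∧ ζ ≤ r + b) ∨ (r + b ≤ lam ∧ ζ ≤ b)) := by
    intro hst
    have := h.straddle_le hg hf (α := lam) (β := ζ) (by
      intro x hx
      rcases h.location hx with h | h | h
      · exact Or.inl h
      · exact Or.inr h.1
      · right; linarith) hst
    nlinarith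
  rcases h.location h0 with h2 | h2 | h2 <;> rcases h.location h1 with h3 | h3 | h3
  · exact Or.inl ⟨0, by simp; constructor <;> constructor <;> linarith⟩
  · exact absurd (Or.inl ⟨h2, h3.1⟩) ns
  · exact absurd (Or.inl ⟨h2, by linarith⟩) ns
  · exact absurd (Or.inr ⟨h3, h2.1⟩) ns
  · exact Or.inl ⟨1, by simp; constructor <;> constructor <;> linarith⟩
  · right; left; refine ⟨?_, ?_, ?_, ?_⟩ <;> linarith
  · exact absurd (Or.inr ⟨h3, by linarith⟩) ns
  · right; right; refine ⟨?_, ?_, ?_, ?_⟩ <;> linarith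
  · exact Or.inl ⟨2, by simp; constructor <;> constructor <;> linarith⟩

end ThreePartCantor

/-- A class of affine self-embeddings of `K`, not containing the identity, that is closed under
precomposition with the three maps and under removing an outermost map. -/
structure StableClass (lam ζ : ℝ) (K : Set ℝ) (Q : ℝ → ℝ → Prop) : Prop where
  embeds : ∀ r b, Q r b → EmbedsInto K r b
  not_id : ¬ Q 1 0
  pre : ∀ r b i, Q r b → Q (r * lam) (r * offset lam ζ i + b)
  post : ∀ r b k, Q r b → EmbedsInto K (r / lam) ((b - offset lam ζ k) / lam) →
    Q (r / lam) ((b - offset lam ζ k) / lam)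

/-- One endpoint of the image of `[0, 1]` lies in the second piece and the other one in the
third piece. -/
def Crosses (lam ζ r b : ℝ) : Prop :=
  (ζ ≤ b ∧ b ≤ ζ + lam ∧ 1 - lam ≤ r + b ∧ r + b ≤ 1) ∨
    (ζ ≤ r + b ∧ r + b ≤ ζ + lam ∧ 1 - lam ≤ b ∧ b ≤ 1)

lemma Crosses.of_pos {lam ζ r b : ℝ} (hc : Crosses lam ζ r b) (hr : 0 < r)
    (hz : ζ < 1 - 2 * lam) : ζ ≤ b ∧ b ≤ ζ + lam ∧ 1 - lam ≤ r + b ∧ r + b ≤ 1 := by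
  rcases hc with hc | hc
  · exact hc
  · exfalso; linarith [hc.2.1, hc.2.2.1]

lemma Crosses.of_neg {lam ζ r b : ℝ} (hc : Crosses lam ζ r b) (hr : r < 0)
    (hz : ζ < 1 - 2 * lam) : ζ ≤ r + b ∧ r + b ≤ ζ + lam ∧ 1 - lam ≤ b ∧ b ≤ 1 := by
  rcases hc with hc | hc
  · exfalso; linarith [hc.2.1, hc.2.2.1]
  · exact hc

lemma mul_bounds_of_div {lam c A r u v u' v' : ℝ} (hl : 0 < lam)
    (hb : u ≤ (A - c) / lam ∧ (A - c) / lam ≤ v ∧ u' ≤ r + (A - c) / lam ∧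
      r + (A - c) / lam ≤ v') :
    lam * u + c ≤ A ∧ A ≤ lam * v + c ∧ lam * u' + c ≤ r * lam + A ∧ r * lam + A ≤ lam * v' + c := by
  obtain ⟨y, hy⟩ : ∃ y, y = (A - c) / lam := ⟨_, rfl⟩
  have hA : A = lam * y + c := by rw [hy]; field_simp; ring
  rw [← hy] at hb
  obtain ⟨h1, h2, h3, h4⟩ := hb
  subst hA
  refine ⟨?_, ?_, ?_, ?_⟩ <;> nlinarith

namespace StableClass

variable {lam ζ : ℝ} {K : Set ℝ} {Q : ℝ → ℝ → Prop}

lemma crosses_of_maximal (hQ : StableClass lam ζ K Q) (h : ThreePartCantor lam ζ K)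
    (hg : 1 - lam < 2 * ζ) {r b : ℝ} (hf : Q r b) (hr : |r| < 1)
    (hmax : ∀ r' b', Q r' b' → |r'| ≠ |r| / lam) : Crosses lam ζ r b := by
  rcases h.location_of_lt_one hg (hQ.embeds _ _ hf) hr with ⟨k, h0, h1⟩ | hc
  · refine absurd ?_ (hmax _ _ (hQ.post _ _ k hf (h.peel (hQ.embeds _ _ hf) h0 h1)))
    rw [abs_div, abs_of_pos h.lam_pos]
  · exact hc

lemma child (hQ : StableClass lam ζ K Q) (h : ThreePartCantor lam ζ K)
    (hg : 1 - lam < 2 * ζ) {r b : ℝ} (hf : Q r b) (hr : |r| < 1)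
    (hmax : ∀ r' b', Q r' b' → |r'| ≠ |r| / lam) (i : Fin 3) :
    Crosses lam ζ (r * lam) (r * offset lam ζ i + b) ∨
      ∃ k, Q r ((r * offset lam ζ i + b - offset lam ζ k) / lam) ∧
        Crosses lam ζ r ((r * offset lam ζ i + b - offset lam ζ k) / lam) := by
  have hq := hQ.pre r b i hf
  have hl := h.lam_pos
  have hr' : |r * lam| < 1 := by
    rw [abs_mul, abs_of_pos hl]
    nlinarith [abs_nonneg r, h.lam_lt]
  rcases h.location_of_lt_one hg (hQ.embeds _ _ hq) hr' with ⟨k, h0, h1⟩ | hc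
  · right
    have := hQ.post _ _ k hq (h.peel (hQ.embeds _ _ hq) h0 h1)
    rw [mul_div_cancel_right₀ _ hl.ne'] at this
    exact ⟨k, this, hQ.crosses_of_maximal h hg this hr hmax⟩
  · exact Or.inl hc

lemma false_of_maximal_pos (hQ : StableClass lam ζ K Q) (h : ThreePartCantor lam ζ K)
    (hg : 1 - lam < 2 * ζ) {r b : ℝ} (hf : Q r b) (hr : |r| < 1)
    (hmax : ∀ r' b', Q r' b' → |r'| ≠ |r| / lam) (hpos : 0 < r) : False := by
  have hl := h.lam_pos
  have hl3 := h.lam_lt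
  have hz := h.lt_zeta
  have hz2 := h.zeta_lt
  have hrl : 0 < r * lam := mul_pos hpos hl
  have hself := (hQ.crosses_of_maximal h hg hf hr hmax).of_pos hpos hz2
  have m1 : r * lam < r * ζ := mul_lt_mul_of_pos_left hz hpos
  have m2 : r * ζ < r * (1 - 2 * lam) := mul_lt_mul_of_pos_left hz2 hpos
  have m3 : lam * lam < lam * ζ := mul_lt_mul_of_pos_left hz hl
  have m4 : lam * ζ < lam * (1 - 2 * lam) := mul_lt_mul_of_pos_left hz2 hl
  have m5 : 0 < lam * lam := mul_pos hl hl
  have child' : ∀ i, (ζ ≤ r * offset lam ζ i + b ∧ r * offset lam ζ i + b ≤ ζ + lam ∧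
      1 - lam ≤ r * lam + (r * offset lam ζ i + b) ∧ r * lam + (r * offset lam ζ i + b) ≤ 1) ∨
      ∃ k, lam * ζ + offset lam ζ k ≤ r * offset lam ζ i + b ∧
        r * offset lam ζ i + b ≤ lam * (ζ + lam) + offset lam ζ k ∧
        lam * (1 - lam) + offset lam ζ k ≤ r * lam + (r * offset lam ζ i + b) ∧
        r * lam + (r * offset lam ζ i + b) ≤ lam * 1 + offset lam ζ k := by
    intro i
    rcases hQ.child h hg hf hr hmax i with hc | ⟨k, -, hc⟩
    · exact Or.inl (hc.of_pos hrl hz2)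
    · exact Or.inr ⟨k, mul_bounds_of_div hl (hc.of_pos hpos hz2)⟩
  have pat : (r * ζ + b ≤ ζ + lam ∧ 1 - lam ≤ r * lam + (r * ζ + b)) ∧
      lam * ζ + (1 - lam) ≤ r * (1 - lam) + b := by
    have c0 := child' 0
    have c1 := child' 1
    have c2 := child' 2
    simp only [Fin.exists_fin_succ, Fin.succ_zero_eq_one, Fin.succ_one_eq_two,
      IsEmpty.exists_iff, or_false,
      offset_zero, offset_one, offset_two, mul_zero, zero_add, add_zero] at c0 c1 c2
    rcases c0 with c0 | c0 | c0 | c0 <;> rcases c1 with c1 | c1 | c1 | c1 <;>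
      rcases c2 with c2 | c2 | c2 | c2 <;>
      obtain ⟨p1, p2, p3, p4⟩ := c0 <;> obtain ⟨q1, q2, q3, q4⟩ := c1 <;>
      obtain ⟨s1, s2, s3, s4⟩ := c2 <;>
      first
        | (exfalso; linarith)
        | exact ⟨⟨q2, q3⟩, s1⟩
  obtain ⟨⟨q2, q3⟩, s1⟩ := pat
  have gap2 : ∀ x ∈ K, x ≤ ζ + lam ∨ 1 - lam ≤ x := by
    intro x hx
    rcases h.location hx with h1 | h1 | h1
    · left; linarith
    · exact Or.inl h1.2
    · exact Or.inr h1
  have gap21 : ∀ x ∈ K, x ≤ 1 - lam + lam * lam ∨ 1 - lam + lam * ζ ≤ x := by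
    intro x hx
    rcases gap2 x hx with h1 | h1
    · left; linarith
    have := h.preimage_mem hx (k := 2) (by simpa using h1) (by simpa using h.le_one x hx)
    rw [offset_two] at this
    rcases h.location this with h2 | h2 | h2
    · left; rw [div_le_iff₀ hl] at h2; linarith
    · right; rw [le_div_iff₀ hl] at h2; linarith
    · right; rw [le_div_iff₀ hl] at h2; linarith
  have hmid := hQ.embeds _ _ (hQ.pre r b 1 hf)
  rw [offset_one] at hmid
  have t1 := h.straddle_le hg hmid gap2 (Or.inl ⟨q2, q3⟩)
  rw [abs_of_pos hrl] at t1
  have hr1 : r < 1 := lt_of_abs_lt hr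
  rcases gap21 _ (h.endpoints hmid).2 with h1 | h1
  · have hb := h.endpoints (hQ.embeds _ _ hf)
    have := h.gap_le hg (c := ζ + lam) (d := 1 - lam) (by linarith) (by linarith) gap2
    have e1 : lam * (ζ - lam) ≤ r * (1 - 2 * lam - ζ) := by nlinarith
    have e2 : r * (1 - 2 * lam - ζ) ≤ r * (r * lam * (ζ - lam)) :=
      mul_le_mul_of_nonneg_left (by linarith) hpos.le
    have e3 : r * (r * lam * (ζ - lam)) < lam * (ζ - lam) := by
      have : r * r < 1 := by nlinarith
      have : 0 < lam * (ζ - lam) := mul_pos hl (by linarith)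
      nlinarith
    linarith
  · have := h.straddle_le hg hmid gap21 (Or.inl ⟨by linarith, h1⟩)
    rw [abs_of_pos hrl] at this
    have : 0 < lam * (ζ - lam) := mul_pos hl (by linarith)
    nlinarith

lemma pattern_of_maximal_neg (hQ : StableClass lam ζ K Q) (h : ThreePartCantor lam ζ K)
    (hg : 1 - lam < 2 * ζ) {r b : ℝ} (hf : Q r b) (hr : |r| < 1)
    (hmax : ∀ r' b', Q r' b' → |r'| ≠ |r| / lam) (hneg : r < 0) :
    r * lam + (r * ζ + b) ≤ ζ + lam ∧ Q r ((b - (1 - lam)) / lam) ∧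
      Q r ((r * (1 - lam) + b - ζ) / lam) := by
  have hl := h.lam_pos
  have hl3 := h.lam_lt
  have hz := h.lt_zeta
  have hz2 := h.zeta_lt
  have hrl : r * lam < 0 := mul_neg_of_neg_of_pos hneg hl
  have hself := (hQ.crosses_of_maximal h hg hf hr hmax).of_neg hneg hz2
  have m1 : r * ζ < r * lam := mul_lt_mul_of_neg_left hz hneg
  have m2 : r * (1 - 2 * lam) < r * ζ := mul_lt_mul_of_neg_left hz2 hneg
  have m3 : lam * lam < lam * ζ := mul_lt_mul_of_pos_left hz hl
  have m4 : lam * ζ < lam * (1 - 2 * lam) := mul_lt_mul_of_pos_left hz2 hl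
  have m5 : 0 < lam * lam := mul_pos hl hl
  have child' : ∀ i, (ζ ≤ r * lam + (r * offset lam ζ i + b) ∧
      r * lam + (r * offset lam ζ i + b) ≤ ζ + lam ∧
      1 - lam ≤ r * offset lam ζ i + b ∧ r * offset lam ζ i + b ≤ 1) ∨
      ∃ k, (lam * ζ + offset lam ζ k ≤ r * lam + (r * offset lam ζ i + b) ∧
        r * lam + (r * offset lam ζ i + b) ≤ lam * (ζ + lam) + offset lam ζ k ∧
        lam * (1 - lam) + offset lam ζ k ≤ r * offset lam ζ i + b ∧
        r * offset lam ζ i + b ≤ lam * 1 + offset lam ζ k) ∧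
        Q r ((r * offset lam ζ i + b - offset lam ζ k) / lam) := by
    intro i
    rcases hQ.child h hg hf hr hmax i with hc | ⟨k, hq, hc⟩
    · exact Or.inl (hc.of_neg hrl hz2)
    · obtain ⟨a1, a2, a3, a4⟩ := hc.of_neg hneg hz2
      obtain ⟨b1, b2, b3, b4⟩ := mul_bounds_of_div hl ⟨a3, a4, a1, a2⟩
      exact Or.inr ⟨k, ⟨b3, b4, b1, b2⟩, hq⟩
  have c0 := child' 0
  have c1 := child' 1
  have c2 := child' 2
  simp only [Fin.exists_fin_succ, Fin.succ_zero_eq_one, Fin.succ_one_eq_two,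
    IsEmpty.exists_iff, or_false,
    offset_zero, offset_one, offset_two, mul_zero, zero_add, add_zero] at c0 c1 c2
  rcases c0 with ⟨p1, p2, p3, p4⟩ | ⟨⟨p1, p2, p3, p4⟩, p5⟩ | ⟨⟨p1, p2, p3, p4⟩, p5⟩ |
      ⟨⟨p1, p2, p3, p4⟩, p5⟩ <;>
    rcases c1 with ⟨q1, q2, q3, q4⟩ | ⟨⟨q1, q2, q3, q4⟩, q5⟩ | ⟨⟨q1, q2, q3, q4⟩, q5⟩ |
      ⟨⟨q1, q2, q3, q4⟩, q5⟩ <;>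
    rcases c2 with ⟨s1, s2, s3, s4⟩ | ⟨⟨s1, s2, s3, s4⟩, s5⟩ | ⟨⟨s1, s2, s3, s4⟩, s5⟩ |
      ⟨⟨s1, s2, s3, s4⟩, s5⟩ <;>
    first
      | (exfalso; linarith)
      | exact ⟨q2, p5, s5⟩

lemma false_of_maximal_neg (hQ : StableClass lam ζ K Q) (h : ThreePartCantor lam ζ K)
    (hg : 1 - lam < 2 * ζ) {r b : ℝ} (hf : Q r b) (hr : |r| < 1)
    (hmax : ∀ r' b', Q r' b' → |r'| ≠ |r| / lam) (hneg : r < 0) : False := by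
  have hl := h.lam_pos
  have hl3 := h.lam_lt
  have hz := h.lt_zeta
  have pat := fun b (hb : Q r b) => hQ.pattern_of_maximal_neg h hg hb hr hmax hneg
  have left : ∀ n : ℕ, ∀ b, Q r b → 1 - b ≤ lam ^ n := by
    intro n
    induction n with
    | zero =>
      intro b hb
      have := h.nonneg _ (h.endpoints (hQ.embeds _ _ hb)).1
      simpa using this
    | succ n ih =>
      intro b hb
      have := mul_le_mul_of_nonneg_left (ih _ (pat b hb).2.1) hl.le
      rw [mul_sub, mul_div_cancel₀ _ hl.ne'] at this
      rw [pow_succ]; linarith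
  have hb1 : 1 ≤ b := by
    by_contra hb
    obtain ⟨n, hn⟩ := exists_pow_lt_of_lt_one (sub_pos.2 (not_le.1 hb)) (by linarith : lam < 1)
    linarith [left n b hf]
  have right : ∀ n : ℕ, ∀ b, Q r b → ζ - (1 - lam) * (r + b) ≤ lam ^ n := by
    intro n
    induction n with
    | zero =>
      intro b hb
      have := h.nonneg _ (h.endpoints (hQ.embeds _ _ hb)).2
      have := mul_nonneg (by linarith : 0 ≤ 1 - lam) this
      have := h.zeta_lt
      rw [pow_zero]; linarith
    | succ n ih =>
      intro b hb
      have := mul_le_mul_of_nonneg_left (ih _ (pat b hb).2.2) hl.le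
      have e : lam * (ζ - (1 - lam) * (r + (r * (1 - lam) + b - ζ) / lam)) =
        ζ - (1 - lam) * (r + b) := by field_simp; ring
      rw [pow_succ]; linarith
  have hb2 : ζ ≤ (1 - lam) * (r + b) := by
    by_contra hb
    obtain ⟨n, hn⟩ := exists_pow_lt_of_lt_one (sub_pos.2 (not_le.1 hb)) (by linarith : lam < 1)
    linarith [right n b hf]
  have := (pat b hf).1
  have : r * (1 - 2 * lam) < r * ζ := mul_lt_mul_of_neg_left h.zeta_lt hneg
  have : lam * 1 ≤ lam * b := mul_le_mul_of_nonneg_left hb1 hl.le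
  nlinarith

lemma isEmpty_of_gap (hQ : StableClass lam ζ K Q) (h : ThreePartCantor lam ζ K)
    (hg : 1 - lam < 2 * ζ) (r b : ℝ) : ¬ Q r b := by
  intro hf
  have hl := h.lam_pos
  obtain ⟨j, ⟨r', b', hf', hr'⟩, hj⟩ : ∃ j : ℕ, (∃ r' b', Q r' b' ∧ |r'| = |r| / lam ^ j) ∧
      ¬ ∃ r' b', Q r' b' ∧ |r'| = |r| / lam ^ (j + 1) := by
    by_contra! hcon
    have all : ∀ j : ℕ, ∃ r' b', Q r' b' ∧ |r'| = |r| / lam ^ j := by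
      intro j
      induction j with
      | zero => exact ⟨r, b, hf, by simp⟩
      | succ j ih => exact hcon j ih
    obtain ⟨n, hn⟩ := exists_pow_lt_of_lt_one (abs_pos.2 (hQ.embeds _ _ hf).1)
      (by linarith [h.lam_lt] : lam < 1)
    obtain ⟨r', b', hf', hr'⟩ := all n
    have := h.abs_le_one (hQ.embeds _ _ hf')
    rw [hr', div_le_one (pow_pos hl n)] at this
    linarith
  have hmax : ∀ r'' b'', Q r'' b'' → |r''| ≠ |r'| / lam := by
    intro r'' b'' h1 h2
    exact hj ⟨r'', b'', h1, by rw [h2, hr', pow_succ, div_div]⟩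
  have hemb := hQ.embeds _ _ hf'
  rcases (h.abs_le_one hemb).lt_or_eq with h1 | h1
  · rcases lt_or_gt_of_ne hemb.1 with h2 | h2
    · exact hQ.false_of_maximal_neg h hg hf' h1 hmax h2
    · exact hQ.false_of_maximal_pos h hg hf' h1 hmax h2
  · rcases h.eq_id_or_reflection hemb h1 with ⟨rfl, rfl⟩ | ⟨rfl, rfl⟩
    · exact hQ.not_id hf'
    · exact h.not_reflection hg hemb

lemma reflect (hQ : StableClass lam ζ K Q) :
    StableClass lam (1 - lam - ζ) {x | 1 - x ∈ K} (fun r b => Q r (1 - r - b)) where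
  embeds r b hb := by
    obtain ⟨h0, h1⟩ := hQ.embeds _ _ hb
    refine ⟨h0, fun x hx => ?_⟩
    have := h1 _ hx
    rw [Set.mem_ofPred_eq]
    convert this using 1
    ring
  not_id hb := hQ.not_id (by simpa using hb)
  pre r b i hb := by
    have := hQ.pre _ _ i.rev hb
    fin_cases i <;> simp [Fin.rev] at this ⊢ <;> convert this using 1 <;> ring
  post r b k hb he := by
    rcases eq_or_ne lam 0 with rfl | hl
    · exact absurd (div_zero r) he.1
    have key : 1 - r / lam - (b - offset lam (1 - lam - ζ) k) / lam =
        (1 - r - b - offset lam ζ k.rev) / lam := by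
      fin_cases k <;> simp [Fin.rev] <;> field_simp <;> ring
    rw [key]
    refine hQ.post _ _ k.rev hb ⟨he.1, fun x hx => ?_⟩
    have := he.2 (1 - x) (by simpa using hx)
    rw [Set.mem_ofPred_eq] at this
    rw [← key]
    convert this using 1
    ring

/-- If the two first-level gaps have different lengths, then there is no self-embedding in a
stable class. -/
lemma isEmpty (hQ : StableClass lam ζ K Q) (h : ThreePartCantor lam ζ K)
    (hne : 2 * ζ ≠ 1 - lam) (r b : ℝ) : ¬ Q r b := by
  rcases lt_or_gt_of_ne hne with hg | hg
  · intro hf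
    refine hQ.reflect.isEmpty_of_gap h.reflect (by linarith) r (1 - r - b) ?_
    rwa [sub_sub_cancel]
  · exact hQ.isEmpty_of_gap h hg r b

end StableClass

/-- The value at `0` of the composition along a word of the maps `x ↦ lam * x + d k`. -/
def digitSum (lam : ℝ) (d : Fin 3 → ℝ) : List (Fin 3) → ℝ
  | [] => 0
  | k :: w => d k + lam * digitSum lam d w

section DigitSum

variable {lam : ℝ}

lemma digitSum_append (d : Fin 3 → ℝ) (u v : List (Fin 3)) :
    digitSum lam d (u ++ v) = digitSum lam d u + lam ^ u.length * digitSum lam d v := by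
  induction u with
  | nil => simp [digitSum]
  | cons k u ih => simp only [List.cons_append, digitSum, ih, List.length_cons, pow_succ]; ring

lemma digitSum_replicate (d : Fin 3 → ℝ) (k : Fin 3) (n : ℕ) :
    (1 - lam) * digitSum lam d (List.replicate n k) = d k * (1 - lam ^ n) := by
  induction n with
  | zero => simp [digitSum]
  | succ n ih =>
    simp only [List.replicate_succ, digitSum, pow_succ]
    linear_combination lam * ih

lemma digitSum_add (d e : Fin 3 → ℝ) (w : List (Fin 3)) :
    digitSum lam (d + e) w = digitSum lam d w + digitSum lam e w := by
  induction w with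
  | nil => simp [digitSum]
  | cons k w ih => simp only [digitSum, ih, Pi.add_apply]; ring

lemma digitSum_offset (ζ : ℝ) (w : List (Fin 3)) :
    digitSum lam (offset lam ζ) w =
      ζ * digitSum lam ![0, 1, 0] w + (1 - lam) * digitSum lam ![0, 0, 1] w := by
  induction w with
  | nil => simp [digitSum]
  | cons k w ih => simp only [digitSum, ih]; fin_cases k <;> simp <;> ring

lemma digitSum_nonneg (hl : 0 < lam) {d : Fin 3 → ℝ} (hd : ∀ k, 0 ≤ d k) (w : List (Fin 3)) :
    0 ≤ digitSum lam d w := by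
  induction w with
  | nil => exact le_rfl
  | cons k w ih => exact add_nonneg (hd k) (mul_nonneg hl.le ih)

lemma digitSum_le (hl : 0 < lam) (hl1 : lam < 1) {d : Fin 3 → ℝ} (hd : ∀ k, d k ≤ 1)
    (w : List (Fin 3)) : (1 - lam) * digitSum lam d w ≤ 1 - lam ^ w.length := by
  induction w with
  | nil => simp [digitSum]
  | cons k w ih =>
    have h1 := mul_le_mul_of_nonneg_left ih hl.le
    have h2 := mul_le_mul_of_nonneg_left (hd k) (sub_nonneg.2 hl1.le)
    simp only [digitSum, List.length_cons, pow_succ]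
    linarith

lemma digitSum_lt (hl : 0 < lam) (hl3 : lam < 1 / 3) {d : Fin 3 → ℝ} (hd : ∀ k, d k ≤ 1)
    (w : List (Fin 3)) : digitSum lam d w < 3 / 2 := by
  have h1 := digitSum_le hl (by linarith) hd w
  have h2 := pow_pos hl w.length
  by_contra! h3
  nlinarith

lemma digitSum_eq_zero_or_le (hl : 0 < lam) (hl1 : lam < 1) {d : Fin 3 → ℝ}
    (hd : ∀ k, d k = 0 ∨ d k = 1) (w : List (Fin 3)) :
    digitSum lam d w = 0 ∨ lam ^ w.length ≤ lam * digitSum lam d w := by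
  have hd0 : ∀ k, 0 ≤ d k := fun k => by rcases hd k with h | h <;> simp [h]
  induction w with
  | nil => exact Or.inl rfl
  | cons k w ih =>
    have h0 := digitSum_nonneg hl hd0 w
    simp only [digitSum, List.length_cons, pow_succ]
    rcases ih with h1 | h1
    · rcases hd k with h2 | h2
      · left; rw [h1, h2]; ring
      · right
        rw [h1, h2]
        have := pow_le_one₀ hl.le hl1.le (n := w.length)
        nlinarith
    · right
      have := mul_le_mul_of_nonneg_left h1 hl.le
      have := mul_nonneg hl.le (hd0 k)
      nlinarith

lemma digitSum_mem {F : Subfield ℝ} (hl : lam ∈ F) {d : Fin 3 → ℝ} (hd : ∀ k, d k ∈ F)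
    (w : List (Fin 3)) : digitSum lam d w ∈ F := by
  induction w with
  | nil => exact F.zero_mem
  | cons k w ih => exact F.add_mem (hd k) (F.mul_mem hl ih)

end DigitSum

lemma coeff_eq_of_notMem {F : Subfield ℝ} {ζ μ : ℝ} (hζ : ζ ∉ F) (hμ : μ ∈ F) (hμ0 : μ ≠ 0)
    {B C B' C' : ℝ} (hB : B ∈ F) (hC : C ∈ F) (hB' : B' ∈ F) (hC' : C' ∈ F)
    (he : ζ * B + μ * C = ζ * B' + μ * C') : B = B' ∧ C = C' := by
  have hBB : B = B' := by
    by_contra hne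
    refine hζ ?_
    have : ζ = μ * (C' - C) / (B - B') := by
      rw [eq_div_iff (sub_ne_zero.2 hne)]; linarith
    rw [this]
    exact F.div_mem (F.mul_mem hμ (F.sub_mem hC' hC)) (F.sub_mem hB hB')
  subst hBB
  exact ⟨rfl, mul_left_cancel₀ hμ0 (by linarith)⟩

namespace ThreePartCantor

variable {lam ζ : ℝ} {K : Set ℝ} (h : ThreePartCantor lam ζ K)
include h

lemma word_mem (w : List (Fin 3)) {x : ℝ} (hx : x ∈ K) :
    lam ^ w.length * x + digitSum lam (offset lam ζ) w ∈ K := by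
  induction w with
  | nil => simpa [digitSum] using hx
  | cons k w ih =>
    have := h.map_mem k _ ih
    simp only [List.length_cons, digitSum, pow_succ]
    convert this using 1
    ring

lemma digitSum_mem_self (w : List (Fin 3)) : digitSum lam (offset lam ζ) w ∈ K := by
  simpa using h.word_mem w h.zero_mem

lemma digitSum_replicate_zero (n : ℕ) :
    digitSum lam (offset lam ζ) (List.replicate n 0) = 0 := by
  have := digitSum_replicate (lam := lam) (offset lam ζ) 0 n
  simp only [offset_zero, zero_mul, mul_eq_zero] at this
  exact this.resolve_left (by linarith [h.lam_lt])

lemma digitSum_replicate_two (n : ℕ) :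
    digitSum lam (offset lam ζ) (List.replicate n 2) = 1 - lam ^ n := by
  have := digitSum_replicate (lam := lam) (offset lam ζ) 2 n
  exact mul_left_cancel₀ (by linarith [h.lam_lt] : (1 : ℝ) - lam ≠ 0) this

lemma stableClass : StableClass lam ζ K (fun r b => EmbedsInto K r b ∧ ∀ v w : List (Fin 3),
    r * lam ^ v.length = lam ^ w.length →
      r * digitSum lam (offset lam ζ) v + b ≠ digitSum lam (offset lam ζ) w) where
  embeds _ _ hb := hb.1
  not_id hb := hb.2 [] [] (by simp) (by simp)
  pre r b i hb := by
    refine ⟨⟨mul_ne_zero hb.1.1 h.lam_pos.ne', fun x hx => ?_⟩, fun v w h1 h2 => ?_⟩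
    · have := hb.1.2 _ (h.map_mem i x hx)
      convert this using 1
      ring
    · refine hb.2 (i :: v) w ?_ ?_
      · rw [← h1, List.length_cons, pow_succ]; ring
      · rw [← h2, digitSum]; ring
  post r b k hb he := by
    have hl := h.lam_pos.ne'
    refine ⟨he, fun v w h1 h2 => hb.2 v (k :: w) ?_ ?_⟩
    · rw [List.length_cons, pow_succ, ← h1]; field_simp
    · rw [digitSum, ← h2]; field_simp; ring

variable (hζQ : ζ ∉ Subfield.closure ({lam} : Set ℝ))
include hζQ

lemma exists_word_pair {r b : ℝ} (hf : EmbedsInto K r b) : ∃ v w : List (Fin 3),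
    r * lam ^ v.length = lam ^ w.length ∧
      r * digitSum lam (offset lam ζ) v + b = digitSum lam (offset lam ζ) w := by
  have hlF : lam ∈ Subfield.closure ({lam} : Set ℝ) := Subfield.subset_closure rfl
  have hne : 2 * ζ ≠ 1 - lam := by
    intro he
    refine hζQ ?_
    rw [show ζ = (1 - lam) / 2 by linarith]
    exact Subfield.div_mem _ (Subfield.sub_mem _ (Subfield.one_mem _) hlF) (ofNat_mem _ 2)
  by_contra! hcon
  exact h.stableClass.isEmpty h hne r b ⟨hf, hcon⟩

lemma exists_word_pair_extending {r b : ℝ} (hf : EmbedsInto K r b) (u : List (Fin 3)) :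
    ∃ v w : List (Fin 3), r * lam ^ (u ++ v).length = lam ^ w.length ∧
      r * digitSum lam (offset lam ζ) (u ++ v) + b = digitSum lam (offset lam ζ) w := by
  obtain ⟨v, w, h1, h2⟩ := h.exists_word_pair hζQ (r := r * lam ^ u.length)
    (b := r * digitSum lam (offset lam ζ) u + b)
    ⟨mul_ne_zero hf.1 (pow_ne_zero _ h.lam_pos.ne'), fun x hx => by
      have := hf.2 _ (h.word_mem u hx)
      convert this using 1
      ring⟩
  refine ⟨v, w, ?_, ?_⟩
  · rw [← h1, List.length_append, pow_add, mul_assoc]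
  · rw [← h2, digitSum_append]; ring

lemma head_eq {m : ℕ} {b : ℝ} {k k' : Fin 3} {v w v' w' : List (Fin 3)}
    (h1 : lam ^ (m + 1) * digitSum lam (offset lam ζ) v + b =
      digitSum lam (offset lam ζ) (k :: w))
    (h2 : lam ^ (m + 1) * digitSum lam (offset lam ζ) v' + b =
      digitSum lam (offset lam ζ) (k' :: w')) : k = k' := by
  have hl := h.lam_pos
  have hl3 := h.lam_lt
  have hlF : lam ∈ Subfield.closure ({lam} : Set ℝ) := Subfield.subset_closure rfl
  have hmF : 1 - lam ∈ Subfield.closure ({lam} : Set ℝ) :=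
    Subfield.sub_mem _ (Subfield.one_mem _) hlF
  have hpow := pow_le_one₀ hl.le (by linarith : lam ≤ 1) (n := m)
  have hpow0 := pow_pos hl m
  have mem : ∀ d : Fin 3 → ℝ, (∀ i, d i = 0 ∨ d i = 1) → ∀ (j : Fin 3) (x y : List (Fin 3)),
      digitSum lam d (j :: x) - lam ^ (m + 1) * digitSum lam d y ∈
        Subfield.closure ({lam} : Set ℝ) := by
    intro d hd j x y
    have hdF : ∀ i, d i ∈ Subfield.closure ({lam} : Set ℝ) := fun i => by
      rcases hd i with h | h <;> rw [h]
      exacts [Subfield.zero_mem _, Subfield.one_mem _]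
    exact Subfield.sub_mem _ (digitSum_mem hlF hdF _)
      (Subfield.mul_mem _ (Subfield.pow_mem _ hlF _) (digitSum_mem hlF hdF _))
  have digit : ∀ d : Fin 3 → ℝ, (∀ i, d i = 0 ∨ d i = 1) →
      digitSum lam d (k :: w) - lam ^ (m + 1) * digitSum lam d v =
        digitSum lam d (k' :: w') - lam ^ (m + 1) * digitSum lam d v' → d k = d k' := by
    intro d hd he
    have hd0 : ∀ i, 0 ≤ d i := fun i => by rcases hd i with h | h <;> simp [h]
    have hd1 : ∀ i, d i ≤ 1 := fun i => by rcases hd i with h | h <;> simp [h]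
    have lower : ∀ x y, -(3 / 2) < digitSum lam d x - lam ^ m * digitSum lam d y := by
      intro x y
      have := digitSum_nonneg hl hd0 x
      have := digitSum_lt hl hl3 hd1 y
      have := mul_le_mul_of_nonneg_right hpow (digitSum_nonneg hl hd0 y)
      linarith
    have upper : ∀ x y, digitSum lam d x - lam ^ m * digitSum lam d y < 3 / 2 := by
      intro x y
      have := mul_nonneg hpow0.le (digitSum_nonneg hl hd0 y)
      have := digitSum_lt hl hl3 hd1 x
      linarith
    have a1 := lower w v
    have a2 := upper w v
    have a3 := lower w' v'
    have a4 := upper w' v'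
    have e : d k - d k' = lam * ((digitSum lam d w' - lam ^ m * digitSum lam d v') -
        (digitSum lam d w - lam ^ m * digitSum lam d v)) := by
      simp only [digitSum, pow_succ] at he
      linear_combination he
    rcases hd k with h3 | h3 <;> rcases hd k' with h4 | h4
    · rw [h3, h4]
    · exfalso; nlinarith
    · exfalso; nlinarith
    · rw [h3, h4]
  have hB : ∀ i, (![0, 1, 0] : Fin 3 → ℝ) i = 0 ∨ (![0, 1, 0] : Fin 3 → ℝ) i = 1 := by
    intro i; fin_cases i <;> simp
  have hC : ∀ i, (![0, 0, 1] : Fin 3 → ℝ) i = 0 ∨ (![0, 0, 1] : Fin 3 → ℝ) i = 1 := by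
    intro i; fin_cases i <;> simp
  simp only [digitSum_offset] at h1 h2
  obtain ⟨e1, e2⟩ := coeff_eq_of_notMem hζQ hmF (by linarith) (mem _ hB k w v) (mem _ hC k w v)
    (mem _ hB k' w' v') (mem _ hC k' w' v') (by linear_combination h2 - h1)
  have d1 := digit _ hB e1
  have d2 := digit _ hC e2
  fin_cases k <;> fin_cases k' <;> simp at d1 d2 ⊢

/-- Every affine map sending `K` into itself is a composition of the three defining maps. -/
theorem exists_word {r b : ℝ} (hf : EmbedsInto K r b) :
    ∃ w : List (Fin 3), r = lam ^ w.length ∧ b = digitSum lam (offset lam ζ) w := by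
  have hl := h.lam_pos
  have hl1 : lam < 1 := by linarith [h.lam_lt]
  obtain ⟨m, rfl⟩ : ∃ m : ℕ, r = lam ^ m := by
    obtain ⟨v, w, h1, -⟩ := h.exists_word_pair hζQ hf
    have h2 : lam ^ w.length ≤ lam ^ v.length := by
      rw [← h1]
      nlinarith [pow_pos hl v.length, le_of_abs_le (h.abs_le_one hf)]
    have h3 := (pow_le_pow_iff_right_of_lt_one₀ hl hl1).1 h2
    refine ⟨w.length - v.length, mul_right_cancel₀ (pow_ne_zero v.length hl.ne') ?_⟩
    rw [h1, ← pow_add, Nat.sub_add_cancel h3]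
  induction m generalizing b with
  | zero =>
    refine ⟨[], by simp, ?_⟩
    rcases h.eq_id_or_reflection hf (by simp) with h1 | h1
    · exact h1.2
    · norm_num at h1
  | succ m ih =>
    have cons : ∀ v w : List (Fin 3), lam ^ (m + 1) * lam ^ v.length = lam ^ w.length →
        ∃ k w', w = k :: w' := by
      intro v w hw
      rw [← pow_add] at hw
      have := (pow_right_injective₀ hl hl1.ne) hw
      cases w with
      | nil => simp at this
      | cons k w => exact ⟨k, w, rfl⟩
    have hpos := pow_pos hl (m + 1)
    have hle := pow_le_one₀ hl.le hl1.le (n := m + 1)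
    obtain ⟨v₀, w₀, h1, h2⟩ := h.exists_word_pair hζQ hf
    obtain ⟨k, w₁, rfl⟩ := cons _ _ h1
    have near : ∀ u : List (Fin 3), ∃ y ∈ K, offset lam ζ k ≤
        lam ^ (m + 1) * (digitSum lam (offset lam ζ) u + lam ^ u.length * y) + b ∧
        lam ^ (m + 1) * (digitSum lam (offset lam ζ) u + lam ^ u.length * y) + b ≤
          offset lam ζ k + lam := by
      intro u
      obtain ⟨v, w, h3, h4⟩ := h.exists_word_pair_extending hζQ hf u
      obtain ⟨k', w', rfl⟩ := cons _ _ h3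
      have := h.head_eq hζQ h2 h4
      subst this
      refine ⟨_, h.digitSum_mem_self v, ?_⟩
      rw [← digitSum_append, h4, digitSum]
      have := h.digitSum_mem_self w'
      have h5 := h.nonneg _ this
      have h6 := h.le_one _ this
      constructor <;> nlinarith
    have close : ∀ n : ℕ, ∀ y ∈ K, 0 ≤ lam ^ (m + 1) * (lam ^ n * y) ∧
        lam ^ (m + 1) * (lam ^ n * y) ≤ lam ^ n := by
      intro n y hy
      have h3 := pow_pos hl n
      have h4 := mul_nonneg h3.le (h.nonneg y hy)
      have h5 := mul_le_mul_of_nonneg_left (h.le_one y hy) h3.le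
      refine ⟨mul_nonneg hpos.le h4, ?_⟩
      calc lam ^ (m + 1) * (lam ^ n * y) ≤ 1 * (lam ^ n * y) :=
            mul_le_mul_of_nonneg_right hle h4
        _ ≤ lam ^ n := by linarith
    have lim : ∀ x y : ℝ, (∀ n : ℕ, x ≤ y + lam ^ n) → x ≤ y := by
      intro x y hxy
      by_contra hlt
      obtain ⟨n, hn⟩ := exists_pow_lt_of_lt_one (sub_pos.2 (not_le.1 hlt)) hl1
      linarith [hxy n]
    have near0 := fun n : ℕ => near (List.replicate n 0)
    have near2 := fun n : ℕ => near (List.replicate n 2)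
    simp only [h.digitSum_replicate_zero, h.digitSum_replicate_two, List.length_replicate]
      at near0 near2
    have hb : offset lam ζ k ≤ b ∧ b ≤ offset lam ζ k + lam := by
      constructor <;> refine lim _ _ fun n => ?_ <;> obtain ⟨y, hy, h3, h4⟩ := near0 n <;>
        have := close n y hy <;> linarith
    have hrb : offset lam ζ k ≤ lam ^ (m + 1) + b ∧
        lam ^ (m + 1) + b ≤ offset lam ζ k + lam := by
      constructor <;> refine lim _ _ fun n => ?_ <;> obtain ⟨y, hy, h3, h4⟩ := near2 n <;>
        have := close n y hy <;> have := close n 1 h.one_mem <;> linarith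
    have hp := h.peel hf hb hrb
    rw [pow_succ, mul_div_cancel_right₀ _ hl.ne'] at hp
    obtain ⟨w, h5, h6⟩ := ih hp
    refine ⟨k :: w, by rw [List.length_cons, pow_succ, h5, pow_succ], ?_⟩
    rw [digitSum, ← h6]
    field_simp
    ring

end ThreePartCantor

lemma coeff_eq_of_digitSum_eq_add {lam ζ x : ℝ}
    (hζQ : ζ ∉ Subfield.closure ({lam} : Set ℝ))
    (hx : x ∈ Subfield.closure ({lam} : Set ℝ)) {u v : List (Fin 3)}
    (huv : digitSum lam (offset lam ζ) v = digitSum lam (offset lam ζ) u + x) :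
    digitSum lam ![0, 1, 0] v = digitSum lam ![0, 1, 0] u ∧
      (1 - lam) * digitSum lam ![0, 0, 1] v = (1 - lam) * digitSum lam ![0, 0, 1] u + x := by
  have hlF : lam ∈ Subfield.closure ({lam} : Set ℝ) := Subfield.subset_closure rfl
  have hmF : 1 - lam ∈ Subfield.closure ({lam} : Set ℝ) :=
    Subfield.sub_mem _ (Subfield.one_mem _) hlF
  have memB := digitSum_mem hlF (d := ![0, 1, 0]) (by simp [Fin.forall_fin_succ])
  have memC := digitSum_mem hlF (d := ![0, 0, 1]) (by simp [Fin.forall_fin_succ])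
  rw [digitSum_offset, digitSum_offset] at huv
  obtain ⟨e1, e2⟩ := coeff_eq_of_notMem hζQ (Subfield.one_mem _) one_ne_zero (memB v)
    (Subfield.mul_mem _ hmF (memC v)) (memB u)
    (Subfield.add_mem _ (Subfield.mul_mem _ hmF (memC u)) hx) (by linarith)
  exact ⟨e1, e2⟩

namespace ThreePartCantor

variable {lam ζ : ℝ} {K : Set ℝ} (h : ThreePartCantor lam ζ K)
include h

lemma fixedPoint_mem (hK : IsClosed K) : ζ / (1 - lam) ∈ K := by
  have hl1 : lam < 1 := by linarith [h.lam_lt]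
  have hs : (1 : ℝ) - lam ≠ 0 := by linarith
  have e : ∀ n : ℕ, digitSum lam (offset lam ζ) (List.replicate n 1) =
      ζ / (1 - lam) * (1 - lam ^ n) := by
    intro n
    have := digitSum_replicate (lam := lam) (offset lam ζ) 1 n
    rw [offset_one] at this
    field_simp
    linarith
  have lim : Filter.Tendsto (fun n : ℕ => ζ / (1 - lam) * (1 - lam ^ n)) Filter.atTop
      (nhds (ζ / (1 - lam) * (1 - 0))) :=
    ((tendsto_pow_atTop_nhds_zero_of_lt_one h.lam_pos.le hl1).const_sub 1).const_mul _
  rw [sub_zero, mul_one] at lim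
  exact hK.mem_of_tendsto lim (Filter.Eventually.of_forall fun n => e n ▸ h.digitSum_mem_self _)

lemma digitSum_of_fixedPoint_mem_image {p q : ℝ} (hp : (1 - lam) * p = ζ) (hq : q ∈ K)
    {w : List (Fin 3)} (hw : lam ^ w.length * q + digitSum lam (offset lam ζ) w = p) :
    (1 - lam) * digitSum lam ![0, 1, 0] w = 1 - lam ^ w.length := by
  have hl := h.lam_pos
  have hl3 := h.lam_lt
  have hz := h.lt_zeta
  have hz2 := h.zeta_lt
  have hp0 : 0 < p := by
    by_contra! hp0
    nlinarith
  have hp1 : p < 1 := by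
    by_contra! hp1
    nlinarith
  induction w with
  | nil => simp [digitSum]
  | cons k w ih =>
    have hw' : offset lam ζ k + lam * (lam ^ w.length * q + digitSum lam (offset lam ζ) w) = p := by
      rw [← hw, digitSum, List.length_cons, pow_succ]; ring
    have hm := h.word_mem w hq
    have h0 := mul_nonneg hl.le (h.nonneg _ hm)
    have h1 := mul_le_mul_of_nonneg_left (h.le_one _ hm) hl.le
    have h2 := mul_pos hl hp0
    have h3 := mul_lt_mul_of_pos_left hp1 hl
    have hk : k = 1 := by
      fin_cases k
      · simp only [Fin.zero_eta, offset_zero] at hw'; linarith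
      · rfl
      · simp only [Fin.reduceFinMk, offset_two] at hw'; linarith
    subst hk
    rw [offset_one] at hw'
    have := ih (mul_left_cancel₀ hl.ne' (by linarith))
    rw [digitSum, List.length_cons, pow_succ]
    simp only [Matrix.cons_val_one, Matrix.cons_val_zero]
    linear_combination lam * this

lemma pow_mul_mem {x : ℝ} (hx : x ∈ K) (n : ℕ) : lam ^ n * x ∈ K := by
  simpa [h.digitSum_replicate_zero] using h.word_mem (List.replicate n 0) hx

lemma one_sub_pow_mul_mem {x : ℝ} (hx : x ∈ K) (n : ℕ) : 1 - lam ^ n * (1 - x) ∈ K := by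
  have := h.word_mem (List.replicate n 2) hx
  rw [h.digitSum_replicate_two, List.length_replicate] at this
  convert this using 1
  ring

variable (hζQ : ζ ∉ Subfield.closure ({lam} : Set ℝ))
include hζQ

lemma pos_of_embedsInto {r b : ℝ} (hf : EmbedsInto K r b) : 0 < r := by
  obtain ⟨w, rfl, -⟩ := h.exists_word hζQ hf
  exact pow_pos h.lam_pos _

lemma eq_zero_of_digitSum_eq_add {x : ℝ} (hx : x ∈ Subfield.closure ({lam} : Set ℝ))
    {u v : List (Fin 3)} (hlen : lam ^ v.length = lam ^ u.length)
    (hu : (1 - lam) * digitSum lam ![0, 1, 0] u = 1 - lam ^ u.length)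
    (huv : digitSum lam (offset lam ζ) v = digitSum lam (offset lam ζ) u + x) : x = 0 := by
  have hl := h.lam_pos
  have hl1 : lam < 1 := by linarith [h.lam_lt]
  have zero : ∀ w : List (Fin 3),
      (1 - lam) * digitSum lam ![0, 1, 0] w = 1 - lam ^ w.length →
        (1 - lam) * digitSum lam ![0, 0, 1] w = 0 := by
    intro w hw
    have h1 := digitSum_le hl hl1 (d := ![0, 1, 0] + ![0, 0, 1])
      (fun i => by fin_cases i <;> simp) w
    have h2 := mul_nonneg (sub_nonneg.2 hl1.le) (digitSum_nonneg hl (d := ![0, 0, 1])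
      (fun i => by fin_cases i <;> simp) w)
    rw [digitSum_add] at h1
    linarith
  obtain ⟨e1, e2⟩ := coeff_eq_of_digitSum_eq_add hζQ hx huv
  rw [zero u hu, zero v (by rw [e1, hlen, hu])] at e2
  linarith

lemma mem_closure_and_two_lt {t : ℝ} (ht : 0 < t) {v w : List (Fin 3)}
    (hw : lam ^ w.length * t = digitSum lam (offset lam ζ) w)
    (hv : 1 - lam ^ v.length * (1 + t) = digitSum lam (offset lam ζ) v) :
    t ∈ Subfield.closure ({lam} : Set ℝ) ∧ 2 < t := by
  have hl := h.lam_pos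
  have hl3 := h.lam_lt
  have hlF : lam ∈ Subfield.closure ({lam} : Set ℝ) := Subfield.subset_closure rfl
  have hmF : 1 - lam ∈ Subfield.closure ({lam} : Set ℝ) :=
    Subfield.sub_mem _ (Subfield.one_mem _) hlF
  have memB := digitSum_mem hlF (d := ![0, 1, 0]) (by simp [Fin.forall_fin_succ])
  have memC := digitSum_mem hlF (d := ![0, 0, 1]) (by simp [Fin.forall_fin_succ])
  have powF : ∀ n : ℕ, lam ^ n ∈ Subfield.closure ({lam} : Set ℝ) :=
    fun n => Subfield.pow_mem _ hlF n
  rw [digitSum_offset] at hw hv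
  have hB0 : ∀ w, 0 ≤ digitSum lam ![0, 1, 0] w :=
    digitSum_nonneg hl (fun i => by fin_cases i <;> simp)
  have hpw := pow_pos hl w.length
  have hpv := pow_pos hl v.length
  have hB : lam ^ v.length * digitSum lam ![0, 1, 0] w +
      lam ^ w.length * digitSum lam ![0, 1, 0] v = 0 := by
    refine (coeff_eq_of_notMem (B' := 0)
      (C := lam ^ v.length * digitSum lam ![0, 0, 1] w + lam ^ w.length * digitSum lam ![0, 0, 1] v)
      (C' := lam ^ w.length * (1 - lam ^ v.length) / (1 - lam)) hζQ hmF (by linarith)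
      (Subfield.add_mem _ (Subfield.mul_mem _ (powF _) (memB w))
        (Subfield.mul_mem _ (powF _) (memB v)))
      (Subfield.add_mem _ (Subfield.mul_mem _ (powF _) (memC w))
        (Subfield.mul_mem _ (powF _) (memC v)))
      (Subfield.zero_mem _) (Subfield.div_mem _ (Subfield.mul_mem _ (powF _)
        (Subfield.sub_mem _ (Subfield.one_mem _) (powF _))) hmF) ?_).1
    rw [mul_div_cancel₀ _ (by linarith : (1 : ℝ) - lam ≠ 0)]
    linear_combination -lam ^ v.length * hw - lam ^ w.length * hv
  have hBw : digitSum lam ![0, 1, 0] w = 0 := by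
    have h1 := mul_nonneg hpv.le (hB0 w)
    have h2 := mul_nonneg hpw.le (hB0 v)
    have h3 : lam ^ v.length * digitSum lam ![0, 1, 0] w = 0 := by linarith
    exact (mul_eq_zero.1 h3).resolve_left hpv.ne'
  rw [hBw, mul_zero, zero_add] at hw
  constructor
  · rw [eq_div_of_mul_eq hpw.ne' ((mul_comm _ _).trans hw)]
    exact Subfield.div_mem _ (Subfield.mul_mem _ hmF (memC _)) (powF _)
  · rcases digitSum_eq_zero_or_le hl (by linarith) (d := ![0, 0, 1])
      (fun i => by fin_cases i <;> simp) w with h0 | h1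
    · rw [h0, mul_zero] at hw
      exact absurd hw (mul_pos hpw ht).ne'
    · have h2 := mul_le_mul_of_nonneg_left h1 (by linarith : 0 ≤ 1 - lam)
      have h3 : lam ^ w.length * (1 - lam) ≤ lam ^ w.length * (lam * t) := by
        linear_combination h2 - lam * hw
      have h4 := le_of_mul_le_mul_left h3 hpw
      by_contra! h5
      nlinarith

section TwoCopies

variable {t r a : ℝ} (ht : 0 < t) (hr0 : r ≠ 0) (hr1 : |r| < 1)
  (hmaps : ∀ x, (x ∈ K ∨ x - t ∈ K) → (r * x + a ∈ K ∨ r * x + a - t ∈ K))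
include ht hr0 hr1 hmaps

lemma exists_word_at_min {y : ℝ} (hy : y ∈ K ∨ y - t ∈ K) (hya : r * y + a = 0) :
    ∃ w : List (Fin 3), lam ^ w.length * t = digitSum lam (offset lam ζ) w := by
  have hl := h.lam_pos
  have hl1 : lam < 1 := by linarith [h.lam_lt]
  have nonneg : ∀ x, (x ∈ K ∨ x - t ∈ K) → 0 ≤ x := by
    rintro x (hx | hx) <;> linarith [h.nonneg _ hx]
  have y0 := nonneg y hy
  have y1 : y ≤ 1 + t := by rcases hy with hx | hx <;> linarith [h.le_one _ hx]
  rcases lt_or_gt_of_ne hr0 with hneg | hpos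
  · exfalso
    have hend := nonneg _ (hmaps (1 + t) (Or.inr (by simpa using h.one_mem)))
    have hend0 : r * (1 + t) + a = 0 := by nlinarith
    obtain ⟨n, hn⟩ := exists_pow_lt_of_lt_one ht hl1
    have hpn := pow_pos hl n
    have hemb : EmbedsInto K (r * lam ^ n) (-(r * lam ^ n)) := by
      refine ⟨mul_ne_zero hr0 hpn.ne', fun x hx => ?_⟩
      have h1 := h.one_sub_pow_mul_mem hx n
      have e : r * (1 - lam ^ n * (1 - x) + t) + a = r * lam ^ n * x + -(r * lam ^ n) := by
        linear_combination hend0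
      rcases hmaps (1 - lam ^ n * (1 - x) + t) (Or.inr (by simpa using h1)) with h2 | h2
      · rwa [e] at h2
      · rw [e] at h2
        have h3 := h.nonneg _ h2
        have h4 : 0 ≤ lam ^ n * x := mul_nonneg hpn.le (h.nonneg x hx)
        have h5 : -r ≤ 1 := by linarith [neg_le_of_abs_le hr1.le]
        nlinarith
    have := h.pos_of_embedsInto hζQ hemb
    nlinarith
  · have ha : a = 0 := by
      have h0 := nonneg _ (hmaps 0 (Or.inl h.zero_mem))
      nlinarith
    subst ha
    have iter : ∀ n : ℕ, ∀ x, (x ∈ K ∨ x - t ∈ K) → (r ^ n * x ∈ K ∨ r ^ n * x - t ∈ K) := by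
      intro n
      induction n with
      | zero => intro x hx; simpa using hx
      | succ n ih =>
        intro x hx
        have := hmaps _ (ih x hx)
        rwa [add_zero, ← mul_assoc, ← pow_succ'] at this
    have h1t : 0 < 1 + t := by linarith
    obtain ⟨n, hn⟩ := exists_pow_lt_of_lt_one (div_pos ht h1t) (lt_of_abs_lt hr1)
    rw [lt_div_iff₀ h1t] at hn
    have hpn := pow_pos hpos n
    have hemb : EmbedsInto K (r ^ n) (r ^ n * t) := by
      refine ⟨hpn.ne', fun x hx => ?_⟩
      rw [← mul_add]
      rcases iter n (x + t) (Or.inr (by simpa using hx)) with h2 | h2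
      · exact h2
      · have h3 := h.nonneg _ h2
        have h4 := mul_le_mul_of_nonneg_left (h.le_one x hx) hpn.le
        linarith
    obtain ⟨w, e1, e2⟩ := h.exists_word hζQ hemb
    exact ⟨w, by rw [← e1, e2]⟩

lemma exists_word_at_max {y : ℝ} (hy : y ∈ K ∨ y - t ∈ K) (hya : r * y + a = 1 + t) :
    ∃ w : List (Fin 3), 1 - lam ^ w.length * (1 + t) = digitSum lam (offset lam ζ) w := by
  have hl := h.lam_pos
  have hl1 : lam < 1 := by linarith [h.lam_lt]
  have le : ∀ x, (x ∈ K ∨ x - t ∈ K) → x ≤ 1 + t := by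
    rintro x (hx | hx) <;> linarith [h.le_one _ hx]
  have y1 := le y hy
  have y0 : 0 ≤ y := by rcases hy with hx | hx <;> linarith [h.nonneg _ hx]
  rcases lt_or_gt_of_ne hr0 with hneg | hpos
  · exfalso
    have hend := le _ (hmaps 0 (Or.inl h.zero_mem))
    have ha : a = 1 + t := by nlinarith
    subst ha
    obtain ⟨n, hn⟩ := exists_pow_lt_of_lt_one ht hl1
    have hpn := pow_pos hl n
    have hemb : EmbedsInto K (r * lam ^ n) 1 := by
      refine ⟨mul_ne_zero hr0 hpn.ne', fun x hx => ?_⟩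
      rcases hmaps _ (Or.inl (h.pow_mul_mem hx n)) with h2 | h2
      · have h3 := h.le_one _ h2
        have h4 : 0 ≤ lam ^ n * x := mul_nonneg hpn.le (h.nonneg x hx)
        have h5 : -r ≤ 1 := by linarith [neg_le_of_abs_le hr1.le]
        have h6 : lam ^ n * x ≤ lam ^ n * 1 := mul_le_mul_of_nonneg_left (h.le_one x hx) hpn.le
        nlinarith
      · convert h2 using 1
        ring
    have := h.pos_of_embedsInto hζQ hemb
    nlinarith
  · have hend : r * (1 + t) + a = 1 + t := by
      have h0 := le _ (hmaps (1 + t) (Or.inr (by simpa using h.one_mem)))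
      nlinarith
    have iter : ∀ n : ℕ, ∀ x, (x ∈ K ∨ x - t ∈ K) →
        (1 + t - r ^ n * (1 + t - x) ∈ K ∨ 1 + t - r ^ n * (1 + t - x) - t ∈ K) := by
      intro n
      induction n with
      | zero => intro x hx; simpa using hx
      | succ n ih =>
        intro x hx
        have := hmaps _ (ih x hx)
        have e : r * (1 + t - r ^ n * (1 + t - x)) + a = 1 + t - r ^ (n + 1) * (1 + t - x) := by
          rw [pow_succ]; linear_combination hend
        rwa [e] at this
    have h1t : 0 < 1 + t := by linarith
    obtain ⟨n, hn⟩ := exists_pow_lt_of_lt_one (div_pos ht h1t) (lt_of_abs_lt hr1)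
    rw [lt_div_iff₀ h1t] at hn
    have hpn := pow_pos hpos n
    have hemb : EmbedsInto K (r ^ n) (1 - r ^ n * (1 + t)) := by
      refine ⟨hpn.ne', fun x hx => ?_⟩
      rcases iter n x (Or.inl hx) with h2 | h2
      · have h3 := h.le_one _ h2
        have h4 := mul_nonneg hpn.le (h.nonneg x hx)
        linarith
      · convert h2 using 1
        ring
    obtain ⟨w, e1, e2⟩ := h.exists_word hζQ hemb
    exact ⟨w, by rw [← e1, e2]⟩

omit ht in
lemma fixedPoint_notMem_image (ht2 : 2 < t) (htF : t ∈ Subfield.closure ({lam} : Set ℝ))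
    {p q : ℝ} (hp : (1 - lam) * p = ζ) (hpK : p ∈ K) (hq : q ∈ K ∨ q - t ∈ K)
    (hqp : r * q + a = p) : False := by
  have one_copy : ∀ b, (∀ x ∈ K, r * x + b ∈ K ∨ r * x + b - t ∈ K) →
      EmbedsInto K r b ∨ EmbedsInto K r (b - t) := by
    intro b hb
    have hb0 := hb 0 h.zero_mem
    rw [mul_zero, zero_add] at hb0
    have close : ∀ x ∈ K, |r * x| < 1 := by
      intro x hx
      rw [abs_mul, abs_of_nonneg (h.nonneg x hx)]
      nlinarith [abs_nonneg r, h.le_one x hx, h.nonneg x hx]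
    rcases hb0 with h0 | h0
    · refine Or.inl ⟨hr0, fun x hx => (hb x hx).resolve_right fun h1 => ?_⟩
      linarith [h.nonneg _ h1, h.le_one _ h0, lt_of_abs_lt (close x hx)]
    · refine Or.inr ⟨hr0, fun x hx => ?_⟩
      rw [← add_sub_assoc]
      refine (hb x hx).resolve_left fun h1 => ?_
      linarith [h.le_one _ h1, h.nonneg _ h0, neg_lt_of_abs_lt (close x hx)]
  have first := one_copy a fun x hx => hmaps x (Or.inl hx)
  have second := one_copy (r * t + a) fun x hx => by
    have := hmaps (x + t) (Or.inr (by simpa using hx))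
    rwa [mul_add, add_assoc] at this
  have hlF : lam ∈ Subfield.closure ({lam} : Set ℝ) := Subfield.subset_closure rfl
  have key : ∀ b, EmbedsInto K r b → (∃ x ∈ K, r * x + b = p) → ∀ c, EmbedsInto K r c →
      c - b ∈ Subfield.closure ({lam} : Set ℝ) → c = b := by
    rintro b hb ⟨x, hx, hxp⟩ c hc hbc
    obtain ⟨u, e1, e2⟩ := h.exists_word hζQ hb
    obtain ⟨v, e3, e4⟩ := h.exists_word hζQ hc
    rw [e1, e2] at hxp
    have := h.eq_zero_of_digitSum_eq_add hζQ hbc (e3.symm.trans e1)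
      (h.digitSum_of_fixedPoint_mem_image hp hx hxp) (by rw [← e4, ← e2]; ring)
    linarith
  have rpos : 0 < r := by
    rcases first with h1 | h1 <;> exact h.pos_of_embedsInto hζQ h1
  have hr1' := lt_of_abs_lt hr1
  have hrt : 0 < r * t := by nlinarith
  have hrt' : r * t < t := by nlinarith
  have hrF : r ∈ Subfield.closure ({lam} : Set ℝ) := by
    rcases first with h1 | h1 <;> obtain ⟨w, rfl, -⟩ := h.exists_word hζQ h1 <;>
      exact Subfield.pow_mem _ hlF _
  have hrtF := Subfield.mul_mem _ hrF htF
  have p1 := h.le_one p hpK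
  rcases hq with hq | hq
  · have hfirst : EmbedsInto K r a := by
      refine first.resolve_right fun h1 => ?_
      have := h.nonneg _ (h1.2 q hq)
      linarith
    rcases second with h1 | h1
    · have := key a hfirst ⟨q, hq, hqp⟩ _ h1 (by rwa [add_sub_cancel_right])
      linarith
    · have := key a hfirst ⟨q, hq, hqp⟩ _ h1 (by
        rw [show r * t + a - t - a = r * t - t by ring]
        exact Subfield.sub_mem _ hrtF htF)
      linarith
  · have hsecond : EmbedsInto K r (r * t + a) := by
      refine second.resolve_right fun h1 => ?_
      have := h.nonneg _ (h1.2 _ hq)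
      linarith
    have hq' : ∃ x ∈ K, r * x + (r * t + a) = p := ⟨q - t, hq, by linarith⟩
    rcases first with h1 | h1
    · have := key _ hsecond hq' _ h1 (by
        rw [show a - (r * t + a) = -(r * t) by ring]
        exact Subfield.neg_mem _ hrtF)
      linarith
    · have := key _ hsecond hq' _ h1 (by
        rw [show a - t - (r * t + a) = -(r * t) - t by ring]
        exact Subfield.sub_mem _ (Subfield.neg_mem _ hrtF) htF)
      linarith

end TwoCopies

end ThreePartCantor

theorem stmt_9 (lam ζ : ℝ) (hlam : 0 < lam ∧ lam < 1 / 3)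
    (hζ : lam < ζ ∧ ζ < 1 - 2 * lam)
    (hζQ : ζ ∉ Subfield.closure ({lam} : Set ℝ))
    (K : Set ℝ) (hne : K.Nonempty) (hcpt : IsCompact K)
    (hK : K = (fun x => lam * x) '' K ∪ (fun x => lam * x + ζ) '' K ∪
      (fun x => lam * x + (1 - lam)) '' K) :
    ∀ t : ℝ, 0 < t → ¬ IsSelfSimilar (K ∪ (· + t) '' K) := by
  rintro t ht ⟨-, -, n, r, a, -, hr, hS⟩
  have h := ThreePartCantor.of_attractor hlam hζ hne hcpt hK
  have mem_iff : ∀ x, x ∈ K ∪ (· + t) '' K ↔ x ∈ K ∨ x - t ∈ K := by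
    intro x
    refine or_congr_right ⟨?_, fun hx => ⟨x - t, hx, sub_add_cancel x t⟩⟩
    rintro ⟨y, hy, rfl⟩
    simpa using hy
  have hmaps : ∀ i x, (x ∈ K ∨ x - t ∈ K) → (r i * x + a i ∈ K ∨ r i * x + a i - t ∈ K) := by
    intro i x hx
    rw [← mem_iff] at hx ⊢
    rw [hS]
    exact Set.mem_iUnion.2 ⟨i, x, hx, rfl⟩
  have hpre : ∀ x, (x ∈ K ∨ x - t ∈ K) → ∃ i y, (y ∈ K ∨ y - t ∈ K) ∧ r i * y + a i = x := by
    intro x hx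
    rw [← mem_iff, hS] at hx
    obtain ⟨i, y, hy, hyx⟩ := Set.mem_iUnion.1 hx
    exact ⟨i, y, (mem_iff y).1 hy, hyx⟩
  obtain ⟨i, y, hy, hyi⟩ := hpre 0 (Or.inl h.zero_mem)
  obtain ⟨w, hw⟩ := h.exists_word_at_min hζQ ht (hr i).1 (hr i).2 (hmaps i) hy hyi
  obtain ⟨j, z, hz, hzj⟩ := hpre (1 + t) (Or.inr (by simpa using h.one_mem))
  obtain ⟨v, hv⟩ := h.exists_word_at_max hζQ ht (hr j).1 (hr j).2 (hmaps j) hz hzj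
  obtain ⟨htF, ht2⟩ := h.mem_closure_and_two_lt hζQ ht hw hv
  have hp := h.fixedPoint_mem hcpt.isClosed
  obtain ⟨k, q, hq, hqk⟩ := hpre _ (Or.inl hp)
  exact h.fixedPoint_notMem_image hζQ (hr k).1 (hr k).2 (hmaps k) ht2 htF
    (mul_div_cancel₀ _ (by linarith [hlam.2] : (1 : ℝ) - lam ≠ 0)) hp hq hqk
end

section
/- Let N ∈ ℕ, β ∈ ℬ_N, and let Γ be the attractor of {φ_i(x) = βx + i(1−β)/N : i = 0,…,N}. For t > 0, if the union Γ ∪ (Γ + t) is a self-similar set, then t = (i(1−β)/N)·β^{−k} for some integers 1 ≤ i ≤ ⌊(N+1)/2⌋ and k ≥ 1. Conversely, for every such i and k, Γ ∪ (Γ + (i(1−β)/N)β^{−k}) is a self-similar set. -/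
/-- `Γ` is the attractor of the maps `x ↦ β * x + i * c`, `0 ≤ i ≤ N`, normalised so that its
convex hull is `[0, 1]`; the condition `β < c` says that the first-level pieces are separated. -/
structure IsDigitCantorSet (N : ℕ) (β c : ℝ) (Γ : Set ℝ) : Prop where
  digits_pos : 0 < N
  ratio_pos : 0 < β
  ratio_lt : β < c
  total : N * c + β = 1
  nonempty : Γ.Nonempty
  isCompact : IsCompact Γ
  mem_iff : ∀ x, x ∈ Γ ↔ ∃ i : ℕ, i ≤ N ∧ ∃ y ∈ Γ, x = β * y + i * c

namespace IsDigitCantorSet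

variable {N : ℕ} {β c : ℝ} {Γ : Set ℝ}

theorem step_pos (h : IsDigitCantorSet N β c Γ) : 0 < c := h.ratio_pos.trans h.ratio_lt

theorem ratio_lt_one (h : IsDigitCantorSet N β c Γ) : β < 1 := by
  have h1 : (1 : ℝ) ≤ N := by exact_mod_cast h.digits_pos
  nlinarith [h.total, h.step_pos]

theorem subset_of_invariant (h : IsDigitCantorSet N β c Γ) {A B : Set ℝ}
    (hA : Bornology.IsBounded A) (hAs : ∀ x ∈ A, ∃ i : ℕ, i ≤ N ∧ ∃ y ∈ A, x = β * y + i * c)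
    (hBc : IsClosed B) (hBne : B.Nonempty)
    (hBs : ∀ i : ℕ, i ≤ N → ∀ y ∈ B, β * y + i * c ∈ B) : A ⊆ B := by
  obtain ⟨b, hb⟩ := hBne
  obtain ⟨M, hM⟩ := hA.subset_closedBall b
  have key : ∀ n : ℕ, ∀ x ∈ A, ∃ y ∈ B, dist y x ≤ β ^ n * M := by
    intro n
    induction n with
    | zero =>
      intro x hx
      refine ⟨b, hb, ?_⟩
      rw [dist_comm]
      simpa using hM hx
    | succ n ih =>
      intro x hx
      obtain ⟨i, hi, y, hy, rfl⟩ := hAs x hx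
      obtain ⟨z, hz, hzy⟩ := ih y hy
      refine ⟨_, hBs i hi z hz, ?_⟩
      rw [Real.dist_eq] at hzy ⊢
      rw [show β * z + i * c - (β * y + i * c) = β * (z - y) by ring, abs_mul,
        abs_of_pos h.ratio_pos, pow_succ']
      nlinarith [h.ratio_pos]
  intro x hx
  rw [← hBc.closure_eq, Metric.mem_closure_iff]
  intro ε hε
  have hlim : Filter.Tendsto (fun n : ℕ => β ^ n * M) Filter.atTop (nhds 0) := by
    simpa using (tendsto_pow_atTop_nhds_zero_of_lt_one h.ratio_pos.le h.ratio_lt_one).mul_const M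
  obtain ⟨n, hn⟩ := (hlim.eventually (gt_mem_nhds hε)).exists
  obtain ⟨y, hy, hyx⟩ := key n x hx
  exact ⟨y, hy, by rw [dist_comm]; linarith⟩

theorem map_mem (h : IsDigitCantorSet N β c Γ) {i : ℕ} (hi : i ≤ N) {y : ℝ} (hy : y ∈ Γ) :
    β * y + i * c ∈ Γ := (h.mem_iff _).2 ⟨i, hi, y, hy, rfl⟩

theorem mem_of_invariant (h : IsDigitCantorSet N β c Γ) {A : Set ℝ}
    (hA : Bornology.IsBounded A)
    (hAs : ∀ x ∈ A, ∃ i : ℕ, i ≤ N ∧ ∃ y ∈ A, x = β * y + i * c) : A ⊆ Γ :=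
  h.subset_of_invariant hA hAs h.isCompact.isClosed h.nonempty fun _ hi _ hy => h.map_mem hi hy

theorem zero_mem (h : IsDigitCantorSet N β c Γ) : (0 : ℝ) ∈ Γ := by
  refine h.mem_of_invariant (A := {0}) Bornology.isBounded_singleton ?_ rfl
  rintro x rfl
  exact ⟨0, Nat.zero_le _, 0, rfl, by simp⟩

theorem one_mem (h : IsDigitCantorSet N β c Γ) : (1 : ℝ) ∈ Γ := by
  refine h.mem_of_invariant (A := {1}) Bornology.isBounded_singleton ?_ rfl
  rintro x rfl
  exact ⟨N, le_rfl, 1, rfl, by linarith [h.total]⟩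

theorem subset_Icc (h : IsDigitCantorSet N β c Γ) : Γ ⊆ Set.Icc 0 1 := by
  refine h.subset_of_invariant h.isCompact.isBounded (fun x hx => (h.mem_iff x).1 hx)
    isClosed_Icc ⟨0, by simp⟩ ?_
  rintro i hi y ⟨hy0, hy1⟩
  have h0 := h.ratio_pos
  have hc := h.step_pos
  have hiN : (i : ℝ) ≤ N := by exact_mod_cast hi
  have ht := h.total
  exact ⟨by positivity, by nlinarith⟩

theorem nonneg (h : IsDigitCantorSet N β c Γ) {x : ℝ} (hx : x ∈ Γ) : 0 ≤ x := (h.subset_Icc hx).1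

theorem le_one (h : IsDigitCantorSet N β c Γ) {x : ℝ} (hx : x ∈ Γ) : x ≤ 1 := (h.subset_Icc hx).2

theorem one_sub_mem (h : IsDigitCantorSet N β c Γ) {x : ℝ} (hx : x ∈ Γ) : 1 - x ∈ Γ := by
  refine h.mem_of_invariant (A := (fun y => 1 - y) '' Γ) ?_ ?_ ⟨x, hx, rfl⟩
  · exact (h.isCompact.image (by fun_prop)).isBounded
  · rintro _ ⟨y, hy, rfl⟩
    obtain ⟨i, hi, z, hz, rfl⟩ := (h.mem_iff y).1 hy
    refine ⟨N - i, Nat.sub_le _ _, 1 - z, ⟨z, hz, rfl⟩, ?_⟩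
    push_cast [Nat.cast_sub hi]
    linarith [h.total]

theorem digit_le (h : IsDigitCantorSet N β c Γ) {i j : ℕ} {y z : ℝ} (hy : 0 ≤ y) (hz : z ≤ 1)
    (hle : β * y + i * c ≤ β * z + j * c) : i ≤ j := by
  by_contra! hlt
  have h1 : (j : ℝ) + 1 ≤ i := by exact_mod_cast hlt
  nlinarith [h.ratio_pos, h.step_pos, h.ratio_lt]

theorem digit_unique (h : IsDigitCantorSet N β c Γ) {i j : ℕ} {y z : ℝ} (hy : y ∈ Γ) (hz : z ∈ Γ)
    (he : β * y + i * c = β * z + j * c) : i = j :=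
  le_antisymm (h.digit_le (h.nonneg hy) (h.le_one hz) he.le)
    (h.digit_le (h.nonneg hz) (h.le_one hy) he.ge)

theorem exists_mem_Ioc (h : IsDigitCantorSet N β c Γ) {u : ℝ} (hu0 : 0 ≤ u) (hu1 : u < 1) :
    ∃ x ∈ Γ, u < x ∧ x ≤ u + (c - β) := by
  have hβ := h.ratio_pos
  have hc := h.step_pos
  have hg : 0 < c - β := sub_pos.2 h.ratio_lt
  have key : ∀ n : ℕ, ∀ u : ℝ, 0 ≤ u → u < 1 →
      ∃ x ∈ Γ, u < x ∧ x ≤ u + max (c - β) (β ^ n) := by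
    intro n
    induction n with
    | zero =>
      intro u hu0 hu1
      refine ⟨1, h.one_mem, hu1, ?_⟩
      have := le_max_right (c - β) (β ^ 0)
      rw [pow_zero] at this ⊢
      linarith
    | succ n ih =>
      intro u hu0 hu1
      set i := ⌊u / c⌋₊ with hi
      have hi1 : i * c ≤ u := (le_div_iff₀ hc).1 (Nat.floor_le (by positivity))
      have hi2 : u < (i + 1) * c := (div_lt_iff₀ hc).1 (Nat.lt_floor_add_one _)
      have hiN : i ≤ N := by
        by_contra! hlt
        have h1 : (N : ℝ) + 1 ≤ i := by exact_mod_cast hlt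
        nlinarith [h.total, h.ratio_lt]
      by_cases hup : u < i * c + β
      · obtain ⟨x, hx, hx1, hx2⟩ := ih ((u - i * c) / β) (div_nonneg (by linarith) hβ.le)
          ((div_lt_one hβ).2 (by linarith))
        refine ⟨β * x + i * c, h.map_mem hiN hx, ?_, ?_⟩
        · rw [div_lt_iff₀ hβ] at hx1
          linarith
        · have h1 : β * x ≤ β * ((u - i * c) / β + max (c - β) (β ^ n)) :=
            mul_le_mul_of_nonneg_left hx2 hβ.le
          rw [mul_add, mul_div_cancel₀ _ hβ.ne', mul_max_of_nonneg _ _ hβ.le, ← pow_succ'] at h1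
          have h2 : max (β * (c - β)) (β ^ (n + 1)) ≤ max (c - β) (β ^ (n + 1)) :=
            max_le_max (by nlinarith [h.ratio_lt_one]) le_rfl
          linarith
      · push Not at hup
        have hlt : i + 1 ≤ N := by
          by_contra! hge
          have : i = N := by omega
          rw [this] at hup
          linarith [h.total]
        refine ⟨β * 0 + (i + 1 : ℕ) * c, h.map_mem hlt h.zero_mem, ?_, ?_⟩
        · push_cast
          linarith
        · push_cast
          have := le_max_left (c - β) (β ^ (n + 1))
          linarith
  obtain ⟨n, hn⟩ := exists_pow_lt_of_lt_one hg h.ratio_lt_one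
  obtain ⟨x, hx, hx1, hx2⟩ := key n u hu0 hu1
  rw [max_eq_left hn.le] at hx2
  exact ⟨x, hx, hx1, hx2⟩

/-- A similar copy of `Γ` inside `Γ` is one of the cylinders of `Γ`. -/
theorem exists_digits_of_copy (h : IsDigitCantorSet N β c Γ) {r a : ℝ} (hr : 0 < r)
    (hsub : ∀ y ∈ Γ, r * y + a ∈ Γ) :
    ∃ (p : ℕ) (d : ℕ → ℕ), r = β ^ p ∧ (∀ j, d j ≤ N) ∧
      a = c * ∑ j ∈ Finset.range p, d j * β ^ j := by
  have hβ := h.ratio_pos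
  have hc := h.step_pos
  have key : ∀ n : ℕ, ∀ r a : ℝ, β ^ n < r → (∀ y ∈ Γ, r * y + a ∈ Γ) →
      ∃ (p : ℕ) (d : ℕ → ℕ), r = β ^ p ∧ (∀ j, d j ≤ N) ∧
        a = c * ∑ j ∈ Finset.range p, d j * β ^ j := by
    intro n
    induction n with
    | zero =>
      intro r a hr hsub
      have h0 := h.nonneg (hsub 0 h.zero_mem)
      have h1 := h.le_one (hsub 1 h.one_mem)
      rw [pow_zero] at hr
      linarith
    | succ n ih =>
      intro r a hr hsub
      have hr0 : 0 < r := (pow_pos hβ _).trans hr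
      have h0 := h.nonneg (hsub 0 h.zero_mem)
      have h1 := h.le_one (hsub 1 h.one_mem)
      rcases (show r ≤ 1 by linarith).eq_or_lt with rfl | hr1
      · exact ⟨0, 0, by simp, by simp, by simp; linarith⟩
      · obtain ⟨i, hi, z, hz, hz'⟩ := (h.mem_iff _).1 (hsub 0 h.zero_mem)
        have hz0 := h.nonneg hz
        have hz1 := h.le_one hz
        have hend : r + a ≤ i * c + β := by
          by_contra! hlt
          obtain ⟨x, hx, hx1, hx2⟩ := h.exists_mem_Ioc (u := (i * c + β - a) / r)
            (div_nonneg (by nlinarith) hr0.le) ((div_lt_one hr0).2 (by linarith))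
          rw [div_lt_iff₀ hr0] at hx1
          have hx3 : r * x ≤ r * ((i * c + β - a) / r + (c - β)) :=
            mul_le_mul_of_nonneg_left hx2 hr0.le
          rw [mul_add, mul_div_cancel₀ _ hr0.ne'] at hx3
          obtain ⟨j, hj, w, hw, hw'⟩ := (h.mem_iff _).1 (hsub x hx)
          have hw0 := h.nonneg hw
          have hw1 := h.le_one hw
          have hrg : r * (c - β) < c - β := by nlinarith [h.ratio_lt]
          rcases le_or_gt j i with hji | hij
          · have : (j : ℝ) ≤ i := by exact_mod_cast hji
            nlinarith
          · have : (i : ℝ) + 1 ≤ j := by exact_mod_cast hij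
            nlinarith
        have hsub' : ∀ y ∈ Γ, r / β * y + (a - i * c) / β ∈ Γ := by
          intro y hy
          obtain ⟨j, hj, w, hw, hw'⟩ := (h.mem_iff _).1 (hsub y hy)
          have hy0 := h.nonneg hy
          have hy1 := h.le_one hy
          have hij : i ≤ j := h.digit_le hz0 (h.le_one hw) (by nlinarith)
          have hji : j ≤ i := h.digit_le (h.nonneg hw) le_rfl (by nlinarith)
          obtain rfl := le_antisymm hij hji
          convert hw using 1
          field_simp
          linarith
        obtain ⟨p, d, hp, hd, ha⟩ := ih (r / β) ((a - i * c) / β)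
          ((lt_div_iff₀ hβ).2 (by rwa [← pow_succ])) hsub'
        refine ⟨p + 1, fun j => Nat.casesOn j i d, ?_, ?_, ?_⟩
        · rw [pow_succ, ← hp, div_mul_cancel₀ _ hβ.ne']
        · rintro (_ | j)
          · exact hi
          · exact hd j
        · rw [Finset.sum_range_succ']
          rw [div_eq_iff hβ.ne'] at ha
          have : ∑ j ∈ Finset.range p, (d j : ℝ) * β ^ (j + 1)
              = β * ∑ j ∈ Finset.range p, (d j : ℝ) * β ^ j := by
            rw [Finset.mul_sum]
            exact Finset.sum_congr rfl fun j _ => by ring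
          change a = c * (∑ j ∈ Finset.range p, (d j : ℝ) * β ^ (j + 1) + (i : ℝ) * β ^ 0)
          rw [this]
          linarith
  obtain ⟨n, hn⟩ := exists_pow_lt_of_lt_one hr h.ratio_lt_one
  exact key n r a hn hsub

theorem digits_unique (h : IsDigitCantorSet N β c Γ) {p : ℕ} {d e : ℕ → ℕ}
    (hd : ∀ j, d j ≤ N) (he : ∀ j, e j ≤ N) {y z : ℝ} (hy : y ∈ Γ) (hz : z ∈ Γ)
    (heq : c * ∑ j ∈ Finset.range p, d j * β ^ j + β ^ p * y
      = c * ∑ j ∈ Finset.range p, e j * β ^ j + β ^ p * z) : ∀ j < p, d j = e j := by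
  induction p generalizing y z with
  | zero => simp
  | succ p ih =>
    rw [Finset.sum_range_succ, Finset.sum_range_succ] at heq
    have hprefix : ∀ j < p, d j = e j :=
      ih (h.map_mem (hd p) hy) (h.map_mem (he p) hz) (by rw [pow_succ] at heq; linarith)
    have hsum : ∑ j ∈ Finset.range p, (d j : ℝ) * β ^ j
        = ∑ j ∈ Finset.range p, (e j : ℝ) * β ^ j :=
      Finset.sum_congr rfl fun j hj => by rw [hprefix j (Finset.mem_range.1 hj)]
    rw [hsum] at heq
    have hpow : 0 < β ^ p := pow_pos h.ratio_pos p
    have hlast : d p = e p := by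
      refine h.digit_unique hy hz (mul_left_cancel₀ hpow.ne' ?_)
      rw [pow_succ] at heq
      linarith
    intro j hj
    rcases Nat.lt_succ_iff_lt_or_eq.1 hj with hj | rfl
    · exact hprefix j hj
    · exact hlast

theorem exists_mem_with_digits (h : IsDigitCantorSet N β c Γ) {d : ℕ → ℕ} (hd : ∀ j, d j ≤ N) :
    ∃ x ∈ Γ, ∀ n : ℕ, ∃ y ∈ Γ, x = c * ∑ j ∈ Finset.range n, d j * β ^ j + β ^ n * y := by
  have hβ := h.ratio_pos
  have hgeo := (summable_geometric_of_lt_one hβ.le h.ratio_lt_one).mul_left (N : ℝ)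
  have hle : ∀ d : ℕ → ℕ, (∀ j, d j ≤ N) → ∀ j, (d j : ℝ) * β ^ j ≤ N * β ^ j := fun d hd j =>
    mul_le_mul_of_nonneg_right (by exact_mod_cast hd j) (by positivity)
  have hsum : ∀ d : ℕ → ℕ, (∀ j, d j ≤ N) → Summable fun j => (d j : ℝ) * β ^ j := fun d hd =>
    hgeo.of_nonneg_of_le (fun j => by positivity) (hle d hd)
  have hmem : ∀ d : ℕ → ℕ, (∀ j, d j ≤ N) → c * ∑' j, (d j : ℝ) * β ^ j ∈ Γ := by
    intro d hd
    refine h.mem_of_invariant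
      (A := {x | ∃ d : ℕ → ℕ, (∀ j, d j ≤ N) ∧ x = c * ∑' j, (d j : ℝ) * β ^ j}) ?_ ?_ ⟨d, hd, rfl⟩
    · refine (Metric.isBounded_Icc 0 (c * ∑' j, (N : ℝ) * β ^ j)).subset ?_
      rintro _ ⟨d, hd, rfl⟩
      exact ⟨mul_nonneg h.step_pos.le (tsum_nonneg fun j => by positivity),
        mul_le_mul_of_nonneg_left ((hsum d hd).tsum_le_tsum (hle d hd) hgeo) h.step_pos.le⟩
    · rintro _ ⟨d, hd, rfl⟩
      refine ⟨d 0, hd 0, _, ⟨fun j => d (j + 1), fun j => hd _, rfl⟩, ?_⟩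
      rw [(hsum d hd).tsum_eq_zero_add]
      have : ∑' j, (d (j + 1) : ℝ) * β ^ (j + 1) = β * ∑' j, (d (j + 1) : ℝ) * β ^ j := by
        rw [← tsum_mul_left]
        exact tsum_congr fun j => by ring
      rw [this]
      ring
  refine ⟨_, hmem d hd, fun n => ⟨_, hmem (fun j => d (j + n)) fun j => hd _, ?_⟩⟩
  rw [← (hsum d hd).sum_add_tsum_nat_add n]
  have : ∑' j, (d (j + n) : ℝ) * β ^ (j + n) = β ^ n * ∑' j, (d (j + n) : ℝ) * β ^ j := by
    rw [← tsum_mul_left]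
    exact tsum_congr fun j => by ring
  rw [this]
  ring

theorem exists_mem_Ioc_union (h : IsDigitCantorSet N β c Γ) {t : ℝ} (ht : c - β ≤ t - 1) {u : ℝ}
    (hu0 : 0 ≤ u) (hu1 : u < 1 + t) :
    ∃ x ∈ Γ ∪ (· + t) '' Γ, u < x ∧ x ≤ u + (t - 1) := by
  rcases lt_or_ge u 1 with h1 | h1
  · obtain ⟨x, hx, hx1, hx2⟩ := h.exists_mem_Ioc hu0 h1
    exact ⟨x, Or.inl hx, hx1, by linarith⟩
  · rcases lt_or_ge u t with h2 | h2
    · exact ⟨t, Or.inr ⟨0, h.zero_mem, by simp⟩, h2, by linarith⟩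
    · obtain ⟨x, hx, hx1, hx2⟩ := h.exists_mem_Ioc (u := u - t) (by linarith) (by linarith)
      exact ⟨x + t, Or.inr ⟨x, hx, rfl⟩, by linarith, by linarith⟩

theorem exists_pos_copy (h : IsDigitCantorSet N β c Γ) {t : ℝ}
    (hS : IsSelfSimilar (Γ ∪ (· + t) '' Γ)) {x : ℝ} (hx : x ∈ Γ ∪ (· + t) '' Γ) :
    ∃ r a : ℝ, 0 < r ∧ r < 1 ∧ (∀ y ∈ Γ ∪ (· + t) '' Γ, r * y + a ∈ Γ ∪ (· + t) '' Γ) ∧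
      ∃ y ∈ Γ ∪ (· + t) '' Γ, x = r * y + a := by
  have hsymm : ∀ y ∈ Γ ∪ (· + t) '' Γ, 1 + t - y ∈ Γ ∪ (· + t) '' Γ := by
    rintro y (hy | ⟨y, hy, rfl⟩)
    · exact Or.inr ⟨1 - y, h.one_sub_mem hy, by ring⟩
    · exact Or.inl (by convert h.one_sub_mem hy using 1; ring)
  obtain ⟨-, -, n, r, a, -, hr, heq⟩ := hS
  have hmaps : ∀ i, ∀ y ∈ Γ ∪ (· + t) '' Γ, r i * y + a i ∈ Γ ∪ (· + t) '' Γ := by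
    intro i y hy
    rw [heq]
    exact Set.mem_iUnion.2 ⟨i, y, hy, rfl⟩
  rw [heq] at hx
  obtain ⟨i, y, hy, hyx⟩ := Set.mem_iUnion.1 hx
  have hyx : r i * y + a i = x := hyx
  have hlt := abs_lt.1 (hr i).2
  rcases (hr i).1.lt_or_gt with hneg | hpos
  · refine ⟨-r i, a i + r i * (1 + t), by linarith, by linarith, fun z hz => ?_,
      1 + t - y, hsymm y hy, by linarith⟩
    convert hmaps i _ (hsymm z hz) using 1
    ring
  · exact ⟨r i, a i, hpos, hlt.2, hmaps i, y, hy, hyx.symm⟩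

theorem exists_digits_of_union_copy (h : IsDigitCantorSet N β c Γ) {t r a : ℝ} (hr : 0 < r)
    (hsub : ∀ y ∈ Γ ∪ (· + t) '' Γ, r * y + a ∈ Γ) :
    ∃ (q : ℕ) (b b' : ℕ → ℕ), r = β ^ q ∧ (∀ j, b j ≤ N) ∧ (∀ j, b' j ≤ N) ∧
      a = c * ∑ j ∈ Finset.range q, b j * β ^ j ∧
      a + β ^ q * t = c * ∑ j ∈ Finset.range q, b' j * β ^ j := by
  obtain ⟨q, b, hq, hb, hba⟩ := h.exists_digits_of_copy hr fun y hy => hsub y (Or.inl hy)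
  obtain ⟨q', b', hq', hb', hba'⟩ := h.exists_digits_of_copy (a := a + r * t) hr fun y hy => by
    convert hsub _ (Or.inr ⟨y, hy, rfl⟩) using 1
    ring
  have : q = q' :=
    pow_right_injective₀ h.ratio_pos h.ratio_lt_one.ne (hq.symm.trans hq')
  subst this
  exact ⟨q, b, b', hq, hb, hb', hba, by rw [← hq, hba']⟩

theorem exists_digits_translate (h : IsDigitCantorSet N β c Γ) {t : ℝ} (ht : 0 < t)
    (hS : IsSelfSimilar (Γ ∪ (· + t) '' Γ)) :
    ∃ (p : ℕ) (e : ℕ → ℕ), (∀ j, e j ≤ N) ∧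
      β ^ p * t = c * ∑ j ∈ Finset.range p, e j * β ^ j := by
  have hnn : ∀ y ∈ Γ ∪ (· + t) '' Γ, 0 ≤ y ∧ y ≤ 1 + t := by
    rintro y (hy | ⟨y, hy, rfl⟩)
    · exact ⟨h.nonneg hy, by linarith [h.le_one hy]⟩
    · exact ⟨add_nonneg (h.nonneg hy) ht.le, by linarith [h.le_one hy]⟩
  obtain ⟨r, a, hr, hr1, hmaps, y, hy, h0⟩ := h.exists_pos_copy hS (x := 0) (Or.inl h.zero_mem)
  have ha : a = 0 := by
    have h1 := (hnn _ (hmaps 0 (Or.inl h.zero_mem))).1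
    have h2 := mul_nonneg hr.le (hnn y hy).1
    linarith
  subst ha
  have hpow : ∀ m : ℕ, ∀ y ∈ Γ ∪ (· + t) '' Γ, r ^ m * y ∈ Γ ∪ (· + t) '' Γ := by
    intro m
    induction m with
    | zero => simp
    | succ m ih =>
      intro y hy
      convert hmaps _ (ih y hy) using 1
      ring
  obtain ⟨m, hm⟩ := exists_pow_lt_of_lt_one (div_pos ht (by linarith : 0 < 1 + t)) hr1
  rw [lt_div_iff₀ (by linarith)] at hm
  have hrm : 0 < r ^ m := pow_pos hr m
  obtain ⟨p, b, e, -, hb, he, hbp, hep⟩ :=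
    h.exists_digits_of_union_copy (t := t) (a := 0) hrm fun y hy => by
      rw [add_zero]
      rcases hpow m y hy with hy' | ⟨z, hz, hz'⟩
      · exact hy'
      · have hz' : z + t = r ^ m * y := hz'
        have := mul_le_mul_of_nonneg_left (hnn y hy).2 hrm.le
        linarith [h.nonneg hz]
  exact ⟨p, e, he, by rw [← hep, zero_add]⟩

theorem step_le_ratio_mul (h : IsDigitCantorSet N β c Γ) {t : ℝ} (ht : 0 < t) {p : ℕ} {e : ℕ → ℕ}
    (hpe : β ^ p * t = c * ∑ j ∈ Finset.range p, e j * β ^ j) : c ≤ β * t := by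
  have hβ := h.ratio_pos
  have hc := h.step_pos
  obtain ⟨s, hs, hes⟩ : ∃ s ∈ Finset.range p, (e s : ℝ) * β ^ s ≠ 0 := by
    refine Finset.exists_ne_zero_of_sum_ne_zero fun h0 => ?_
    rw [h0, mul_zero] at hpe
    exact (mul_pos (pow_pos hβ p) ht).ne' hpe
  have hs' := Finset.mem_range.1 hs
  have hes1 : (1 : ℝ) ≤ e s := by
    exact_mod_cast Nat.one_le_iff_ne_zero.2 fun h0 => hes (by simp [h0])
  have h1 : (e s : ℝ) * β ^ s ≤ ∑ j ∈ Finset.range p, (e j : ℝ) * β ^ j :=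
    Finset.single_le_sum (f := fun j => (e j : ℝ) * β ^ j) (fun j _ => by positivity) hs
  obtain ⟨n, rfl⟩ : ∃ n, p = n + 1 := ⟨p - 1, by omega⟩
  have h2 : β ^ n ≤ β ^ s :=
    pow_le_pow_of_le_one hβ.le h.ratio_lt_one.le (by omega)
  have h3 : β ^ n ≤ ∑ j ∈ Finset.range (n + 1), (e j : ℝ) * β ^ j := by
    nlinarith [pow_pos hβ s]
  have h4 : β ^ n * c ≤ β ^ n * (β * t) := by
    rw [← mul_assoc, ← pow_succ, hpe]
    nlinarith
  exact le_of_mul_le_mul_left h4 (pow_pos hβ n)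

/-- Every digit sequence begins with one of the two words coding a copy of the union in `Γ`. -/
theorem exists_prefix (h : IsDigitCantorSet N β c Γ) {t : ℝ} (hct : c ≤ β * t)
    (hS : IsSelfSimilar (Γ ∪ (· + t) '' Γ)) {d : ℕ → ℕ} (hd : ∀ j, d j ≤ N) :
    ∃ (q : ℕ) (b b' : ℕ → ℕ), (∀ j, b j ≤ N) ∧ (∀ j, b' j ≤ N) ∧
      c * ∑ j ∈ Finset.range q, b j * β ^ j + β ^ q * t
        = c * ∑ j ∈ Finset.range q, b' j * β ^ j ∧
      ((∀ j < q, d j = b j) ∨ ∀ j < q, d j = b' j) := by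
  have hβ := h.ratio_pos
  have hβ1 := h.ratio_lt_one
  have hg := h.ratio_lt
  have ht1 : c - β ≤ t - 1 := by
    have : (1 : ℝ) ≤ t := by nlinarith
    nlinarith
  obtain ⟨x, hx, hxd⟩ := h.exists_mem_with_digits hd
  obtain ⟨r, a, hr, hr1, hmaps, y, hy, hxy⟩ := h.exists_pos_copy hS (Or.inl hx)
  have hnn : ∀ y ∈ Γ ∪ (· + t) '' Γ, 0 ≤ y ∧ y ≤ 1 + t := by
    rintro y (hy | ⟨y, hy, rfl⟩)
    · exact ⟨h.nonneg hy, by linarith [h.le_one hy]⟩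
    · exact ⟨by linarith [h.nonneg hy], by linarith [h.le_one hy]⟩
  have ha1 : a ≤ 1 := by
    have := mul_nonneg hr.le (hnn y hy).1
    linarith [h.le_one hx]
  have hend : r * (1 + t) + a ≤ 1 := by
    by_contra! hlt
    obtain ⟨z, hz, hz1, hz2⟩ := h.exists_mem_Ioc_union ht1 (u := (1 - a) / r)
      (div_nonneg (by linarith) hr.le) ((div_lt_iff₀ hr).2 (by linarith))
    rw [div_lt_iff₀ hr] at hz1
    have hz3 := mul_le_mul_of_nonneg_left hz2 hr.le
    rw [mul_add, mul_div_cancel₀ _ hr.ne'] at hz3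
    rcases hmaps z hz with hz' | ⟨w, hw, hw'⟩
    · linarith [h.le_one hz']
    · have hw' : w + t = r * z + a := hw'
      nlinarith [h.nonneg hw]
  have hsub : ∀ y ∈ Γ ∪ (· + t) '' Γ, r * y + a ∈ Γ := by
    intro y hy
    rcases hmaps y hy with hy' | ⟨w, hw, hw'⟩
    · exact hy'
    · have hw' : w + t = r * y + a := hw'
      have := mul_le_mul_of_nonneg_left (hnn y hy).2 hr.le
      linarith [h.nonneg hw]
  obtain ⟨q, b, b', rfl, hb, hb', hba, hba'⟩ := h.exists_digits_of_union_copy hr hsub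
  refine ⟨q, b, b', hb, hb', by rw [← hba, hba'], ?_⟩
  obtain ⟨z, hz, hxz⟩ := hxd q
  rcases hy with hy | ⟨y, hy, rfl⟩
  · exact Or.inl (h.digits_unique hd hb hz hy (by rw [← hxz, ← hba, hxy]; ring))
  · exact Or.inr (h.digits_unique hd hb' hz hy (by rw [← hxz, ← hba', hxy]; ring))

theorem exists_single_digit (h : IsDigitCantorSet N β c Γ)
    (hadd : ∀ (p q : ℕ) (e b b' : ℕ → ℕ), (∀ j, e j ≤ N) → (∀ j, b j ≤ N) → (∀ j, b' j ≤ N) →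
      β ^ q * ∑ j ∈ Finset.range p, (e j : ℝ) * β ^ j +
          β ^ p * ∑ j ∈ Finset.range q, (b j : ℝ) * β ^ j
        = β ^ p * ∑ j ∈ Finset.range q, (b' j : ℝ) * β ^ j →
      ∀ s < p, e s ≠ 0 → p ≤ s + q ∧ b (s + q - p) + e s = b' (s + q - p))
    {t : ℝ} (ht : 0 < t) (hS : IsSelfSimilar (Γ ∪ (· + t) '' Γ)) :
    ∃ i k : ℕ, 1 ≤ i ∧ i ≤ (N + 1) / 2 ∧ 1 ≤ k ∧ t = i * c / β ^ k := by
  have hβ := h.ratio_pos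
  obtain ⟨p, e, he, hpe⟩ := h.exists_digits_translate ht hS
  have hcover : ∀ d : ℕ → ℕ, (∀ j, d j ≤ N) → ∃ q : ℕ, (∀ s < p, e s ≠ 0 → p ≤ s + q) ∧
      ((∀ s < p, e s ≠ 0 → d (s + q - p) + e s ≤ N) ∨
        ∀ s < p, e s ≠ 0 → e s ≤ d (s + q - p)) := by
    intro d hd
    obtain ⟨q, b, b', hb, hb', hbb', hdb⟩ := h.exists_prefix (h.step_le_ratio_mul ht hpe) hS hd
    have key := hadd p q e b b' he hb hb' <| by
      refine mul_left_cancel₀ h.step_pos.ne' ?_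
      linear_combination β ^ p * hbb' - β ^ q * hpe
    refine ⟨q, fun s hs hes => (key s hs hes).1, hdb.imp ?_ ?_⟩
    · intro hdb s hs hes
      have := (key s hs hes).1
      rw [hdb _ (by omega), (key s hs hes).2]
      exact hb' _
    · intro hdb s hs hes
      have := (key s hs hes).1
      rw [hdb _ (by omega), ← (key s hs hes).2]
      exact Nat.le_add_left _ _
  have hunique : ∀ s s', s < s' → s' < p → e s ≠ 0 → e s' ≠ 0 → False := by
    intro s s' hss hs' hes hes'
    obtain ⟨q, hq, hd⟩ := hcover (fun j => if j / (s' - s) % 2 = 0 then 0 else N)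
      fun j => by split_ifs <;> simp
    have hqs := hq s (by omega) hes
    have hshift : (s' + q - p) / (s' - s) = (s + q - p) / (s' - s) + 1 := by
      rw [← Nat.add_div_right _ (by omega)]
      congr 1
      omega
    rcases hd with hd | hd
    · have h1 := hd s (by omega) hes
      have h2 := hd s' hs' hes'
      rw [hshift] at h2
      split_ifs at h1 h2 <;> omega
    · have h1 := hd s (by omega) hes
      have h2 := hd s' hs' hes'
      rw [hshift] at h2
      split_ifs at h1 h2 <;> omega
  obtain ⟨s, hs, hes⟩ : ∃ s ∈ Finset.range p, (e s : ℝ) * β ^ s ≠ 0 := by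
    refine Finset.exists_ne_zero_of_sum_ne_zero fun h0 => ?_
    rw [h0, mul_zero] at hpe
    exact (mul_pos (pow_pos hβ p) ht).ne' hpe
  have hs' := Finset.mem_range.1 hs
  have hes0 : e s ≠ 0 := fun h0 => hes (by simp [h0])
  have hsum : ∑ j ∈ Finset.range p, (e j : ℝ) * β ^ j = e s * β ^ s := by
    refine Finset.sum_eq_single_of_mem s hs fun j hj hjs => ?_
    have : e j = 0 := by
      by_contra hej
      rcases hjs.lt_or_gt with hlt | hlt
      · exact hunique j s hlt hs' hej hes0
      · exact hunique s j hlt (Finset.mem_range.1 hj) hes0 hej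
    simp [this]
  refine ⟨e s, p - s, Nat.one_le_iff_ne_zero.2 hes0, ?_, by omega, ?_⟩
  · have := he s
    obtain ⟨q, -, hd⟩ := hcover (fun _ => e s - 1) fun _ => by omega
    rcases hd with hd | hd <;> have := hd s hs' hes0 <;> omega
  · rw [eq_div_iff (pow_pos hβ _).ne']
    refine mul_left_cancel₀ (pow_pos hβ s).ne' ?_
    rw [hsum, show p = s + (p - s) by omega, pow_add] at hpe
    linear_combination hpe

theorem exists_finset_cylinders (h : IsDigitCantorSet N β c Γ) (m : ℕ) :
    ∃ F : Finset ℝ, ∀ x, x ∈ Γ ↔ ∃ w ∈ F, ∃ y ∈ Γ, x = β ^ m * y + w := by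
  induction m with
  | zero => exact ⟨{0}, by simp⟩
  | succ m ih =>
    obtain ⟨F, hF⟩ := ih
    refine ⟨Finset.image₂ (fun w i => w + β ^ m * ((i : ℕ) * c)) F (Finset.range (N + 1)),
      fun x => ?_⟩
    rw [hF]
    constructor
    · rintro ⟨w, hw, y, hy, rfl⟩
      obtain ⟨i, hi, z, hz, rfl⟩ := (h.mem_iff y).1 hy
      exact ⟨_, Finset.mem_image₂.2 ⟨w, hw, i, Finset.mem_range.2 (by omega), rfl⟩, z, hz, by ring⟩
    · rintro ⟨_, hv, z, hz, rfl⟩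
      obtain ⟨w, hw, i, hi, rfl⟩ := Finset.mem_image₂.1 hv
      rw [Finset.mem_range] at hi
      exact ⟨w, hw, _, h.map_mem (by omega : i ≤ N) hz, by ring⟩

theorem isSelfSimilar_union (h : IsDigitCantorSet N β c Γ) {i k : ℕ} (hi : i ≤ (N + 1) / 2)
    (hk : 1 ≤ k) : IsSelfSimilar (Γ ∪ (· + i * c / β ^ k) '' Γ) := by
  have hβ := h.ratio_pos
  obtain ⟨m, rfl⟩ : ∃ m, k = m + 1 := ⟨k - 1, by omega⟩
  obtain ⟨F, hF⟩ := h.exists_finset_cylinders m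
  set t := i * c / β ^ (m + 1)
  have htβ : β ^ (m + 1) * t = i * c := mul_div_cancel₀ _ (pow_pos hβ _).ne'
  set G := Finset.image₂ (fun w j => β * w + (j : ℕ) * c) F (Finset.range (N + 1 - i))
  have hΓ : ∀ x, x ∈ Γ ↔ ∃ w ∈ G, ∃ y ∈ Γ ∪ (· + t) '' Γ, x = β ^ (m + 1) * y + w := by
    intro x
    constructor
    · intro hx
      obtain ⟨j, hj, y, hy, rfl⟩ := (h.mem_iff x).1 hx
      obtain ⟨w, hw, z, hz, rfl⟩ := (hF y).1 hy
      rcases Nat.lt_or_ge j (N + 1 - i) with hlt | hge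
      · exact ⟨_, Finset.mem_image₂.2 ⟨w, hw, j, Finset.mem_range.2 hlt, rfl⟩, z, Or.inl hz,
          by ring⟩
      · refine ⟨_, Finset.mem_image₂.2 ⟨w, hw, j - i, Finset.mem_range.2 (by omega), rfl⟩, z + t,
          Or.inr ⟨z, hz, rfl⟩, ?_⟩
        push_cast [Nat.cast_sub (show i ≤ j by omega)]
        linear_combination -htβ
    · rintro ⟨_, hv, y, hy, rfl⟩
      obtain ⟨w, hw, j, hj, rfl⟩ := Finset.mem_image₂.1 hv
      rw [Finset.mem_range] at hj
      rcases hy with hy | ⟨y, hy, rfl⟩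
      · convert h.map_mem (i := j) (by omega) ((hF _).2 ⟨w, hw, y, hy, rfl⟩) using 1
        ring
      · convert h.map_mem (i := j + i) (by omega) ((hF _).2 ⟨w, hw, y, hy, rfl⟩) using 1
        push_cast
        linear_combination htβ
  have hne : (Γ ∪ (· + t) '' Γ).Nonempty := h.nonempty.inl
  have hFG : ∀ x, x ∈ Γ ∪ (· + t) '' Γ ↔ ∃ w ∈ G ∪ G.image (· + t), ∃ y ∈ Γ ∪ (· + t) '' Γ,
      x = β ^ (m + 1) * y + w := by
    intro x
    constructor
    · rintro (hx | ⟨x, hx, rfl⟩)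
      · obtain ⟨w, hw, y, hy, rfl⟩ := (hΓ x).1 hx
        exact ⟨w, Finset.mem_union_left _ hw, y, hy, rfl⟩
      · obtain ⟨w, hw, y, hy, rfl⟩ := (hΓ x).1 hx
        exact ⟨w + t, Finset.mem_union_right _ (Finset.mem_image_of_mem _ hw), y, hy, by ring⟩
    · rintro ⟨w, hw, y, hy, rfl⟩
      rcases Finset.mem_union.1 hw with hw | hw
      · exact Or.inl ((hΓ _).2 ⟨w, hw, y, hy, rfl⟩)
      · obtain ⟨v, hv, rfl⟩ := Finset.mem_image.1 hw
        exact Or.inr ⟨_, (hΓ _).2 ⟨v, hv, y, hy, rfl⟩, by ring⟩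
  refine ⟨hne, h.isCompact.union (h.isCompact.image (by fun_prop)), _,
    fun _ => β ^ (m + 1), fun n => ((G ∪ G.image (· + t)).equivFin.symm n : ℝ), ?_, ?_, ?_⟩
  · obtain ⟨x, hx⟩ := hne
    obtain ⟨w, hw, -⟩ := (hFG x).1 hx
    exact Finset.card_pos.2 ⟨w, hw⟩
  · intro _
    rw [abs_of_pos (pow_pos hβ _)]
    exact ⟨(pow_pos hβ _).ne', pow_lt_one₀ hβ.le h.ratio_lt_one (by omega)⟩
  · ext x
    rw [hFG, Set.mem_iUnion]
    constructor
    · rintro ⟨w, hw, y, hy, rfl⟩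
      exact ⟨(G ∪ G.image (· + t)).equivFin ⟨w, hw⟩, y, hy, by simp⟩
    · rintro ⟨n, y, hy, rfl⟩
      exact ⟨_, ((G ∪ G.image (· + t)).equivFin.symm n).2, y, hy, rfl⟩

end IsDigitCantorSet

theorem sum_range_shift (β : ℝ) (f : ℕ → ℕ) (p q : ℕ) :
    ∑ j ∈ Finset.range (p + q), ((if q ≤ j then f (j - q) else 0 : ℕ) : ℝ) * β ^ (j + 1)
      = β * (β ^ q * ∑ j ∈ Finset.range p, (f j : ℝ) * β ^ j) := by
  rw [add_comm p q, Finset.sum_range_add, Finset.sum_eq_zero, zero_add, Finset.mul_sum,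
    Finset.mul_sum]
  · refine Finset.sum_congr rfl fun j _ => ?_
    rw [if_pos (Nat.le_add_right _ _), Nat.add_sub_cancel_left]
    ring
  · intro j hj
    rw [if_neg (by simpa using hj)]
    simp

/-- Uniqueness of expansions forces additions of expansions to be digitwise, without carries. -/
theorem digitwise_add {N : ℕ} {β : ℝ}
    (hB : ∀ (n : ℕ) (a b : Fin n → ℕ), (∀ k, a k ≤ 2 * N) → (∀ k, b k ≤ N) →
      (∑ k : Fin n, (a k : ℝ) * β ^ ((k : ℕ) + 1) =
        ∑ k : Fin n, (b k : ℝ) * β ^ ((k : ℕ) + 1)) → a = b)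
    (p q : ℕ) (e b b' : ℕ → ℕ) (he : ∀ j, e j ≤ N) (hb : ∀ j, b j ≤ N) (hb' : ∀ j, b' j ≤ N)
    (heq : β ^ q * ∑ j ∈ Finset.range p, (e j : ℝ) * β ^ j +
        β ^ p * ∑ j ∈ Finset.range q, (b j : ℝ) * β ^ j
      = β ^ p * ∑ j ∈ Finset.range q, (b' j : ℝ) * β ^ j) :
    ∀ s < p, e s ≠ 0 → p ≤ s + q ∧ b (s + q - p) + e s = b' (s + q - p) := by
  have key := hB (p + q)
    (fun j => (if q ≤ (j : ℕ) then e (j - q) else 0) + if p ≤ (j : ℕ) then b (j - p) else 0)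
    (fun j => if p ≤ (j : ℕ) then b' (j - p) else 0)
    (fun j => by
      have h1 := he (j - q)
      have h2 := hb (j - p)
      split_ifs <;> omega)
    (fun j => by
      have := hb' (j - p)
      split_ifs <;> omega)
    (by
      rw [Fin.sum_univ_eq_sum_range (fun j => (((if q ≤ j then e (j - q) else 0) +
          if p ≤ j then b (j - p) else 0 : ℕ) : ℝ) * β ^ (j + 1)),
        Fin.sum_univ_eq_sum_range (fun j => ((if p ≤ j then b' (j - p) else 0 : ℕ) : ℝ)
          * β ^ (j + 1))]
      simp only [Nat.cast_add, add_mul, Finset.sum_add_distrib]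
      rw [sum_range_shift, add_comm p q, sum_range_shift, sum_range_shift, ← mul_add, heq])
  intro s hs hes
  have hs := congrFun key ⟨s + q, by omega⟩
  dsimp only at hs
  rw [if_pos (Nat.le_add_left _ _), Nat.add_sub_cancel] at hs
  split_ifs at hs with hp
  · exact ⟨hp, by omega⟩
  · omega

theorem stmt_18 (N : ℕ) (hN : 0 < N) (β : ℝ) (hβ0 : 0 < β)
    (hβ1 : β < 1 / ((N : ℝ) + 1))
    (hB : ∀ (n : ℕ) (a b : Fin n → ℕ), (∀ k, a k ≤ 2 * N) → (∀ k, b k ≤ N) →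
      (∑ k : Fin n, (a k : ℝ) * β ^ ((k : ℕ) + 1) =
        ∑ k : Fin n, (b k : ℝ) * β ^ ((k : ℕ) + 1)) → a = b)
    (Γ : Set ℝ) (hne : Γ.Nonempty) (hcpt : IsCompact Γ)
    (hinv : Γ = ⋃ i : Fin (N + 1), (fun x => β * x + (i.1 : ℝ) * (1 - β) / N) '' Γ) :
    ∀ t : ℝ, 0 < t →
      (IsSelfSimilar (Γ ∪ (· + t) '' Γ) ↔
        ∃ i k : ℕ, 1 ≤ i ∧ i ≤ (N + 1) / 2 ∧ 1 ≤ k ∧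
          t = (i : ℝ) * (1 - β) / N / β ^ k) := by
  have hN' : (0 : ℝ) < N := by exact_mod_cast hN
  have h : IsDigitCantorSet N β ((1 - β) / N) Γ := by
    refine ⟨hN, hβ0, ?_, ?_, hne, hcpt, fun x => ?_⟩
    · rw [lt_div_iff₀ (by linarith)] at hβ1
      rw [lt_div_iff₀ hN']
      linarith
    · rw [mul_div_cancel₀ _ hN'.ne']
      ring
    · conv_lhs => rw [hinv]
      rw [Set.mem_iUnion]
      constructor
      · rintro ⟨i, y, hy, rfl⟩
        exact ⟨i, Nat.lt_succ_iff.1 i.2, y, hy, by rw [mul_div_assoc]⟩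
      · rintro ⟨i, hi, y, hy, rfl⟩
        exact ⟨⟨i, Nat.lt_succ_iff.2 hi⟩, y, hy, by rw [mul_div_assoc]⟩
  intro t ht
  constructor
  · intro hS
    obtain ⟨i, k, hi1, hi2, hk, hik⟩ := h.exists_single_digit (digitwise_add hB) ht hS
    exact ⟨i, k, hi1, hi2, hk, by rw [hik, mul_div_assoc (i : ℝ) (1 - β)]⟩
  · rintro ⟨i, k, -, hi, hk, rfl⟩
    rw [mul_div_assoc (i : ℝ)]
    exact h.isSelfSimilar_union hi hk
end
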